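/- Let d ≥ 2 and l ≥ 1 be an integer. Suppose Ω : ℝ^d \ {0} → ℝ is homogeneous of degree zero, ‖Ω‖_{L log⁺L(S^{d−1})} < ∞, and Ω satisfies the moment conditions ∫_{S^{d−1}} Ω(θ) θ^α dθ = 0 for every multi-index α with |α| = l. Let A : ℝ^d → ℝ be of class C^l with A_α := ∂^α A ∈ L^∞(ℝ^d) for every multi-index α with |α| = l, and set P_l(A,x,y) = A(x) − ∑_{|α|<l} (A_α(y)/α!) (x−y)^α. Let the Bajsanski–Coifman commutator be given for f ∈ C_c^∞(ℝ^d) by T_{Ω,A,l} f(x) = p.v. ∫_{ℝ^d} (Ω(x−y)/|x−y|^d) · (P_l(A,x,y)/|x−y|^l) · f(y) dy, assumed to exist a.e. for such f. Then there is a constant C depending only on d and l such that for all λ > 0 and f ∈ C_c^∞(ℝ^d), m({x ∈ ℝ^d : |T_{Ω,A,l} f(x)| > λ}) ≤ C λ^{−1} 𝒞_Ω (∑_{|α|=l} ‖A_α‖_∞) ‖f‖_{L¹}. -/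

import Mathlib

open MeasureTheory Metric Filter Topology ENNReal

noncomputable section

/-- The surface measure on the unit sphere `S^{d-1}` of `ℝ^d`. -/
def sphereMeasure (d : ℕ) :
    Measure (sphere (0 : EuclideanSpace ℝ (Fin d)) 1) :=
  (volume : Measure (EuclideanSpace ℝ (Fin d))).toSphere

/-- `‖Ω‖_{L¹(S^{d-1})}`. -/
def sphL1 (d : ℕ) (Ω : EuclideanSpace ℝ (Fin d) → ℝ) : ℝ :=
  ∫ θ : sphere (0 : EuclideanSpace ℝ (Fin d)) 1, |Ω θ| ∂(sphereMeasure d)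

/-- `‖Ω‖_{L log⁺ L(S^{d-1})} = ∫ |Ω| log(2+|Ω|)`. -/
def sphLlogL (d : ℕ) (Ω : EuclideanSpace ℝ (Fin d) → ℝ) : ℝ :=
  ∫ θ : sphere (0 : EuclideanSpace ℝ (Fin d)) 1,
    |Ω θ| * Real.log (2 + |Ω θ|) ∂(sphereMeasure d)

/-- The constant `𝒞_Ω`. -/
def COmega (d : ℕ) (Ω : EuclideanSpace ℝ (Fin d) → ℝ) : ℝ :=
  sphLlogL d Ω +
    ∫ θ : sphere (0 : EuclideanSpace ℝ (Fin d)) 1,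
      |Ω θ| * (1 + max (Real.log (|Ω θ| / sphL1 d Ω)) 0) ∂(sphereMeasure d)

/-- Partial derivative in the `i`-th coordinate direction. -/
def pderivCoord (d : ℕ) (i : Fin d) (g : EuclideanSpace ℝ (Fin d) → ℝ) :
    EuclideanSpace ℝ (Fin d) → ℝ :=
  fun x => fderiv ℝ g x (EuclideanSpace.single i 1)

/-- The multi-index partial derivative `∂^α g`. -/
def mderiv (d : ℕ) (α : Fin d → ℕ) (g : EuclideanSpace ℝ (Fin d) → ℝ) :
    EuclideanSpace ℝ (Fin d) → ℝ :=
  ((List.finRange d).flatMap fun i => List.replicate (α i) i).foldr (pderivCoord d) g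

/-- The Taylor-type remainder `P_l(A,x,y) = A(x) - ∑_{|α|<l} (∂^α A)(y)/α! · (x-y)^α`. -/
def Pl (d l : ℕ) (A : EuclideanSpace ℝ (Fin d) → ℝ)
    (x y : EuclideanSpace ℝ (Fin d)) : ℝ :=
  A x - ∑ α ∈ Finset.univ.filter (fun α : Fin d → Fin l => (∑ i, (α i : ℕ)) < l),
    mderiv d (fun i => (α i : ℕ)) A y / (∏ i, (Nat.factorial (α i) : ℝ)) *
      ∏ i, (x i - y i) ^ (α i : ℕ)

/-- `∑_{|α| = l} ‖∂^α A‖_∞`. -/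
def sumSupDeriv (d l : ℕ) (A : EuclideanSpace ℝ (Fin d) → ℝ) : ℝ :=
  ∑ α ∈ Finset.univ.filter (fun α : Fin d → Fin (l + 1) => (∑ i, (α i : ℕ)) = l),
    ⨆ x : EuclideanSpace ℝ (Fin d), |mderiv d (fun i => (α i : ℕ)) A x|

section Plancherel

open scoped FourierTransform SchwartzMap

variable {V : Type*} [NormedAddCommGroup V] [InnerProductSpace ℝ V] [FiniteDimensional ℝ V]
  [MeasurableSpace V] [BorelSpace V]

/-- The `L²` Fourier transform agrees with the Fourier integral on `L¹ ∩ L²`. -/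
theorem fourier_toLp_ae_eq {f : V → ℂ} (hf : Integrable f) (hf2 : MemLp f 2) :
    ((𝓕 (hf2.toLp f) : Lp ℂ 2 (volume : Measure V)) : V → ℂ) =ᵐ[volume] 𝓕 f := by
  have hcont : Continuous (𝓕 f) :=
    VectorFourier.fourierIntegral_continuous Real.continuous_fourierChar
      (by exact continuous_inner) hf
  apply ae_eq_of_integral_contDiff_smul_eq
  · exact (Lp.memLp (𝓕 (hf2.toLp f) : Lp ℂ 2 (volume : Measure V))).locallyIntegrable (by norm_num)
  · exact hcont.locallyIntegrable
  intro g hg hgc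
  have hg₁ : HasCompactSupport (Complex.ofRealCLM ∘ g) := hgc.comp_left rfl
  have hg₂ : ContDiff ℝ (⊤ : ℕ∞) (Complex.ofRealCLM ∘ g) := by fun_prop
  set φ : 𝓢(V, ℂ) := hg₁.toSchwartzMap hg₂ with hφ
  have hφg : ∀ x, φ x = (g x : ℂ) := fun x => rfl
  have h1 : ∫ x, g x • (𝓕 (hf2.toLp f) : Lp ℂ 2 (volume : Measure V)) x
      = Lp.toTemperedDistribution (𝓕 (hf2.toLp f)) φ := by
    rw [Lp.toTemperedDistribution_apply]
    refine integral_congr_ae (Eventually.of_forall fun x => ?_)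
    simp [hφg]
  rw [h1, ← Lp.fourier_toTemperedDistribution_eq, TemperedDistribution.fourier_apply,
    Lp.toTemperedDistribution_apply]
  have h2 : ∫ x, (𝓕 φ) x • (hf2.toLp f : Lp ℂ 2 (volume : Measure V)) x
      = ∫ x, (𝓕 φ) x • f x := by
    refine integral_congr_ae ?_
    filter_upwards [hf2.coeFn_toLp] with x hx
    rw [hx]
  rw [h2]
  have h3 := VectorFourier.integral_fourierIntegral_smul_eq_flip (μ := (volume : Measure V))
    (ν := (volume : Measure V)) (L := innerₗ V)
    (f := fun x => φ x) (g := f) Real.continuous_fourierChar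
    (by exact continuous_inner) φ.integrable hf
  have h4 : (innerₗ V).flip = innerₗ V := by
    ext x y; simp
  rw [h4] at h3
  refine Eq.trans ?_ (h3.trans ?_)
  · rfl
  · refine integral_congr_ae (Eventually.of_forall fun x => ?_)
    simp only [hφg, Real.fourier_eq]
    rfl

theorem lintegral_enorm_sq_fourier {f : V → ℂ} (hf : Integrable f) (hf2 : MemLp f 2) :
    ∫⁻ ξ, ‖𝓕 f ξ‖ₑ ^ 2 = ∫⁻ x, ‖f x‖ₑ ^ 2 := by
  have hnorm : eLpNorm (𝓕 f) 2 volume = eLpNorm f 2 volume := by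
    rw [← eLpNorm_congr_ae (fourier_toLp_ae_eq hf hf2), ← eLpNorm_congr_ae hf2.coeFn_toLp,
      ← Lp.enorm_def, ← Lp.enorm_def]
    rw [← ofReal_norm, ← ofReal_norm, Lp.norm_fourier_eq]
  have key : ∀ g : V → ℂ, ∫⁻ ξ, ‖g ξ‖ₑ ^ 2 = eLpNorm g 2 volume ^ 2 := by
    intro g
    rw [eLpNorm_eq_lintegral_rpow_enorm_toReal (by norm_num) (by norm_num)]
    rw [← ENNReal.rpow_natCast, ← ENNReal.rpow_mul]
    simp
  rw [key, key, hnorm]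

end Plancherel

section Tube

variable {V : Type*} [NormedAddCommGroup V] [InnerProductSpace ℝ V]

/-- The `b`-neighbourhood of the segment `{t • v : |t| ≤ a}`. -/
def tube (v : V) (a b : ℝ) : Set V := {z | ∃ t : ℝ, |t| ≤ a ∧ ‖z - t • v‖ ≤ b}

theorem sub_mem_tube {v x c c' : V} {a b a' b' : ℝ} (h : x - c ∈ tube v a b)
    (h' : x - c' ∈ tube v a' b') : c' - c ∈ tube v (a + a') (b + b') := by
  obtain ⟨t, ht, hb⟩ := h
  obtain ⟨t', ht', hb'⟩ := h'
  refine ⟨t - t', (abs_sub _ _).trans (add_le_add ht ht'), ?_⟩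
  have : c' - c - (t - t') • v = (x - c - t • v) - (x - c' - t' • v) := by
    rw [sub_smul]; abel
  rw [this]
  exact (norm_sub_le _ _).trans (add_le_add hb hb')

theorem add_mem_tube {v z w : V} {a b e : ℝ} (h : z ∈ tube v a b) (hw : ‖w‖ ≤ e) :
    z + w ∈ tube v a (b + e) := by
  obtain ⟨t, ht, hb⟩ := h
  refine ⟨t, ht, ?_⟩
  have : z + w - t • v = (z - t • v) + w := by abel
  rw [this]
  exact (norm_add_le _ _).trans (add_le_add hb hw)

theorem tube_mono {v : V} {a b a' b' : ℝ} (ha : a ≤ a') (hb : b ≤ b') :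
    tube v a b ⊆ tube v a' b' := fun _ ⟨t, h1, h2⟩ => ⟨t, h1.trans ha, h2.trans hb⟩

variable [FiniteDimensional ℝ V]

theorem isCompact_tube (v : V) (a b : ℝ) : IsCompact (tube v a b) := by
  have : tube v a b =
      Set.image (fun p : ℝ × V => p.1 • v + p.2) (Set.Icc (-a) a ×ˢ closedBall 0 b) := by
    ext z
    constructor
    · rintro ⟨t, ht, hb⟩
      exact ⟨(t, z - t • v), ⟨abs_le.mp ht, by simpa using hb⟩, by simp⟩
    · rintro ⟨⟨t, w⟩, ⟨ht, hw⟩, rfl⟩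
      exact ⟨t, abs_le.mpr ht, by simpa using hw⟩
  rw [this]
  exact (isCompact_Icc.prod (isCompact_closedBall _ _)).image (by fun_prop)

variable [MeasurableSpace V] [BorelSpace V]

theorem measurableSet_tube (v : V) (a b : ℝ) : MeasurableSet (tube v a b) :=
  (isCompact_tube v a b).measurableSet

variable (V) in
theorem volume_tube_le (K : ℝ) (hK : 0 < K) : ∃ C : ℝ, 0 < C ∧ ∀ (v : V) (a b : ℝ), ‖v‖ ≤ 2 →
    0 < b → b ≤ K * a →
    volume (tube v a b) ≤ ENNReal.ofReal (C * (a / b) * b ^ Module.finrank ℝ V) := by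
  set n := Module.finrank ℝ V
  set ω := (volume (ball (0 : V) 1)).toReal with hω
  have hωtop : volume (ball (0 : V) 1) ≠ ∞ := measure_ball_lt_top.ne
  have hωpos : 0 < ω := ENNReal.toReal_pos (measure_ball_pos _ _ one_pos).ne' hωtop
  refine ⟨(2 + 3 * K) * 4 ^ n * ω, by positivity, fun v a b hv hb hab => ?_⟩
  have ha : 0 < a := by
    by_contra h
    nlinarith
  set N : ℕ := ⌈a / b⌉₊ with hN
  have hsub : tube v a b ⊆ ⋃ k ∈ Finset.Icc (-(N : ℤ)) N, ball (((k : ℝ) * b) • v) (4 * b) := by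
    rintro z ⟨t, ht, hz⟩
    have htb : |t / b| ≤ a / b := by rw [abs_div, abs_of_pos hb]; gcongr
    have hNa : a / b ≤ N := Nat.le_ceil _
    have habs := abs_le.mp (htb.trans hNa)
    simp only [Set.mem_iUnion]
    refine ⟨round (t / b), ?_, ?_⟩
    · rw [Finset.mem_Icc]
      constructor
      · rw [round_eq, Int.le_floor]
        push_cast
        linarith [habs.1]
      · rw [round_eq, Int.floor_le_iff]
        push_cast
        linarith [habs.2]
    · rw [mem_ball_iff_norm]
      have h1 : z - ((round (t / b) : ℝ) * b) • v
          = (z - t • v) + ((t / b - round (t / b)) * b) • v := by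
        have : (t / b - round (t / b)) * b = t - round (t / b) * b := by field_simp
        rw [this, sub_smul]; abel
      rw [h1]
      have h2 : ‖((t / b - round (t / b)) * b) • v‖ ≤ 1 / 2 * b * 2 := by
        rw [norm_smul, norm_mul, Real.norm_eq_abs, Real.norm_eq_abs, abs_of_pos hb]
        gcongr
        exact abs_sub_round _
      calc _ ≤ b + 1 / 2 * b * 2 := (norm_add_le _ _).trans (add_le_add hz h2)
        _ < 4 * b := by linarith
  refine (measure_mono hsub).trans ((measure_biUnion_finset_le _ _).trans ?_)
  simp only [Measure.addHaar_ball_of_pos volume _ (by positivity : (0 : ℝ) < 4 * b)]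
  rw [Finset.sum_const, Int.card_Icc, nsmul_eq_mul]
  rw [← ENNReal.ofReal_toReal hωtop, ← hω, ← ENNReal.ofReal_natCast,
    ← ENNReal.ofReal_mul (by positivity), ← ENNReal.ofReal_mul (by positivity)]
  apply ENNReal.ofReal_le_ofReal
  have hc : (((N : ℤ) + 1 - -(N : ℤ)).toNat : ℝ) = 2 * N + 1 := by
    have : ((N : ℤ) + 1 - -(N : ℤ)).toNat = 2 * N + 1 := by omega
    rw [this]; push_cast; ring
  have hN2 : (N : ℝ) ≤ a / b + 1 := (Nat.ceil_lt_add_one (by positivity)).le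
  have hKab : 1 ≤ K * (a / b) := by
    rw [← mul_div_assoc, le_div_iff₀ hb]; linarith
  rw [hc, mul_pow]
  calc (2 * (N : ℝ) + 1) * (4 ^ n * b ^ n * ω) ≤ ((2 + 3 * K) * (a / b)) * (4 ^ n * b ^ n * ω) := by
        gcongr; nlinarith
    _ = _ := by ring

variable (V) in
/-- Christ's `L²` estimate for a sum of normalised indicators of tubes around disjoint balls. -/
theorem lintegral_sum_tube_sq_le (K : ℝ) (hK : 1 ≤ K) : ∃ C : ℝ, 0 < C ∧
    ∀ {ι : Type} (s : Finset ι) (r β : ι → ℝ) (c : ι → V) (δ α : ℝ) (v : V),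
      0 < δ → δ ≤ 1 → 0 ≤ α → ‖v‖ ≤ 2 → (∀ i ∈ s, 0 < r i) →
      (∀ i ∈ s, 0 ≤ β i ∧ β i ≤ α * (δ * r i) ^ Module.finrank ℝ V) →
      ((s : Set ι).PairwiseDisjoint fun i => ball (c i) (δ * r i / 2)) →
      ∫⁻ x, (∑ i ∈ s, ENNReal.ofReal (β i / r i ^ Module.finrank ℝ V) *
          (tube v (2 * r i) (K * δ * r i)).indicator 1 (x - c i)) ^ 2
        ≤ ENNReal.ofReal (C * (δ ^ Module.finrank ℝ V / δ) ^ 2 * α * ∑ i ∈ s, β i) := by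
  obtain ⟨C₁, hC₁, hvol⟩ := volume_tube_le V (K + 1) (by linarith)
  set n := Module.finrank ℝ V with hn
  set ω := (volume (ball (0 : V) 1)).toReal with hω
  have hωtop : volume (ball (0 : V) 1) ≠ ∞ := measure_ball_lt_top.ne
  have hωpos : 0 < ω := ENNReal.toReal_pos (measure_ball_pos _ _ one_pos).ne' hωtop
  set A₁ := C₁ * (2 / K) * K ^ n with hA₁
  set A₂ := C₁ * (4 / (2 * K + 1)) * (2 * K + 1) ^ n with hA₂
  have hA₁p : 0 < A₁ := by positivity
  have hA₂p : 0 < A₂ := by positivity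
  refine ⟨2 * (A₁ * (2 ^ n / ω * A₂)), by positivity, ?_⟩
  intro ι s r β c δ α v hδ hδ1 hα hv hr hβ hdisj
  classical
  set T : ι → Set V := fun i => (fun x => x - c i) ⁻¹' tube v (2 * r i) (K * δ * r i) with hT
  have hTm : ∀ i, MeasurableSet (T i) := fun i =>
    (measurableSet_tube v _ _).preimage (by fun_prop)
  set w : ι → ℝ≥0∞ := fun i => ENNReal.ofReal (β i / r i ^ n) with hw
  have hvolT : ∀ i ∈ s, volume (T i) ≤ ENNReal.ofReal (A₁ * (δ ^ n / δ) * r i ^ n) := by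
    intro i hi
    have hri := hr i hi
    simp only [hT, sub_eq_add_neg, measure_preimage_add_right]
    refine (hvol v (2 * r i) (K * δ * r i) hv (by positivity) ?_).trans
      (ENNReal.ofReal_le_ofReal (le_of_eq ?_))
    · have : K * δ * r i ≤ K * 1 * r i := by gcongr
      nlinarith
    · rw [hA₁, mul_pow, mul_pow]
      field_simp
  have hexp : ∀ x, (∑ i ∈ s, w i * (tube v (2 * r i) (K * δ * r i)).indicator 1 (x - c i)) ^ 2
      = ∑ i ∈ s, ∑ j ∈ s, w i * w j * (T i ∩ T j).indicator 1 x := by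
    intro x
    rw [sq, Finset.sum_mul_sum]
    refine Finset.sum_congr rfl fun i _ => Finset.sum_congr rfl fun j _ => ?_
    have : ∀ i, (tube v (2 * r i) (K * δ * r i)).indicator (1 : V → ℝ≥0∞) (x - c i)
        = (T i).indicator 1 x := fun i => rfl
    rw [this, this, Set.inter_indicator_one, Pi.mul_apply]
    ring
  have hint : ∫⁻ x, (∑ i ∈ s, w i * (tube v (2 * r i) (K * δ * r i)).indicator 1 (x - c i)) ^ 2
      = ∑ i ∈ s, ∑ j ∈ s, w i * w j * volume (T i ∩ T j) := by
    simp_rw [hexp]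
    rw [lintegral_finsetSum _ fun i _ => by
      refine Finset.measurable_sum _ fun j _ => ?_
      exact (measurable_one.indicator ((hTm i).inter (hTm j))).const_mul _]
    refine Finset.sum_congr rfl fun i _ => ?_
    rw [lintegral_finsetSum _ fun j _ =>
      (measurable_one.indicator ((hTm i).inter (hTm j))).const_mul _]
    refine Finset.sum_congr rfl fun j _ => ?_
    rw [lintegral_const_mul _ (measurable_one.indicator ((hTm i).inter (hTm j))),
      lintegral_indicator_one ((hTm i).inter (hTm j))]
  set a : ι → ι → ℝ≥0∞ := fun i j => w i * w j * volume (T i ∩ T j) with ha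
  have hasymm : ∀ i j, a i j = a j i := fun i j => by
    simp only [ha]; rw [Set.inter_comm, mul_comm (w i)]
  have hhalf : ∑ i ∈ s, ∑ j ∈ s, a i j ≤ 2 * ∑ i ∈ s, ∑ j ∈ s with r j ≤ r i, a i j := by
    have h1 : ∑ i ∈ s, ∑ j ∈ s, a i j ≤ ∑ i ∈ s, ∑ j ∈ s,
        ((if r j ≤ r i then a i j else 0) + (if r i ≤ r j then a j i else 0)) := by
      refine Finset.sum_le_sum fun i _ => Finset.sum_le_sum fun j _ => ?_
      rcases le_total (r j) (r i) with h | h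
      · rw [if_pos h]; exact le_self_add
      · rw [if_pos h, hasymm j i]; exact le_add_self
    refine h1.trans (le_of_eq ?_)
    simp_rw [Finset.sum_add_distrib]
    rw [two_mul]
    congr 1
    · simp_rw [Finset.sum_filter]
    · rw [Finset.sum_comm]
      simp_rw [Finset.sum_filter]
  rw [hint]
  refine hhalf.trans ?_
  have hrow : ∀ i ∈ s, ∑ j ∈ s with r j ≤ r i, a i j
      ≤ ENNReal.ofReal ((A₁ * (2 ^ n / ω * A₂)) * (δ ^ n / δ) ^ 2 * α * β i) := by
    intro i hi
    have hri := hr i hi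
    set J := {j ∈ s | r j ≤ r i ∧ (T i ∩ T j).Nonempty} with hJ
    have hJs : ∀ j ∈ J, j ∈ s := fun j hj => (Finset.mem_filter.mp hj).1
    have h1 : ∑ j ∈ s with r j ≤ r i, a i j
        ≤ ∑ j ∈ J, w i * ENNReal.ofReal (A₁ * (δ ^ n / δ) * β j) := by
      have h2 : ∑ j ∈ s with r j ≤ r i, a i j = ∑ j ∈ J, a i j := by
        symm
        apply Finset.sum_subset
        · intro j hj
          simp only [hJ, Finset.mem_filter] at hj ⊢
          exact ⟨hj.1, hj.2.1⟩
        · intro j hj hj'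
          simp only [hJ, Finset.mem_filter] at hj hj'
          have : T i ∩ T j = ∅ := by
            by_contra hne
            exact hj' ⟨hj.1, hj.2, Set.nonempty_iff_ne_empty.mpr hne⟩
          simp [ha, this]
      rw [h2]
      refine Finset.sum_le_sum fun j hj => ?_
      have hjs := hJs j hj
      have hrj := hr j hjs
      simp only [ha]
      rw [mul_assoc]
      gcongr
      calc w j * volume (T i ∩ T j) ≤ w j * ENNReal.ofReal (A₁ * (δ ^ n / δ) * r j ^ n) := by
            gcongr
            exact (measure_mono Set.inter_subset_right).trans (hvolT j hjs)
        _ = _ := by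
            rw [hw, ← ENNReal.ofReal_mul (div_nonneg (hβ j hjs).1 (by positivity))]
            congr 1
            field_simp
    refine h1.trans ?_
    rw [← Finset.mul_sum, ← ENNReal.ofReal_sum_of_nonneg
      (fun j hj => mul_nonneg (by positivity) (hβ j (hJs j hj)).1), ← Finset.mul_sum]
    have hpack : ∑ j ∈ J, β j ≤ α * (2 ^ n / ω * (A₂ * (δ ^ n / δ) * r i ^ n)) := by
      have h3 : ∑ j ∈ J, β j ≤ α * ∑ j ∈ J, (δ * r j) ^ n := by
        rw [Finset.mul_sum]
        exact Finset.sum_le_sum fun j hj => (hβ j (hJs j hj)).2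
      refine h3.trans (mul_le_mul_of_nonneg_left ?_ hα)
      have hball : ∀ j ∈ J, volume (ball (c j) (δ * r j / 2))
          = ENNReal.ofReal ((δ * r j) ^ n * (ω / 2 ^ n)) := by
        intro j hj
        have hrj := hr j (hJs j hj)
        rw [Measure.addHaar_ball_of_pos volume _ (by positivity), ← ENNReal.ofReal_toReal hωtop, ← hω,
          ← ENNReal.ofReal_mul (by positivity), div_pow]
        congr 1; ring
      have hsub : (⋃ j ∈ J, ball (c j) (δ * r j / 2)) ⊆
          (fun x => x - c i) ⁻¹' tube v (4 * r i) ((2 * K + 1) * δ * r i) := by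
        intro x hx
        simp only [Set.mem_iUnion] at hx
        obtain ⟨j, hj, hxj⟩ := hx
        have hj' := (Finset.mem_filter.mp hj).2
        obtain ⟨y, hyi, hyj⟩ := hj'.2
        have hrj := hr j (hJs j hj)
        have h4 : c j - c i ∈ tube v (2 * r i + 2 * r j) (K * δ * r i + K * δ * r j) :=
          sub_mem_tube hyi hyj
        have h5 : ‖x - c j‖ ≤ δ * r j / 2 := (mem_ball_iff_norm.mp hxj).le
        have h6 := add_mem_tube h4 h5
        have h7 : c j - c i + (x - c j) = x - c i := by abel
        rw [h7] at h6
        refine tube_mono ?_ ?_ h6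
        · linarith [hj'.1]
        · have h8 : K * δ * r j ≤ K * δ * r i := by gcongr; exact hj'.1
          have h9 : δ * r j ≤ δ * r i := by gcongr; exact hj'.1
          nlinarith [mul_pos hδ hri]
      have h10 : ∑ j ∈ J, volume (ball (c j) (δ * r j / 2))
          ≤ ENNReal.ofReal (A₂ * (δ ^ n / δ) * r i ^ n) := by
        rw [← measure_biUnion_finset (hdisj.subset (by
          intro j hj; exact hJs j hj)) (fun j _ => measurableSet_ball)]
        refine (measure_mono hsub).trans ?_
        simp only [sub_eq_add_neg, measure_preimage_add_right]
        refine (hvol v _ _ hv (by positivity) ?_).trans (ENNReal.ofReal_le_ofReal (le_of_eq ?_))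
        · have : (2 * K + 1) * δ * r i ≤ (2 * K + 1) * 1 * r i := by gcongr
          nlinarith
        · rw [hA₂, mul_pow, mul_pow]
          field_simp
      rw [Finset.sum_congr rfl hball, ← ENNReal.ofReal_sum_of_nonneg (fun j hj => by
        have hrj := hr j (hJs j hj)
        positivity), ENNReal.ofReal_le_ofReal_iff (by positivity), ← Finset.sum_mul] at h10
      have hc : (2 ^ n / ω) * (ω / 2 ^ n) = 1 := by field_simp
      calc ∑ j ∈ J, (δ * r j) ^ n
          = (2 ^ n / ω) * ((∑ j ∈ J, (δ * r j) ^ n) * (ω / 2 ^ n)) := by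
            rw [mul_left_comm, hc, mul_one]
        _ ≤ _ := by gcongr
    rw [hw, ← ENNReal.ofReal_mul (div_nonneg (hβ i hi).1 (by positivity))]
    apply ENNReal.ofReal_le_ofReal
    have hβi := (hβ i hi).1
    calc β i / r i ^ n * (A₁ * (δ ^ n / δ) * ∑ j ∈ J, β j)
        ≤ β i / r i ^ n * (A₁ * (δ ^ n / δ) *
          (α * (2 ^ n / ω * (A₂ * (δ ^ n / δ) * r i ^ n)))) := by gcongr
      _ = _ := by field_simp
  calc 2 * ∑ i ∈ s, ∑ j ∈ s with r j ≤ r i, a i j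
      ≤ 2 * ∑ i ∈ s, ENNReal.ofReal ((A₁ * (2 ^ n / ω * A₂)) * (δ ^ n / δ) ^ 2 * α * β i) := by
        gcongr with i hi; exact hrow i hi
    _ = _ := by
        rw [← ENNReal.ofReal_sum_of_nonneg (fun i hi => mul_nonneg (by positivity) (hβ i hi).1),
          ← Finset.mul_sum, show (2 : ℝ≥0∞) = ENNReal.ofReal 2 by simp,
          ← ENNReal.ofReal_mul (by norm_num)]
        congr 1; ring

end Tube

section Annulus

open scoped Pointwise

variable (V : Type*) [NormedAddCommGroup V] [InnerProductSpace ℝ V] [FiniteDimensional ℝ V]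
  [MeasurableSpace V] [BorelSpace V]

theorem volume_slab_le : ∃ C : ℝ, 0 < C ∧ ∀ (u : V) (ρ : ℝ), ‖u‖ = 1 → 0 < ρ →
    volume (ball (0 : V) 3 ∩ {v | |inner ℝ v u| ≤ ρ}) ≤ ENNReal.ofReal (C * ρ) := by
  set ω := (volume (ball (0 : V) 6)).toReal with hω
  have hωtop : volume (ball (0 : V) 6) ≠ ∞ := measure_ball_lt_top.ne
  have hωpos : 0 < ω := ENNReal.toReal_pos (measure_ball_pos _ _ (by norm_num)).ne' hωtop
  refine ⟨ω, hωpos, fun u ρ hu hρ => ?_⟩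
  set B := ball (0 : V) 3 ∩ {v | |inner ℝ v u| ≤ ρ} with hB
  have hBm : MeasurableSet B := measurableSet_ball.inter
    (isClosed_le (by fun_prop) continuous_const).measurableSet
  have huu : inner ℝ u u = (1 : ℝ) := by rw [real_inner_self_eq_norm_sq, hu]; norm_num
  set N : ℕ := ⌈1 / ρ⌉₊ with hN
  have hN1 : 1 / ρ ≤ N := Nat.le_ceil _
  have hNpos : (0 : ℝ) < N := lt_of_lt_of_le (by positivity) hN1
  set t : ℕ → V := fun k => (3 * ρ * k) • u
  have hdisj : ((Finset.range N : Finset ℕ) : Set ℕ).PairwiseDisjoint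
      fun k => (fun x => x + -t k) ⁻¹' B := by
    intro j _ k _ hjk
    refine Set.disjoint_left.mpr fun x hx hx' => hjk ?_
    have h1 := hx.2
    have h2 := hx'.2
    simp only [Set.mem_ofPred_eq, t, inner_add_left, inner_neg_left, inner_smul_left, huu,
      abs_le, mul_one, conj_trivial] at h1 h2
    have h3 : ((j : ℝ) - k) * (3 * ρ) ≤ 2 * ρ := by linarith [h1.1, h2.2]
    have h4 : ((k : ℝ) - j) * (3 * ρ) ≤ 2 * ρ := by linarith [h1.2, h2.1]
    have h5 : (j : ℝ) < k + 1 := by nlinarith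
    have h6 : (k : ℝ) < j + 1 := by nlinarith
    have h7 : j < k + 1 := by exact_mod_cast h5
    have h8 : k < j + 1 := by exact_mod_cast h6
    omega
  have hsub : (⋃ k ∈ Finset.range N, (fun x => x + -t k) ⁻¹' B) ⊆ ball (0 : V) 6 := by
    intro x hx
    simp only [Set.mem_iUnion, Finset.mem_range] at hx
    obtain ⟨k, hk, hx⟩ := hx
    have h1 := mem_ball_zero_iff.mp hx.1
    have h2 : ‖t k‖ ≤ 3 := by
      rw [norm_smul, hu, mul_one, Real.norm_of_nonneg (by positivity)]
      have h3 : (k : ℝ) + 1 ≤ N := by exact_mod_cast hk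
      have h4 : (N : ℝ) < 1 / ρ + 1 := Nat.ceil_lt_add_one (by positivity)
      have h5 : (k : ℝ) ≤ 1 / ρ := by linarith
      calc 3 * ρ * k ≤ 3 * ρ * (1 / ρ) := by gcongr
        _ = 3 := by field_simp
    rw [mem_ball_zero_iff]
    calc ‖x‖ = ‖(x + -t k) + t k‖ := by congr 1; abel
      _ ≤ ‖x + -t k‖ + ‖t k‖ := norm_add_le _ _
      _ < 6 := by linarith
  have h1 : (N : ℝ≥0∞) * volume B ≤ volume (ball (0 : V) 6) := by
    refine le_trans (le_of_eq ?_) (measure_mono hsub)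
    rw [measure_biUnion_finset hdisj fun k _ => hBm.preimage (by fun_prop)]
    simp [measure_preimage_add_right]
  have hBtop : volume B ≠ ∞ :=
    ((measure_mono Set.inter_subset_left).trans_lt measure_ball_lt_top).ne
  rw [← ENNReal.ofReal_toReal hBtop]
  apply ENNReal.ofReal_le_ofReal
  have h2 := ENNReal.toReal_mono hωtop h1
  rw [ENNReal.toReal_mul, ENNReal.toReal_natCast, ← hω] at h2
  have h3 : 1 ≤ ρ * N := by
    rw [div_le_iff₀ hρ] at hN1; linarith
  have h4 : 0 ≤ (volume B).toReal := ENNReal.toReal_nonneg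
  calc (volume B).toReal ≤ (ρ * N) * (volume B).toReal := le_mul_of_one_le_left h4 h3
    _ = ρ * (N * (volume B).toReal) := by ring
    _ ≤ ω * ρ := by rw [mul_comm ω]; gcongr

theorem pow_sub_pow_le_mul_sub {a b : ℝ} (hb : 0 ≤ b) (hab : b ≤ a) (ha : a ≤ 2) (n : ℕ) :
    a ^ n - b ^ n ≤ n * 2 ^ n * (a - b) := by
  induction n with
  | zero => simp
  | succ n ih =>
    have h1 : a ^ (n + 1) - b ^ (n + 1) = a * (a ^ n - b ^ n) + b ^ n * (a - b) := by ring
    have h2 : 0 ≤ a ^ n - b ^ n := sub_nonneg.mpr (pow_le_pow_left₀ hb hab n)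
    have h3 : b ^ n ≤ 2 ^ n := pow_le_pow_left₀ hb (hab.trans ha) n
    have h4 : 0 ≤ a - b := sub_nonneg.mpr hab
    have h5 : (0 : ℝ) < 2 ^ n := by positivity
    rw [h1]
    push_cast
    calc a * (a ^ n - b ^ n) + b ^ n * (a - b)
        ≤ 2 * (n * 2 ^ n * (a - b)) + 2 ^ n * (a - b) := by gcongr
      _ ≤ (n + 1) * 2 ^ (n + 1) * (a - b) := by
        rw [pow_succ]; nlinarith [mul_nonneg h5.le h4]

/-- The part of a thin annulus that is close to a hyperplane is small. -/
theorem volume_annulus_band_le : ∃ C : ℝ, 0 < C ∧ ∀ (ξ : V) (δ ρ : ℝ), ξ ≠ 0 → 0 < δ → δ ≤ 1 →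
    0 < ρ → volume {v : V | |‖v‖ - 1| ≤ δ ∧ |inner ℝ v ξ| ≤ ρ * ‖ξ‖}
      ≤ ENNReal.ofReal (C * δ * ρ) := by
  obtain ⟨C₁, hC₁, hslab⟩ := volume_slab_le V
  set n := Module.finrank ℝ V with hn
  refine ⟨4 * C₁ + n * 2 ^ n * 3 * (C₁ * 4), by positivity, fun ξ δ ρ hξ hδ hδ1 hρ => ?_⟩
  have hξ' : 0 < ‖ξ‖ := norm_pos_iff.mpr hξ
  set u : V := ‖ξ‖⁻¹ • ξ with hu
  have hu1 : ‖u‖ = 1 := norm_smul_inv_norm hξ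
  have hinner : ∀ v : V, inner ℝ v ξ = ‖ξ‖ * inner ℝ v u := fun v => by
    rw [hu, inner_smul_right]; field_simp
  have hband : ∀ v : V, |inner ℝ v ξ| ≤ ρ * ‖ξ‖ ↔ |inner ℝ v u| ≤ ρ := fun v => by
    rw [hinner, abs_mul, abs_of_pos hξ', mul_comm, mul_le_mul_iff_left₀ hξ']
  simp_rw [hband]
  have hterm : 0 ≤ (n : ℝ) * 2 ^ n * 3 * (C₁ * 4) * δ * ρ := by positivity
  rcases le_or_gt (1 / 4) δ with hδ4 | hδ4
  · have hsub : {v : V | |‖v‖ - 1| ≤ δ ∧ |inner ℝ v u| ≤ ρ} ⊆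
        ball (0 : V) 3 ∩ {v | |inner ℝ v u| ≤ ρ} := by
      rintro v ⟨h1, h2⟩
      exact ⟨by rw [mem_ball_zero_iff]; linarith [(abs_le.mp h1).2], h2⟩
    refine (measure_mono hsub).trans ((hslab u ρ hu1 hρ).trans (ENNReal.ofReal_le_ofReal ?_))
    have : C₁ * ρ * 1 ≤ C₁ * ρ * (4 * δ) := by gcongr; linarith
    nlinarith
  · set S : Set V := {v | |inner ℝ v u| ≤ 4 * ρ * ‖v‖} with hS
    set m : ℝ := (volume (S ∩ ball 0 1)).toReal with hm
    have hmtop : volume (S ∩ ball 0 1) ≠ ∞ :=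
      ((measure_mono Set.inter_subset_right).trans_lt measure_ball_lt_top).ne
    have hSm : MeasurableSet S := (isClosed_le (by fun_prop) (by fun_prop)).measurableSet
    have hscale : ∀ t : ℝ, 0 < t → volume (S ∩ ball 0 t) = ENNReal.ofReal (t ^ n * m) := by
      intro t ht
      have h1 : S ∩ ball 0 t = t • (S ∩ ball (0 : V) 1) := by
        ext x
        rw [Set.mem_smul_set_iff_inv_smul_mem₀ ht.ne']
        simp only [hS, Set.mem_inter_iff, Set.mem_ofPred_eq, mem_ball_zero_iff, norm_smul, norm_inv,
          inner_smul_left, conj_trivial, abs_mul, abs_inv, Real.norm_eq_abs, abs_of_pos ht]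
        have h2 : t⁻¹ * |inner ℝ x u| ≤ 4 * ρ * (t⁻¹ * ‖x‖) ↔ |inner ℝ x u| ≤ 4 * ρ * ‖x‖ := by
          rw [mul_left_comm, mul_le_mul_iff_right₀ (by positivity)]
        have h3 : t⁻¹ * ‖x‖ < 1 ↔ ‖x‖ < t := by
          rw [inv_mul_lt_iff₀ ht, mul_one]
        rw [h2, h3]
      rw [h1, Measure.addHaar_smul, abs_of_pos (by positivity),
        ENNReal.ofReal_mul (by positivity), ENNReal.ofReal_toReal hmtop]
    have hm_le : m ≤ C₁ * (4 * ρ) := by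
      have h1 : S ∩ ball 0 1 ⊆ ball (0 : V) 3 ∩ {v | |inner ℝ v u| ≤ 4 * ρ} := by
        rintro v ⟨h1, h2⟩
        rw [mem_ball_zero_iff] at h2
        refine ⟨by rw [mem_ball_zero_iff]; linarith, (show |inner ℝ v u| ≤ 4 * ρ * ‖v‖ from h1).trans ?_⟩
        nlinarith
      have h2 := (measure_mono h1).trans (hslab u (4 * ρ) hu1 (by positivity))
      exact ENNReal.toReal_le_of_le_ofReal (by positivity) h2
    have hsub : {v : V | |‖v‖ - 1| ≤ δ ∧ |inner ℝ v u| ≤ ρ} ⊆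
        (S ∩ ball 0 (1 + 2 * δ)) \ (S ∩ ball 0 (1 - δ)) := by
      rintro v ⟨h1, h2⟩
      have h3 := abs_le.mp h1
      refine ⟨⟨?_, ?_⟩, fun h => ?_⟩
      · simp only [hS, Set.mem_ofPred_eq]; nlinarith
      · rw [mem_ball_zero_iff]; linarith
      · have := mem_ball_zero_iff.mp h.2; linarith
    refine (measure_mono hsub).trans ?_
    have hfin : volume (S ∩ ball 0 (1 - δ)) ≠ ∞ := by
      rw [hscale _ (by linarith)]; exact ENNReal.ofReal_ne_top
    rw [measure_sdiff (Set.inter_subset_inter_right _ (ball_subset_ball (by linarith)))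
      (hSm.inter measurableSet_ball).nullMeasurableSet hfin, hscale _ (by linarith),
      hscale _ (by linarith), ← ENNReal.ofReal_sub _ (by
        have : 0 ≤ 1 - δ := by linarith
        positivity)]
    apply ENNReal.ofReal_le_ofReal
    have h1 := pow_sub_pow_le_mul_sub (a := 1 + 2 * δ) (b := 1 - δ) (by linarith) (by linarith)
      (by linarith) n
    have hm0 : 0 ≤ m := ENNReal.toReal_nonneg
    rw [show 1 + 2 * δ - (1 - δ) = 3 * δ by ring] at h1
    calc (1 + 2 * δ) ^ n * m - (1 - δ) ^ n * m = ((1 + 2 * δ) ^ n - (1 - δ) ^ n) * m := by ring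
      _ ≤ (n * 2 ^ n * (3 * δ)) * (C₁ * (4 * ρ)) := by gcongr
      _ = n * 2 ^ n * 3 * (C₁ * 4) * δ * ρ := by ring
      _ ≤ _ := by
        have : 0 ≤ 4 * C₁ * δ * ρ := by positivity
        linarith

end Annulus

section CauchySchwarz

theorem lintegral_sq_le {α : Type*} [MeasurableSpace α] (μ : Measure α) {f : α → ℝ≥0∞}
    (hf : AEMeasurable f μ) : (∫⁻ x, f x ∂μ) ^ 2 ≤ μ Set.univ * ∫⁻ x, f x ^ 2 ∂μ := by
  have h := ENNReal.lintegral_mul_le_Lp_mul_Lq μ Real.HolderConjugate.two_two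
    (f := fun _ => 1) (g := f) aemeasurable_const hf
  simp only [Pi.mul_apply, one_mul, one_rpow, lintegral_const] at h
  calc (∫⁻ x, f x ∂μ) ^ 2 ≤ ((μ Set.univ) ^ (1 / 2 : ℝ) *
        (∫⁻ x, f x ^ (2 : ℝ) ∂μ) ^ (1 / 2 : ℝ)) ^ 2 := by gcongr
    _ = _ := by
      rw [mul_pow, ← ENNReal.rpow_natCast, ← ENNReal.rpow_natCast, ← ENNReal.rpow_mul,
        ← ENNReal.rpow_mul]
      norm_num

end CauchySchwarz

section FourierTube

open scoped FourierTransform RealInnerProductSpace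

variable {V : Type*} [NormedAddCommGroup V] [InnerProductSpace ℝ V] [FiniteDimensional ℝ V]
  [MeasurableSpace V] [BorelSpace V] {Y : Type*} [MeasurableSpace Y] {ν : Measure Y} [SFinite ν]

/-- The Fourier transform of the pushforward of the weight `w` under `p`. -/
def fourierPush (ν : Measure Y) (p : Y → V) (w : Y → ℂ) (ξ : V) : ℂ :=
  ∫ y, 𝐞 (-⟪p y, ξ⟫) • w y ∂ν

theorem integrable_conv_push {h : V → ℂ} (hm : Measurable h) (hi : Integrable h) {p : Y → V}
    (hp : Measurable p) {w : Y → ℂ} (hw : Integrable w ν) :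
    Integrable (fun z : V × Y => w z.2 * h (z.1 - p z.2)) (volume.prod ν) := by
  have hmeas : AEStronglyMeasurable (fun z : V × Y => w z.2 * h (z.1 - p z.2))
      (volume.prod ν) := by
    refine hw.aestronglyMeasurable.comp_snd.mul (Measurable.aestronglyMeasurable ?_)
    exact hm.comp (measurable_fst.sub (hp.comp measurable_snd))
  rw [integrable_prod_iff' hmeas]
  refine ⟨ae_of_all _ fun y => (hi.comp_sub_right (p y)).const_mul (w y), ?_⟩
  have : ∀ y, ∫ x, ‖w y * h (x - p y)‖ = ‖w y‖ * ∫ x, ‖h x‖ := fun y => by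
    simp_rw [norm_mul]
    rw [integral_const_mul, integral_sub_right_eq_self (fun x => ‖h x‖)]
  simp_rw [this]
  exact hw.norm.mul_const _

theorem fourier_conv_push {h : V → ℂ} (hm : Measurable h) (hi : Integrable h) {p : Y → V}
    (hp : Measurable p) {w : Y → ℂ} (hw : Integrable w ν) (ξ : V) :
    𝓕 (fun x => ∫ y, w y * h (x - p y) ∂ν) ξ = 𝓕 h ξ * fourierPush ν p w ξ := by
  have hint := integrable_conv_push hm hi hp hw
  rw [Real.fourier_eq]
  have h1 : ∀ x : V, 𝐞 (-⟪x, ξ⟫) • ∫ y, w y * h (x - p y) ∂ν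
      = ∫ y, 𝐞 (-⟪x, ξ⟫) • (w y * h (x - p y)) ∂ν := fun x => by
    simp_rw [Circle.smul_def, smul_eq_mul]
    exact (integral_const_mul _ _).symm
  simp_rw [h1]
  rw [integral_integral_swap]
  · have h2 : ∀ y, ∫ x, 𝐞 (-⟪x, ξ⟫) • (w y * h (x - p y)) = 𝓕 h ξ * (𝐞 (-⟪p y, ξ⟫) • w y) := by
      intro y
      rw [Real.fourier_eq, ← integral_mul_const, ← integral_sub_right_eq_self
        (fun x => 𝐞 (-⟪x, ξ⟫) • h x * (𝐞 (-⟪p y, ξ⟫) • w y)) (p y)]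
      refine integral_congr_ae (ae_of_all _ fun x => ?_)
      simp only [Circle.smul_def, smul_eq_mul]
      have : -⟪x, ξ⟫ = -⟪x - p y, ξ⟫ + -⟪p y, ξ⟫ := by rw [inner_sub_left]; ring
      rw [this, AddChar.map_add_eq_mul, Circle.coe_mul]
      ring
    simp_rw [h2]
    rw [integral_const_mul, fourierPush]
  · have hc : Measurable fun x : V => (𝐞 (-⟪x, ξ⟫) : ℂ) :=
      Continuous.measurable (by fun_prop)
    have h3 := hint.bdd_mul (c := 1) (f := fun z : V × Y => (𝐞 (-⟪z.1, ξ⟫) : ℂ))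
      (hc.comp measurable_fst).aestronglyMeasurable (ae_of_all _ fun z => (Circle.norm_coe _).le)
    exact h3.congr (ae_of_all _ fun z => rfl)

/-- A kernel supported in a tube, convolved with a weight close to the centre. -/
theorem enorm_conv_push_le {h : V → ℂ} {p : Y → V} {w : Y → ℂ} (hw : Integrable w ν)
    {v c : V} {a b e H W : ℝ} (hH : 0 ≤ H) (hh : ∀ z, ‖h z‖ ≤ H)
    (hsupp : ∀ z, h z ≠ 0 → z ∈ tube v a b) (hp : ∀ y, w y ≠ 0 → ‖p y - c‖ ≤ e)
    (hW : ∫ y, ‖w y‖ ∂ν ≤ W) (x : V) :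
    ‖∫ y, w y * h (x - p y) ∂ν‖ₑ ≤
      ENNReal.ofReal (H * W) * (tube v a (b + e)).indicator 1 (x - c) := by
  by_cases hx : x - c ∈ tube v a (b + e)
  · rw [Set.indicator_of_mem hx, Pi.one_apply, mul_one, ← ofReal_norm]
    apply ENNReal.ofReal_le_ofReal
    refine (norm_integral_le_integral_norm _).trans ?_
    calc ∫ y, ‖w y * h (x - p y)‖ ∂ν ≤ ∫ y, ‖w y‖ * H ∂ν := by
          refine integral_mono_of_nonneg (ae_of_all _ fun _ => norm_nonneg _)
            (hw.norm.mul_const _) (ae_of_all _ fun y => ?_)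
          simp only [norm_mul]
          gcongr
          exact hh _
      _ ≤ H * W := by rw [integral_mul_const, mul_comm]; gcongr
  · have : ∀ y, w y * h (x - p y) = 0 := fun y => by
      by_contra hne
      obtain ⟨h1, h2⟩ := mul_ne_zero_iff.mp hne
      have h3 := add_mem_tube (hsupp _ h2) (hp y h1)
      rw [sub_add_sub_cancel] at h3
      exact hx h3
    simp [this]

variable (V) in
/-- `L²` bound on the Fourier side for a sum of kernels supported in tubes. -/
theorem lintegral_fourier_sum_tube_le (K R : ℝ) (hK : 1 ≤ K) (hR : 0 ≤ R) : ∃ C : ℝ, 0 < C ∧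
    ∀ {ι : Type} {Y : Type _} [MeasurableSpace Y] (ν : Measure Y) [SFinite ν]
      (s : Finset ι) (r β : ι → ℝ) (c : ι → V) (δ α : ℝ) (v : V)
      (h : ι → V → ℂ) (p : ι → Y → V) (w : ι → Y → ℂ) (H W : ι → ℝ) (L : ℝ),
      0 < δ → δ ≤ 1 → 0 ≤ α → ‖v‖ ≤ 2 → 0 ≤ L → (∀ i ∈ s, 0 < r i) →
      (∀ i ∈ s, 0 ≤ β i ∧ β i ≤ α * (δ * r i) ^ Module.finrank ℝ V) →
      ((s : Set ι).PairwiseDisjoint fun i => ball (c i) (δ * r i / 2)) →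
      (∀ i ∈ s, Measurable (h i)) → (∀ i ∈ s, ∀ z, ‖h i z‖ ≤ H i) → (∀ i ∈ s, 0 ≤ H i) →
      (∀ i ∈ s, ∀ z, h i z ≠ 0 → z ∈ tube v (2 * r i) (K * δ * r i)) →
      (∀ i ∈ s, Measurable (p i)) → (∀ i ∈ s, Integrable (w i) ν) →
      (∀ i ∈ s, ∀ y, w i y ≠ 0 → ‖p i y - c i‖ ≤ R * δ * r i) →
      (∀ i ∈ s, ∫ y, ‖w i y‖ ∂ν ≤ W i) →
      (∀ i ∈ s, H i * W i ≤ L * (β i / r i ^ Module.finrank ℝ V)) →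
      ∫⁻ ξ, ‖∑ i ∈ s, 𝓕 (h i) ξ * fourierPush ν (p i) (w i) ξ‖ₑ ^ 2
        ≤ ENNReal.ofReal (C * L ^ 2 * (δ ^ Module.finrank ℝ V / δ) ^ 2 * α * ∑ i ∈ s, β i) := by
  obtain ⟨C, hC, hmain⟩ := lintegral_sum_tube_sq_le V (K + R) (by linarith)
  refine ⟨C, hC, ?_⟩
  intro ι Y _ ν _ s r β c δ α v h p w H W L hδ hδ1 hα hv hL hr hβ hdisj hhm hhH hH hhs hp hw hpc
    hW hHW
  have hhi : ∀ i ∈ s, Integrable (h i) := fun i hi => by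
    have h1 : IntegrableOn (h i) (tube v (2 * r i) (K * δ * r i)) :=
      Measure.integrableOn_of_bounded (M := H i) (isCompact_tube v _ _).measure_lt_top.ne
        (hhm i hi).aestronglyMeasurable (ae_of_all _ fun z => hhH i hi z)
    refine (integrableOn_iff_integrable_of_support_subset fun z hz => hhs i hi z hz).mp h1
  set G : ι → V → ℂ := fun i x => ∫ y, w i y * h i (x - p i y) ∂ν with hG
  have hGi : ∀ i ∈ s, Integrable (G i) := fun i hi =>
    (integrable_conv_push (hhm i hi) (hhi i hi) (hp i hi) (hw i hi)).integral_prod_left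
  have hsumI : Integrable (fun x => ∑ i ∈ s, G i x) := integrable_finsetSum _ hGi
  have hbound : ∀ x, ‖∑ i ∈ s, G i x‖ₑ ≤ ENNReal.ofReal L * ∑ i ∈ s,
      ENNReal.ofReal (β i / r i ^ Module.finrank ℝ V) *
        (tube v (2 * r i) ((K + R) * δ * r i)).indicator 1 (x - c i) := by
    intro x
    refine (enorm_sum_le _ _).trans ?_
    rw [Finset.mul_sum]
    refine Finset.sum_le_sum fun i hi => ?_
    have h1 := enorm_conv_push_le (hw i hi) (hH i hi) (hhH i hi) (hhs i hi) (hpc i hi) (hW i hi) x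
    rw [show K * δ * r i + R * δ * r i = (K + R) * δ * r i by ring] at h1
    refine h1.trans ?_
    rw [← mul_assoc, ← ENNReal.ofReal_mul hL]
    exact mul_le_mul_left (ENNReal.ofReal_le_ofReal (hHW i hi)) _
  have hsq : ∫⁻ x, ‖∑ i ∈ s, G i x‖ₑ ^ 2 ≤
      ENNReal.ofReal (C * L ^ 2 * (δ ^ Module.finrank ℝ V / δ) ^ 2 * α * ∑ i ∈ s, β i) := by
    have h1 := hmain s r β c δ α v hδ hδ1 hα hv hr hβ hdisj
    calc ∫⁻ x, ‖∑ i ∈ s, G i x‖ₑ ^ 2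
        ≤ ∫⁻ x, ENNReal.ofReal (L ^ 2) * (∑ i ∈ s,
            ENNReal.ofReal (β i / r i ^ Module.finrank ℝ V) *
            (tube v (2 * r i) ((K + R) * δ * r i)).indicator 1 (x - c i)) ^ 2 := by
          refine lintegral_mono fun x => ?_
          rw [ENNReal.ofReal_pow hL, ← mul_pow]
          gcongr
          exact hbound x
      _ ≤ ENNReal.ofReal (L ^ 2) * ENNReal.ofReal
            (C * (δ ^ Module.finrank ℝ V / δ) ^ 2 * α * ∑ i ∈ s, β i) := by
          rw [lintegral_const_mul' _ _ ENNReal.ofReal_ne_top]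
          gcongr
      _ = _ := by
          rw [← ENNReal.ofReal_mul (by positivity)]
          congr 1; ring
  have hmem : MemLp (fun x => ∑ i ∈ s, G i x) 2 := by
    refine ⟨hsumI.aestronglyMeasurable, ?_⟩
    rw [eLpNorm_lt_top_iff_lintegral_rpow_enorm_lt_top (by norm_num) (by norm_num)]
    simpa using hsq.trans_lt ENNReal.ofReal_lt_top
  have hF : ∀ ξ, 𝓕 (fun x => ∑ i ∈ s, G i x) ξ
      = ∑ i ∈ s, 𝓕 (h i) ξ * fourierPush ν (p i) (w i) ξ := by
    intro ξ
    rw [Real.fourier_eq]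
    simp_rw [Finset.smul_sum]
    rw [integral_finsetSum]
    · refine Finset.sum_congr rfl fun i hi => ?_
      rw [← fourier_conv_push (hhm i hi) (hhi i hi) (hp i hi) (hw i hi), Real.fourier_eq]
    · intro i hi
      exact (Real.fourierIntegral_convergent_iff ξ).mpr (hGi i hi)
  simp_rw [← hF]
  rw [lintegral_enorm_sq_fourier hsumI hmem]
  exact hsq

end FourierTube

section Radial

open scoped FourierTransform RealInnerProductSpace

variable {V : Type*} [NormedAddCommGroup V] [InnerProductSpace ℝ V]

/-- `m` is bounded by `B`, supported in `r / 2 ≤ ‖z‖ ≤ 2 r`, and `m'` is its radial derivative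
`z ↦ d/dt m (t z)` at `t = 1`, with the same bounds. -/
structure IsRadialKernel [MeasurableSpace V] (r B : ℝ) (m m' : V → ℝ) : Prop where
  meas : Measurable m
  meas' : Measurable m'
  bound : ∀ z, |m z| ≤ B
  bound' : ∀ z, |m' z| ≤ B
  supp : ∀ z, m z ≠ 0 → r / 2 ≤ ‖z‖ ∧ ‖z‖ ≤ 2 * r
  supp' : ∀ z, m' z ≠ 0 → r / 2 ≤ ‖z‖ ∧ ‖z‖ ≤ 2 * r
  deriv : ∀ z, z ≠ 0 → ∀ t : ℝ, 0 < t → HasDerivAt (fun t : ℝ => m (t • z)) (m' (t • z) / t) t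

variable [FiniteDimensional ℝ V] [MeasurableSpace V] [BorelSpace V]

theorem integrable_of_bounded_support {f : V → ℂ} (hf : Measurable f) {B R : ℝ}
    (hB : ∀ z, ‖f z‖ ≤ B) (hR : ∀ z, f z ≠ 0 → ‖z‖ ≤ R) : Integrable f := by
  have h1 : IntegrableOn f (closedBall 0 R) :=
    Measure.integrableOn_of_bounded (M := B) measure_closedBall_lt_top.ne
      hf.aestronglyMeasurable (ae_of_all _ hB)
  exact (integrableOn_iff_integrable_of_support_subset fun z hz => by
    rw [mem_closedBall_zero_iff]; exact hR z hz).mp h1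

theorem radial_integral_by_parts {r B Λ : ℝ} (hr : 0 < r) (hB : 0 ≤ B) (hΛ : 0 ≤ Λ)
    {m m' q : V → ℝ}
    (hm : IsRadialKernel r B m m') (hq : Measurable q) (hqb : ∀ z, |q z| ≤ Λ)
    (hhom : ∀ t : ℝ, 0 < t → ∀ z, z ≠ 0 → q (t • z) = q z) (ξ : V) :
    ∫ z, Complex.exp (↑(-2 * Real.pi * ⟪z, ξ⟫) * Complex.I) *
        ((q z * ‖z‖⁻¹ * m' z : ℝ) - 2 * Real.pi * Complex.I * (q z * ‖z‖⁻¹ * ⟪z, ξ⟫ * m z : ℝ))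
      = (1 - Module.finrank ℝ V : ℂ) *
        ∫ z, Complex.exp (↑(-2 * Real.pi * ⟪z, ξ⟫) * Complex.I) * (q z * ‖z‖⁻¹ * m z : ℝ) := by
  set n := Module.finrank ℝ V with hn
  set F : ℝ → V → ℂ := fun s z =>
    Complex.exp (↑(-2 * Real.pi * ⟪z, ξ⟫ * s) * Complex.I) * (q z * ‖z‖⁻¹ * m (s • z) : ℝ) with hF
  set F' : ℝ → V → ℂ := fun s z => Complex.exp (↑(-2 * Real.pi * ⟪z, ξ⟫ * s) * Complex.I) *
    ((q z * ‖z‖⁻¹ * (m' (s • z) / s) : ℝ) -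
      2 * Real.pi * Complex.I * (q z * ‖z‖⁻¹ * ⟪z, ξ⟫ * m (s • z) : ℝ)) with hF'
  have hnorm : ∀ x : ℝ, ‖Complex.exp ((x : ℂ) * Complex.I)‖ = 1 := Complex.norm_exp_ofReal_mul_I
  have hinv : ∀ z : V, ∀ s : ℝ, 0 < s → s < 2 → r / 2 ≤ ‖s • z‖ → ‖z‖⁻¹ ≤ 4 / r := by
    intro z s hs hs2 h
    rw [norm_smul, Real.norm_of_nonneg hs.le] at h
    have h1 : r / 4 ≤ ‖z‖ := by nlinarith [norm_nonneg z]
    calc ‖z‖⁻¹ ≤ (r / 4)⁻¹ := by gcongr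
      _ = 4 / r := by rw [inv_div]
  have hprod : ∀ (z : V) (s : ℝ), 0 < s → s < 2 → ∀ g : V → ℝ, (∀ z, |g z| ≤ B) →
      (∀ z, g z ≠ 0 → r / 2 ≤ ‖z‖ ∧ ‖z‖ ≤ 2 * r) →
      |q z * ‖z‖⁻¹ * g (s • z)| ≤ Λ * (4 / r) * B := by
    intro z s hs hs2 g hg hgs
    by_cases h0 : g (s • z) = 0
    · rw [h0, mul_zero, abs_zero]; positivity
    · rw [abs_mul, abs_mul, abs_of_nonneg (inv_nonneg.mpr (norm_nonneg z))]
      gcongr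
      · exact hqb z
      · exact hinv z s hs hs2 (hgs _ h0).1
      · exact hg _
  have hderiv : ∀ z : V, ∀ s : ℝ, 0 < s → HasDerivAt (fun s => F s z) (F' s z) s := by
    intro z s hs
    by_cases hz : z = 0
    · subst hz
      have h1 : (fun s => F s 0) = fun _ => (0 : ℂ) := by funext s; simp [hF]
      have h2 : F' s 0 = 0 := by simp [hF']
      rw [h1, h2]
      exact hasDerivAt_const _ _
    · have h1 := (hm.deriv z hz s hs).const_mul (q z * ‖z‖⁻¹)
      have h2 : HasDerivAt (fun s : ℝ => Complex.exp (↑(-2 * Real.pi * ⟪z, ξ⟫ * s) * Complex.I))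
          (Complex.exp (↑(-2 * Real.pi * ⟪z, ξ⟫ * s) * Complex.I) *
            ((-2 * Real.pi * ⟪z, ξ⟫ : ℝ) * Complex.I)) s := by
        have h3 : HasDerivAt (fun s : ℝ => -2 * Real.pi * ⟪z, ξ⟫ * s) (-2 * Real.pi * ⟪z, ξ⟫) s := by
          simpa using (hasDerivAt_id s).const_mul (-2 * Real.pi * ⟪z, ξ⟫)
        exact (h3.ofReal_comp.mul_const Complex.I).cexp
      refine (h2.mul h1.ofReal_comp).congr_deriv ?_
      simp only [hF']
      push_cast
      ring
  have hFm : ∀ s, Measurable (F s) := fun s => by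
    have h1 : Measurable m := hm.meas
    simp only [hF]
    fun_prop
  have hF'm : ∀ s, Measurable (F' s) := fun s => by
    have h1 : Measurable m := hm.meas
    have h2 : Measurable fun z : V => m' (s • z) / s :=
      (hm.meas'.comp (measurable_const_smul s)).div_const s
    have h3 : Measurable fun z : V => Complex.exp (↑(-2 * Real.pi * ⟪z, ξ⟫ * s) * Complex.I) :=
      Continuous.measurable (by fun_prop)
    have h4 : Measurable fun z : V => ((q z * ‖z‖⁻¹ * (m' (s • z) / s) : ℝ) : ℂ) := by fun_prop
    have h6 : Measurable fun z : V => ⟪z, ξ⟫ := Continuous.measurable (by fun_prop)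
    have h5 : Measurable fun z : V => ((q z * ‖z‖⁻¹ * ⟪z, ξ⟫ * m (s • z) : ℝ) : ℂ) := by fun_prop
    exact h3.mul (h4.sub (h5.const_mul _))
  set D : ℝ := 2 * (Λ * (4 / r) * B) + 2 * Real.pi * ((4 * r * ‖ξ‖) * (Λ * (4 / r) * B)) with hD
  have hD0 : 0 ≤ D := by positivity
  have hF'b : ∀ z : V, ∀ s ∈ Set.Ioo (1 / 2 : ℝ) 2,
      ‖F' s z‖ ≤ (closedBall (0 : V) (4 * r)).indicator (fun _ => D) z := by
    rintro z s ⟨hs1, hs2⟩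
    have hs : 0 < s := by linarith
    by_cases hz : ‖z‖ ≤ 4 * r
    · rw [Set.indicator_of_mem (by simpa using hz)]
      simp only [hF']
      rw [norm_mul, hnorm, one_mul]
      refine (norm_sub_le _ _).trans (add_le_add ?_ ?_)
      · rw [Complex.norm_real, Real.norm_eq_abs, ← mul_div_assoc, abs_div, abs_of_pos hs,
          div_le_iff₀ hs]
        have h1 := hprod z s hs hs2 m' hm.bound' hm.supp'
        have h2 : 0 ≤ Λ * (4 / r) * B := by positivity
        nlinarith
      · rw [norm_mul, norm_mul, norm_mul, Complex.norm_I, Complex.norm_real, Complex.norm_real]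
        have h1 := hprod z s hs hs2 m hm.bound hm.supp
        have h2 : ‖(2 : ℂ)‖ = 2 := by norm_num
        rw [h2, Real.norm_of_nonneg Real.pi_pos.le, mul_one, Real.norm_eq_abs,
          show q z * ‖z‖⁻¹ * ⟪z, ξ⟫ * m (s • z) = ⟪z, ξ⟫ * (q z * ‖z‖⁻¹ * m (s • z)) by ring,
          abs_mul]
        gcongr
        exact (abs_real_inner_le_norm z ξ).trans (by gcongr)
    · have hz' : ¬ ‖s • z‖ ≤ 2 * r := by
        rw [norm_smul, Real.norm_of_nonneg hs.le]; nlinarith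
      have h1 : m (s • z) = 0 := by
        by_contra h; exact hz' (hm.supp _ h).2
      have h2 : m' (s • z) = 0 := by
        by_contra h; exact hz' (hm.supp' _ h).2
      rw [Set.indicator_of_notMem (by simpa using hz)]
      simp [hF', h1, h2]
  have hF1 : Integrable (F 1) := by
    refine integrable_of_bounded_support (hFm 1) (B := Λ * (4 / r) * B) (R := 2 * r) ?_ ?_
    · intro z
      simp only [hF]
      rw [norm_mul, hnorm, one_mul, Complex.norm_real, Real.norm_eq_abs]
      exact hprod z 1 one_pos (by norm_num) m hm.bound hm.supp
    · intro z hz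
      by_contra h
      have h1 : m z = 0 := by
        by_contra h'; exact h (hm.supp _ h').2
      exact hz (by simp [hF, h1])
  have hkey := (hasDerivAt_integral_of_dominated_loc_of_deriv_le (μ := volume) (F := F) (F' := F')
    (x₀ := 1) (s := Set.Ioo (1 / 2 : ℝ) 2) (Ioo_mem_nhds (by norm_num) (by norm_num))
    (Eventually.of_forall fun s => (hFm s).aestronglyMeasurable) hF1
    (hF'm 1).aestronglyMeasurable (ae_of_all _ hF'b)
    ((integrable_indicator_iff measurableSet_closedBall).mpr
      (integrableOn_const measure_closedBall_lt_top.ne))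
    (ae_of_all _ fun z s hs => hderiv z s (by linarith [hs.1]))).2
  set J : ℂ := ∫ z, F 1 z with hJ
  have hscale : ∀ s : ℝ, 0 < s → ∫ z, F s z = ((s * (s ^ n)⁻¹ : ℝ) : ℂ) * J := by
    intro s hs
    have h1 : ∀ z, F s z = (s : ℂ) * F 1 (s • z) := by
      intro z
      by_cases hz : z = 0
      · simp [hF, hz]
      · simp only [hF, inner_smul_left, conj_trivial, hhom s hs z hz, norm_smul,
          Real.norm_of_nonneg hs.le, mul_one, one_smul, mul_inv]
        have h2 : -2 * Real.pi * ⟪z, ξ⟫ * s = -2 * Real.pi * (s * ⟪z, ξ⟫) := by ring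
        rw [h2]
        have hs' : (s : ℂ) ≠ 0 := by exact_mod_cast hs.ne'
        push_cast
        field_simp
    simp_rw [h1]
    rw [integral_const_mul, Measure.integral_comp_smul_of_nonneg _ _ s (hR := hs.le), ← hn, ← hJ,
      Complex.real_smul]
    push_cast; ring
  have hderiv2 : HasDerivAt (fun s : ℝ => ((s * (s ^ n)⁻¹ : ℝ) : ℂ) * J)
      (((1 - n : ℝ) : ℂ) * J) 1 := by
    have h1 : HasDerivAt (fun s : ℝ => s * (s ^ n)⁻¹) (1 - n : ℝ) 1 := by
      have h2 := (hasDerivAt_id (1 : ℝ)).mul ((hasDerivAt_pow n (1 : ℝ)).inv (by simp))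
      refine h2.congr_deriv ?_
      simp; ring
    exact h1.ofReal_comp.mul_const J
  have huniq := hkey.unique (hderiv2.congr_of_eventuallyEq
    (Filter.eventually_of_mem (Ioi_mem_nhds (one_pos : (0:ℝ) < 1)) hscale))
  simp only [hJ, hF, hF', mul_one, one_smul, div_one] at huniq
  rw [huniq]
  push_cast
  rfl

end Radial

section RadialMoment

open scoped FourierTransform RealInnerProductSpace

variable {V : Type*} [NormedAddCommGroup V] [InnerProductSpace ℝ V]
  [FiniteDimensional ℝ V] [MeasurableSpace V] [BorelSpace V]

theorem measurable_inner_right (ξ : V) : Measurable fun z : V => ⟪z, ξ⟫ :=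
  Continuous.measurable (by fun_prop)

theorem abs_mul_mul_le_of_annulus {r B Λ Φ : ℝ} (hB : 0 ≤ B) (hΛ : 0 ≤ Λ)
    (hΦ : 0 ≤ Φ) {g q φ : V → ℝ} (hg : ∀ z, |g z| ≤ B)
    (hgs : ∀ z, g z ≠ 0 → r / 2 ≤ ‖z‖ ∧ ‖z‖ ≤ 2 * r) (hq : ∀ z, |q z| ≤ Λ)
    (hφ : ∀ z, q z ≠ 0 → r / 2 ≤ ‖z‖ → ‖z‖ ≤ 2 * r → |φ z| ≤ Φ) (z : V) :
    |q z * φ z * g z| ≤ Λ * Φ * B := by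
  by_cases h0 : g z = 0
  · rw [h0, mul_zero, abs_zero]; positivity
  · by_cases h1 : q z = 0
    · rw [h1, zero_mul, zero_mul, abs_zero]; positivity
    rw [abs_mul, abs_mul]
    gcongr
    · exact hq z
    · exact hφ z h1 (hgs z h0).1 (hgs z h0).2
    · exact hg z

theorem integrable_of_annulus {r B Λ Φ : ℝ} (hB : 0 ≤ B) (hΛ : 0 ≤ Λ) (hΦ : 0 ≤ Φ)
    {g q φ : V → ℝ} (hgm : Measurable g) (hqm : Measurable q) (hφm : Measurable φ)
    (hg : ∀ z, |g z| ≤ B)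
    (hgs : ∀ z, g z ≠ 0 → r / 2 ≤ ‖z‖ ∧ ‖z‖ ≤ 2 * r) (hq : ∀ z, |q z| ≤ Λ)
    (hφ : ∀ z, q z ≠ 0 → r / 2 ≤ ‖z‖ → ‖z‖ ≤ 2 * r → |φ z| ≤ Φ) :
    Integrable (fun z => ((q z * φ z * g z : ℝ) : ℂ)) := by
  refine integrable_of_bounded_support (B := Λ * Φ * B) (R := 2 * r) (by fun_prop) ?_ ?_
  · intro z
    rw [Complex.norm_real, Real.norm_eq_abs]
    exact abs_mul_mul_le_of_annulus hB hΛ hΦ hg hgs hq hφ z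
  · intro z hz
    have : g z ≠ 0 := by
      intro h; exact hz (by rw [h, mul_zero, Complex.ofReal_zero])
    exact (hgs z this).2

/-- Moving `⟪v, ξ⟫` onto a kernel: a radial derivative and the angular deviations from `v`. -/
theorem inner_mul_fourier_radial {r B Λ : ℝ} (hr : 0 < r) (hB : 0 ≤ B) (hΛ : 0 ≤ Λ)
    {m m' q : V → ℝ} (hm : IsRadialKernel r B m m') (hq : Measurable q) (hqb : ∀ z, |q z| ≤ Λ)
    (hhom : ∀ t : ℝ, 0 < t → ∀ z, z ≠ 0 → q (t • z) = q z) (v ξ : V) :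
    2 * Real.pi * Complex.I * ⟪v, ξ⟫ * 𝓕 (fun z => ((q z * m z : ℝ) : ℂ)) ξ =
      𝓕 (fun z => ((q z * ‖z‖⁻¹ * ((Module.finrank ℝ V - 1) * m z + m' z) : ℝ) : ℂ)) ξ +
      2 * Real.pi * Complex.I * ∑ j, (⟪stdOrthonormalBasis ℝ V j, ξ⟫ : ℂ) *
        𝓕 (fun z => ((q z * ⟪v - ‖z‖⁻¹ • z, stdOrthonormalBasis ℝ V j⟫ * m z : ℝ) : ℂ)) ξ := by
  set n := Module.finrank ℝ V with hn
  set e := stdOrthonormalBasis ℝ V with he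
  have hmm := hm.meas
  have hinvb : ∀ z : V, q z ≠ 0 → r / 2 ≤ ‖z‖ → ‖z‖ ≤ 2 * r → |‖z‖⁻¹| ≤ 2 / r := by
    intro z _ h _
    rw [abs_of_nonneg (by positivity)]
    calc ‖z‖⁻¹ ≤ (r / 2)⁻¹ := by gcongr
      _ = 2 / r := by rw [inv_div]
  have hinnb : ∀ j, ∀ z : V, q z ≠ 0 → r / 2 ≤ ‖z‖ → ‖z‖ ≤ 2 * r →
      |⟪v - ‖z‖⁻¹ • z, e j⟫| ≤ ‖v‖ + 1 := by
    intro j z _ h _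
    have hz : z ≠ 0 := norm_pos_iff.mp (by linarith)
    refine (abs_real_inner_le_norm _ _).trans ?_
    rw [e.norm_eq_one, mul_one]
    refine (norm_sub_le _ _).trans ?_
    rw [norm_smul, norm_inv, norm_norm, inv_mul_cancel₀ (norm_ne_zero_iff.mpr hz)]
  have hinnm : ∀ j, Measurable fun z : V => ⟪v - ‖z‖⁻¹ • z, e j⟫ := fun j =>
    (measurable_inner_right (e j)).comp (by fun_prop)
  have i1 : Integrable (fun z => ((q z * ‖z‖⁻¹ * m' z : ℝ) : ℂ)) :=
    integrable_of_annulus hB hΛ (by positivity : 0 ≤ 2 / r) hm.meas' hq (by fun_prop) hm.bound'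
      hm.supp' hqb hinvb
  have i3 : Integrable (fun z => ((q z * ‖z‖⁻¹ * m z : ℝ) : ℂ)) :=
    integrable_of_annulus hB hΛ (by positivity : 0 ≤ 2 / r) hm.meas hq (by fun_prop) hm.bound
      hm.supp hqb hinvb
  have i2 : Integrable (fun z => ((q z * (‖z‖⁻¹ * ⟪z, ξ⟫) * m z : ℝ) : ℂ)) := by
    refine integrable_of_annulus hB hΛ (by positivity : 0 ≤ 2 / r * (2 * r * ‖ξ‖)) hm.meas hq
      (by have := measurable_inner_right ξ; fun_prop) hm.bound hm.supp hqb fun z h0 h1 h2 => ?_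
    rw [abs_mul]
    gcongr
    · exact hinvb z h0 h1 h2
    · exact (abs_real_inner_le_norm z ξ).trans (by gcongr)
  have i4 : ∀ j, Integrable (fun z => ((q z * ⟪v - ‖z‖⁻¹ • z, e j⟫ * m z : ℝ) : ℂ)) := fun j =>
    integrable_of_annulus hB hΛ (by positivity : 0 ≤ ‖v‖ + 1) hm.meas hq (hinnm j) hm.bound
      hm.supp hqb (hinnb j)
  set E : V → ℂ := fun z => Complex.exp (↑(-2 * Real.pi * ⟪z, ξ⟫) * Complex.I) with hE
  have hEm : Measurable E := Continuous.measurable (by fun_prop)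
  have hEi : ∀ {f : V → ℂ}, Integrable f → Integrable (fun z => E z * f z) := fun {f} hf =>
    hf.bdd_mul (c := 1) hEm.aestronglyMeasurable
      (ae_of_all _ fun z => (Complex.norm_exp_ofReal_mul_I _).le)
  have hibp := radial_integral_by_parts hr hB hΛ hm hq hqb hhom ξ
  simp only [Real.fourier_eq', smul_eq_mul]
  change 2 * Real.pi * Complex.I * ⟪v, ξ⟫ * ∫ z, E z * ((q z * m z : ℝ) : ℂ) =
    (∫ z, E z * ((q z * ‖z‖⁻¹ * ((n - 1) * m z + m' z) : ℝ) : ℂ)) +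
      2 * Real.pi * Complex.I * ∑ j, (⟪e j, ξ⟫ : ℂ) *
        ∫ z, E z * ((q z * ⟪v - ‖z‖⁻¹ • z, e j⟫ * m z : ℝ) : ℂ)
  change ∫ z, E z * ((q z * ‖z‖⁻¹ * m' z : ℝ) -
      2 * Real.pi * Complex.I * (q z * ‖z‖⁻¹ * ⟪z, ξ⟫ * m z : ℝ)) =
      (1 - n : ℂ) * ∫ z, E z * (q z * ‖z‖⁻¹ * m z : ℝ) at hibp
  have hA : ∫ z, E z * ((q z * ‖z‖⁻¹ * ((n - 1) * m z + m' z) : ℝ) : ℂ) =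
      (n - 1 : ℂ) * (∫ z, E z * (q z * ‖z‖⁻¹ * m z : ℝ)) + ∫ z, E z * (q z * ‖z‖⁻¹ * m' z : ℝ) := by
    rw [← integral_const_mul, ← integral_add ((hEi i3).const_mul _) (hEi i1)]
    congr 1; funext z; push_cast; ring
  have hBB : ∫ z, E z * ((q z * ‖z‖⁻¹ * m' z : ℝ) -
      2 * Real.pi * Complex.I * (q z * ‖z‖⁻¹ * ⟪z, ξ⟫ * m z : ℝ)) =
      (∫ z, E z * (q z * ‖z‖⁻¹ * m' z : ℝ)) - 2 * Real.pi * Complex.I *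
        ∫ z, E z * (q z * (‖z‖⁻¹ * ⟪z, ξ⟫) * m z : ℝ) := by
    rw [← integral_const_mul, ← integral_sub (hEi i1) ((hEi i2).const_mul _)]
    congr 1; funext z; push_cast; ring
  have hCC : ⟪v, ξ⟫ * ∫ z, E z * ((q z * m z : ℝ) : ℂ) =
      (∫ z, E z * (q z * (‖z‖⁻¹ * ⟪z, ξ⟫) * m z : ℝ)) + ∑ j, (⟪e j, ξ⟫ : ℂ) *
        ∫ z, E z * ((q z * ⟪v - ‖z‖⁻¹ • z, e j⟫ * m z : ℝ) : ℂ) := by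
    simp_rw [← integral_const_mul]
    rw [← integral_finsetSum _ fun j _ => (hEi (i4 j)).const_mul _,
      ← integral_add (hEi i2) (integrable_finsetSum _ fun j _ => (hEi (i4 j)).const_mul _)]
    congr 1; funext z
    have h1 := e.sum_inner_mul_inner (v - ‖z‖⁻¹ • z) ξ
    rw [inner_sub_left, inner_smul_left, conj_trivial] at h1
    have h2 : (⟪v, ξ⟫ : ℂ) = (‖z‖⁻¹ * ⟪z, ξ⟫ : ℝ) +
        ∑ j, ((⟪v - ‖z‖⁻¹ • z, e j⟫ * ⟪e j, ξ⟫ : ℝ) : ℂ) := by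
      rw [← Complex.ofReal_sum, h1]; push_cast; ring
    rw [h2, add_mul, Finset.sum_mul]
    congr 1
    · push_cast; ring
    · refine Finset.sum_congr rfl fun j _ => ?_
      push_cast; ring
  rw [hBB] at hibp
  rw [mul_assoc, hCC, hA]
  linear_combination -hibp

theorem norm_moment_le {b : V → ℂ} {c : V} {e : ℝ} (hsupp : ∀ y, b y ≠ 0 → ‖y - c‖ ≤ e) (u : V)
    (hu : ‖u‖ ≤ 1) (y : V) : ‖(⟪y - c, u⟫ : ℂ) * b y‖ ≤ e * ‖b y‖ := by
  by_cases h : b y = 0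
  · simp [h]
  · rw [norm_mul, Complex.norm_real]
    gcongr
    refine (norm_inner_le_norm _ _).trans ?_
    calc ‖y - c‖ * ‖u‖ ≤ ‖y - c‖ * 1 := by gcongr
      _ ≤ e := by rw [mul_one]; exact hsupp y h

theorem integrable_moment {b : V → ℂ} (hb : Integrable b) {c : V} {e : ℝ}
    (hsupp : ∀ y, b y ≠ 0 → ‖y - c‖ ≤ e) (u : V) (hu : ‖u‖ ≤ 1) :
    Integrable (fun x : ℝ × V => (⟪x.2 - c, u⟫ : ℂ) * b x.2)
      ((volume.restrict (Set.Icc (0 : ℝ) 1)).prod volume) := by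
  have h1 : Integrable (fun y => (⟪y - c, u⟫ : ℂ) * b y) := by
    refine (hb.norm.const_mul e).mono' ?_ (ae_of_all _ (norm_moment_le hsupp u hu))
    exact (Continuous.aestronglyMeasurable (by fun_prop)).mul hb.aestronglyMeasurable
  exact h1.comp_snd _

theorem integral_norm_moment_le {b : V → ℂ} (hb : Integrable b) {c : V} {e : ℝ}
    (hsupp : ∀ y, b y ≠ 0 → ‖y - c‖ ≤ e) (u : V) (hu : ‖u‖ ≤ 1) :
    ∫ x : ℝ × V, ‖(⟪x.2 - c, u⟫ : ℂ) * b x.2‖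
      ∂((volume.restrict (Set.Icc (0 : ℝ) 1)).prod volume) ≤ e * ∫ y, ‖b y‖ := by
  rw [integral_prod_symm _ (integrable_moment hb hsupp u hu).norm]
  simp only [integral_const, measureReal_restrict_apply_univ, Real.volume_real_Icc, sub_zero,
    max_eq_left zero_le_one, one_smul]
  rw [← integral_const_mul]
  exact integral_mono_of_nonneg (ae_of_all _ fun _ => norm_nonneg _) (hb.norm.const_mul e)
    (ae_of_all _ (norm_moment_le hsupp u hu))

/-- The Fourier transform of a mean zero function near `c`, written with first moments. -/
theorem fourierPush_mean_zero {b : V → ℂ} (hb : Integrable b) (hmean : ∫ y, b y = 0) (c : V)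
    {e : ℝ} (hsupp : ∀ y, b y ≠ 0 → ‖y - c‖ ≤ e) (ξ : V) :
    fourierPush volume id b ξ = -(2 * Real.pi * Complex.I) *
      ∑ j, (⟪stdOrthonormalBasis ℝ V j, ξ⟫ : ℂ) *
        fourierPush ((volume.restrict (Set.Icc (0 : ℝ) 1)).prod volume)
          (fun x : ℝ × V => c + x.1 • (x.2 - c))
          (fun x => (⟪x.2 - c, stdOrthonormalBasis ℝ V j⟫ : ℂ) * b x.2) ξ := by
  set B := stdOrthonormalBasis ℝ V with hB
  set ν := (volume.restrict (Set.Icc (0 : ℝ) 1)).prod (volume : Measure V) with hν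
  set G : ℝ × V → ℂ := fun x => (𝐞 (-⟪c + x.1 • (x.2 - c), ξ⟫) : ℂ) with hG
  have hGm : AEStronglyMeasurable G ν := Continuous.aestronglyMeasurable (by fun_prop)
  have hint : ∀ u : V, ‖u‖ ≤ 1 →
      Integrable (fun x : ℝ × V => G x * ((⟪x.2 - c, u⟫ : ℂ) * b x.2)) ν := fun u hu =>
    (integrable_moment hb hsupp u hu).bdd_mul (c := 1) hGm
      (ae_of_all _ fun z => (Circle.norm_coe _).le)
  have hBn : ∀ j, ‖B j‖ ≤ 1 := fun j => (B.norm_eq_one j).le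
  have h1 : ∑ j, (⟪B j, ξ⟫ : ℂ) * fourierPush ν (fun x : ℝ × V => c + x.1 • (x.2 - c))
      (fun x => (⟪x.2 - c, B j⟫ : ℂ) * b x.2) ξ = ∫ x, G x * (⟪x.2 - c, ξ⟫ * b x.2) ∂ν := by
    have h2 : ∀ j, (⟪B j, ξ⟫ : ℂ) * fourierPush ν (fun x : ℝ × V => c + x.1 • (x.2 - c))
        (fun x => (⟪x.2 - c, B j⟫ : ℂ) * b x.2) ξ
        = ∫ x, ⟪B j, ξ⟫ * (G x * ((⟪x.2 - c, B j⟫ : ℂ) * b x.2)) ∂ν := fun j => by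
      rw [integral_const_mul]; rfl
    simp_rw [h2]
    rw [← integral_finsetSum _ fun j _ => (hint (B j) (hBn j)).const_mul _]
    congr 1; funext x
    rw [← B.sum_inner_mul_inner (x.2 - c) ξ, Complex.ofReal_sum, Finset.sum_mul, Finset.mul_sum]
    refine Finset.sum_congr rfl fun j _ => ?_
    push_cast; ring
  have hintξ : Integrable (fun x : ℝ × V => G x * ((⟪x.2 - c, ξ⟫ : ℂ) * b x.2)) ν := by
    have h2 : (fun x : ℝ × V => G x * ((⟪x.2 - c, ξ⟫ : ℂ) * b x.2))
        = fun x => ∑ j, (⟪B j, ξ⟫ : ℂ) * (G x * ((⟪x.2 - c, B j⟫ : ℂ) * b x.2)) := by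
      funext x
      rw [← B.sum_inner_mul_inner (x.2 - c) ξ, Complex.ofReal_sum, Finset.sum_mul, Finset.mul_sum]
      refine Finset.sum_congr rfl fun j _ => ?_
      push_cast; ring
    rw [h2]
    exact integrable_finsetSum _ fun j _ => (hint (B j) (hBn j)).const_mul _
  rw [h1, integral_prod_symm _ hintξ, ← integral_const_mul]
  have h3 : ∀ y : V, -(2 * Real.pi * Complex.I) *
      ∫ t in Set.Icc (0 : ℝ) 1, G (t, y) * (⟪y - c, ξ⟫ * b y)
        = (𝐞 (-⟪y, ξ⟫) : ℂ) * b y - (𝐞 (-⟪c, ξ⟫) : ℂ) * b y := by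
    intro y
    have h4 : ∀ t : ℝ, HasDerivAt (fun t : ℝ => (𝐞 (-⟪c + t • (y - c), ξ⟫) : ℂ))
        (-(2 * Real.pi * Complex.I) * (G (t, y) * ⟪y - c, ξ⟫)) t := by
      intro t
      have h5 : HasDerivAt (fun t : ℝ => -⟪c + t • (y - c), ξ⟫) (-⟪y - c, ξ⟫) t := by
        simp only [inner_add_left, inner_smul_left, conj_trivial]
        exact ((hasDerivAt_mul_const ⟪y - c, ξ⟫).const_add ⟪c, ξ⟫).fun_neg
      have h6 := (Real.hasDerivAt_fourierChar (-⟪c + t • (y - c), ξ⟫)).scomp t h5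
      refine h6.congr_deriv ?_
      simp only [hG, Complex.real_smul]
      push_cast; ring
    have h7 := intervalIntegral.integral_eq_sub_of_hasDerivAt (a := 0) (b := 1)
      (fun t _ => h4 t) (Continuous.intervalIntegrable (by fun_prop) _ _)
    rw [intervalIntegral.integral_of_le zero_le_one, ← integral_Icc_eq_integral_Ioc] at h7
    simp only [one_smul, zero_smul, add_zero, add_sub_cancel] at h7
    rw [← sub_mul, ← h7, ← integral_mul_const, ← integral_const_mul]
    congr 1; funext t; ring
  simp_rw [h3]
  have hc : ∀ y : V, (𝐞 (-⟪y, ξ⟫) : ℂ) * b y = 𝐞 (-⟪y, ξ⟫) • b y := fun y => rfl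
  have i1 : Integrable fun y => (𝐞 (-⟪y, ξ⟫) : ℂ) * b y :=
    (Real.fourierIntegral_convergent_iff ξ).mpr hb
  rw [integral_sub i1 (hb.const_mul _), integral_const_mul, hmean, mul_zero, sub_zero]
  rfl

end RadialMoment

section AngularCap

open scoped FourierTransform RealInnerProductSpace

variable {V : Type*} [NormedAddCommGroup V] [InnerProductSpace ℝ V]

open scoped Classical in
/-- The restriction of `Ω` to the directions within `δ` of `v`. -/
def capped (Ω : V → ℝ) (δ : ℝ) (v z : V) : ℝ := if ‖‖z‖⁻¹ • z - v‖ ≤ δ then Ω z else 0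

theorem abs_capped_le {Ω : V → ℝ} {Λ : ℝ} (hΩ : ∀ z, |Ω z| ≤ Λ) (δ : ℝ) (v z : V) :
    |capped Ω δ v z| ≤ Λ := by
  unfold capped
  split_ifs
  · exact hΩ z
  · rw [abs_zero]; exact (abs_nonneg _).trans (hΩ z)

theorem norm_sub_le_of_capped_ne_zero {Ω : V → ℝ} {δ : ℝ} {v z : V} (h : capped Ω δ v z ≠ 0) :
    ‖‖z‖⁻¹ • z - v‖ ≤ δ := by
  by_contra h1
  exact h (if_neg h1)

theorem capped_smul {Ω : V → ℝ} (hΩ : ∀ t : ℝ, 0 < t → ∀ z, z ≠ 0 → Ω (t • z) = Ω z) (δ : ℝ)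
    (v : V) (t : ℝ) (ht : 0 < t) (z : V) (hz : z ≠ 0) :
    capped Ω δ v (t • z) = capped Ω δ v z := by
  unfold capped
  rw [hΩ t ht z hz, norm_smul, Real.norm_of_nonneg ht.le, smul_smul]
  have : (t * ‖z‖)⁻¹ * t = ‖z‖⁻¹ := by field_simp
  rw [this]

theorem mem_tube_of_capped_ne_zero {Ω : V → ℝ} {δ r : ℝ} {v z : V} (hδ : 0 ≤ δ)
    (h : capped Ω δ v z ≠ 0) (hz : ‖z‖ ≤ 2 * r) : z ∈ tube v (2 * r) (2 * δ * r) := by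
  refine ⟨‖z‖, by rwa [abs_norm], ?_⟩
  rcases eq_or_ne z 0 with rfl | h0
  · simp only [norm_zero, zero_smul, sub_zero] at hz ⊢
    nlinarith
  · have h1 : z - ‖z‖ • v = ‖z‖ • (‖z‖⁻¹ • z - v) := by
      rw [smul_sub, smul_smul, mul_inv_cancel₀ (norm_ne_zero_iff.mpr h0), one_smul]
    rw [h1, norm_smul, norm_norm]
    nlinarith [norm_sub_le_of_capped_ne_zero h, norm_nonneg z, norm_nonneg (‖z‖⁻¹ • z - v)]

variable [FiniteDimensional ℝ V] [MeasurableSpace V] [BorelSpace V]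

theorem measurable_capped_uncurry {Ω : V → ℝ} (hΩ : Measurable Ω) (δ : ℝ) :
    Measurable fun x : V × V => capped Ω δ x.1 x.2 := by
  unfold capped
  refine Measurable.ite ?_ (hΩ.comp measurable_snd) measurable_const
  refine measurableSet_le ?_ measurable_const
  fun_prop

theorem measurable_capped {Ω : V → ℝ} (hΩ : Measurable Ω) (δ : ℝ) (v : V) :
    Measurable (capped Ω δ v) :=
  (measurable_capped_uncurry hΩ δ).comp measurable_prodMk_left

theorem continuous_fourierPush {Y : Type*} [MeasurableSpace Y] {ν : Measure Y}
    {p : Y → V} (hp : Measurable p) {w : Y → ℂ} (hw : Integrable w ν) :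
    Continuous (fourierPush ν p w) := by
  unfold fourierPush
  refine continuous_of_dominated (bound := fun y => ‖w y‖) (fun ξ => ?_)
    (fun ξ => ae_of_all _ fun y => by rw [Circle.norm_smul]) hw.norm
    (ae_of_all _ fun y => by fun_prop)
  simp_rw [Circle.smul_def, smul_eq_mul]
  refine AEStronglyMeasurable.mul (Measurable.aestronglyMeasurable ?_) hw.aestronglyMeasurable
  have : Continuous fun x : V => (𝐞 (-⟪x, ξ⟫) : ℂ) := by fun_prop
  exact this.measurable.comp hp

theorem continuous_fourier {f : V → ℂ} (hf : Integrable f) : Continuous (𝓕 f) := by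
  have : 𝓕 f = fourierPush volume id f := by
    ext ξ; rw [Real.fourier_eq]; rfl
  rw [this]
  exact continuous_fourierPush measurable_id hf

/-- The hypotheses of the core `L²` estimate: disjoint balls `B (c i, δ r i / 2)`, mean zero
atoms `b i` of mass at most `β i` near `c i`, and smooth kernels `m i` at scale `r i`. -/
structure IsCoreData {ι : Type} (s : Finset ι) (r β : ι → ℝ) (c : ι → V) (δ α R M : ℝ)
    (m m' : ι → V → ℝ) (b : ι → V → ℂ) : Prop where
  δ_pos : 0 < δ
  δ_le : δ ≤ 1
  α_nonneg : 0 ≤ α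
  M_nonneg : 0 ≤ M
  r_pos : ∀ i ∈ s, 0 < r i
  β_le : ∀ i ∈ s, 0 ≤ β i ∧ β i ≤ α * (δ * r i) ^ Module.finrank ℝ V
  disj : (s : Set ι).PairwiseDisjoint fun i => ball (c i) (δ * r i / 2)
  kernel : ∀ i ∈ s, IsRadialKernel (r i) (M / r i ^ Module.finrank ℝ V) (m i) (m' i)
  b_int : ∀ i ∈ s, Integrable (b i)
  b_supp : ∀ i ∈ s, ∀ y, b i y ≠ 0 → ‖y - c i‖ ≤ R * δ * r i
  b_mean : ∀ i ∈ s, ∫ y, b i y = 0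
  b_norm : ∀ i ∈ s, ∫ y, ‖b i y‖ ≤ β i

/-- The Fourier transform of the part of the rough operator with kernel supported in the
directions close to `v`. -/
def capFourier {ι : Type} (s : Finset ι) (Ω : V → ℝ) (δ : ℝ) (m : ι → V → ℝ) (b : ι → V → ℂ)
    (v ξ : V) : ℂ :=
  ∑ i ∈ s, 𝓕 (fun z => ((capped Ω δ v z * m i z : ℝ) : ℂ)) ξ * fourierPush volume id (b i) ξ

variable (V) in
theorem lintegral_capFourier_le (R : ℝ) (hR : 0 ≤ R) : ∃ C : ℝ, 0 < C ∧
    ∀ {ι : Type} (s : Finset ι) (r β : ι → ℝ) (c : ι → V) (δ α M : ℝ)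
      (m m' : ι → V → ℝ) (b : ι → V → ℂ) (Ω : V → ℝ) (Λ : ℝ) (v : V),
      IsCoreData s r β c δ α R M m m' b → Measurable Ω → (∀ z, |Ω z| ≤ Λ) → ‖v‖ ≤ 2 →
      ∫⁻ ξ, ‖capFourier s Ω δ m b v ξ‖ₑ ^ 2
        ≤ ENNReal.ofReal (C * (Λ * M) ^ 2 * (δ ^ Module.finrank ℝ V / δ) ^ 2 * α
            * ∑ i ∈ s, β i) := by
  obtain ⟨C, hC, hmain⟩ := lintegral_fourier_sum_tube_le V 2 R one_le_two hR
  refine ⟨C, hC, fun s r β c δ α M m m' b Ω Λ v hD hΩ hΩb hv => ?_⟩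
  have hΛ : 0 ≤ Λ := (abs_nonneg _).trans (hΩb 0)
  refine hmain volume s r β c δ α v (fun i z => ((capped Ω δ v z * m i z : ℝ) : ℂ)) (fun _ => id)
    b (fun i => Λ * (M / r i ^ Module.finrank ℝ V)) β (Λ * M) hD.δ_pos hD.δ_le hD.α_nonneg hv
    (mul_nonneg hΛ hD.M_nonneg) hD.r_pos hD.β_le hD.disj
    (fun i hi => Complex.measurable_ofReal.comp
      ((measurable_capped hΩ δ v).mul (hD.kernel i hi).meas))
    (fun i hi z => ?_) (fun i hi => ?_) (fun i hi z hz => ?_)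
    (fun _ _ => measurable_id) hD.b_int hD.b_supp hD.b_norm (fun i hi => le_of_eq (by ring))
  · rw [Complex.norm_real, Real.norm_eq_abs, abs_mul]
    exact mul_le_mul (abs_capped_le hΩb δ v z) ((hD.kernel i hi).bound z) (abs_nonneg _) hΛ
  · have := hD.r_pos i hi
    have := hD.M_nonneg
    positivity
  · have h1 : capped Ω δ v z * m i z ≠ 0 := by exact_mod_cast hz
    exact mem_tube_of_capped_ne_zero hD.δ_pos.le (left_ne_zero_of_mul h1)
      ((hD.kernel i hi).supp z (right_ne_zero_of_mul h1)).2

end AngularCap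

section Contraction

open scoped FourierTransform RealInnerProductSpace

variable {V : Type*} [NormedAddCommGroup V] [InnerProductSpace ℝ V] [FiniteDimensional ℝ V]
  [MeasurableSpace V] [BorelSpace V]

/-- Uniform measure on the unit interval times Lebesgue measure. -/
abbrev homotopyMeasure (V : Type*) [NormedAddCommGroup V] [InnerProductSpace ℝ V]
    [FiniteDimensional ℝ V] [MeasurableSpace V] [BorelSpace V] : Measure (ℝ × V) :=
  (volume.restrict (Set.Icc (0 : ℝ) 1)).prod volume

/-- The contraction of `V` to `c`, with the time parameter clamped to the unit interval. -/
def contraction (c : V) (x : ℝ × V) : V := c + max 0 (min x.1 1) • (x.2 - c)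

theorem measurable_contraction (c : V) : Measurable (contraction c) := by
  unfold contraction
  fun_prop

theorem norm_contraction_sub_le (c : V) (x : ℝ × V) : ‖contraction c x - c‖ ≤ ‖x.2 - c‖ := by
  unfold contraction
  rw [add_sub_cancel_left, norm_smul, Real.norm_of_nonneg (le_max_left _ _)]
  exact mul_le_of_le_one_left (norm_nonneg _) (max_le zero_le_one (min_le_right _ _))

theorem fourierPush_contraction (c : V) (w : ℝ × V → ℂ) (ξ : V) :
    fourierPush (homotopyMeasure V) (fun x : ℝ × V => c + x.1 • (x.2 - c)) w ξ =
      fourierPush (homotopyMeasure V) (contraction c) w ξ := by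
  unfold fourierPush
  have h1 : ∀ᵐ x : ℝ × V ∂homotopyMeasure V, x.1 ∈ Set.Icc (0 : ℝ) 1 :=
    Measure.quasiMeasurePreserving_fst.ae (ae_restrict_mem measurableSet_Icc)
  refine integral_congr_ae ?_
  filter_upwards [h1] with x hx
  rw [contraction, min_eq_left hx.2, max_eq_right hx.1]

/-- The angular error term in direction `j`. -/
def capFourierAngular {ι : Type} (s : Finset ι) (Ω : V → ℝ) (δ : ℝ) (m : ι → V → ℝ)
    (b : ι → V → ℂ) (v : V) (j : Fin (Module.finrank ℝ V)) (ξ : V) : ℂ :=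
  ∑ i ∈ s, 𝓕 (fun z => ((capped Ω δ v z * ⟪v - ‖z‖⁻¹ • z, stdOrthonormalBasis ℝ V j⟫ * m i z : ℝ)
    : ℂ)) ξ * fourierPush volume id (b i) ξ

/-- The radial error term in direction `j`. -/
def capFourierRadial {ι : Type} (s : Finset ι) (Ω : V → ℝ) (δ : ℝ) (c : ι → V) (m m' : ι → V → ℝ)
    (b : ι → V → ℂ) (v : V) (j : Fin (Module.finrank ℝ V)) (ξ : V) : ℂ :=
  ∑ i ∈ s, 𝓕 (fun z => ((capped Ω δ v z * ‖z‖⁻¹ *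
      ((Module.finrank ℝ V - 1) * m i z + m' i z) : ℝ) : ℂ)) ξ *
    fourierPush (homotopyMeasure V) (contraction (c i))
      (fun x => (⟪x.2 - c i, stdOrthonormalBasis ℝ V j⟫ : ℂ) * b i x.2) ξ

theorem abs_inner_mul_norm_capFourier_le {ι : Type} {s : Finset ι} {r β : ι → ℝ} {c : ι → V}
    {δ α R M : ℝ} {m m' : ι → V → ℝ} {b : ι → V → ℂ} {Ω : V → ℝ} {Λ : ℝ}
    (hD : IsCoreData s r β c δ α R M m m' b) (hΩ : Measurable Ω) (hΩb : ∀ z, |Ω z| ≤ Λ)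
    (hΩh : ∀ t : ℝ, 0 < t → ∀ z, z ≠ 0 → Ω (t • z) = Ω z) (v ξ : V) :
    |⟪v, ξ⟫| * ‖capFourier s Ω δ m b v ξ‖ ≤
      ‖ξ‖ * ∑ j, (‖capFourierRadial s Ω δ c m m' b v j ξ‖ +
        ‖capFourierAngular s Ω δ m b v j ξ‖) := by
  have hΛ : 0 ≤ Λ := (abs_nonneg _).trans (hΩb 0)
  have hpi : (2 * Real.pi * Complex.I : ℂ) ≠ 0 := Complex.two_pi_I_ne_zero
  have key : (⟪v, ξ⟫ : ℂ) * capFourier s Ω δ m b v ξ =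
      ∑ j, (⟪stdOrthonormalBasis ℝ V j, ξ⟫ : ℂ) *
        (-capFourierRadial s Ω δ c m m' b v j ξ + capFourierAngular s Ω δ m b v j ξ) := by
    apply mul_left_cancel₀ hpi
    obtain ⟨G, hG⟩ : ∃ G : ι → ℂ, ∀ i, 𝓕 (fun z : V => ((capped Ω δ v z * ‖z‖⁻¹ *
        ((Module.finrank ℝ V - 1) * m i z + m' i z) : ℝ) : ℂ)) ξ = G i := ⟨_, fun _ => rfl⟩
    unfold capFourier capFourierRadial capFourierAngular
    simp_rw [hG]
    simp_rw [mul_add, Finset.sum_add_distrib, ← Finset.sum_neg_distrib, Finset.mul_sum]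
    rw [Finset.sum_comm, Finset.sum_comm (s := Finset.univ) (t := s), mul_add, Finset.mul_sum,
      Finset.mul_sum, ← Finset.sum_add_distrib]
    refine Finset.sum_congr rfl fun i hi => ?_
    have hr := hD.r_pos i hi
    have hM := hD.M_nonneg
    have h1 := inner_mul_fourier_radial hr (by positivity) hΛ (hD.kernel i hi)
      (measurable_capped hΩ δ v) (abs_capped_le hΩb δ v) (capped_smul hΩh δ v) v ξ
    have h2 := fourierPush_mean_zero (hD.b_int i hi) (hD.b_mean i hi) (c i) (hD.b_supp i hi) ξ
    simp_rw [fourierPush_contraction] at h2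
    rw [← mul_assoc, ← mul_assoc, h1, hG, add_mul]
    congr 1
    · rw [h2, Finset.mul_sum, Finset.mul_sum, Finset.mul_sum]
      refine Finset.sum_congr rfl fun j _ => ?_
      ring
    · rw [Finset.mul_sum, Finset.mul_sum, Finset.sum_mul]
      refine Finset.sum_congr rfl fun j _ => ?_
      ring
  rw [← Complex.norm_real ⟪v, ξ⟫ |>.trans (Real.norm_eq_abs _), ← norm_mul, key, Finset.mul_sum]
  refine (norm_sum_le _ _).trans (Finset.sum_le_sum fun j _ => ?_)
  rw [norm_mul, Complex.norm_real]
  have h3 : ‖⟪stdOrthonormalBasis ℝ V j, ξ⟫‖ ≤ ‖ξ‖ :=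
    (norm_inner_le_norm _ _).trans (by rw [(stdOrthonormalBasis ℝ V).orthonormal.1 j, one_mul])
  gcongr
  exact (norm_add_le _ _).trans (by rw [norm_neg])

variable (V) in
theorem lintegral_capFourierAngular_le (R : ℝ) (hR : 0 ≤ R) : ∃ C : ℝ, 0 < C ∧
    ∀ {ι : Type} (s : Finset ι) (r β : ι → ℝ) (c : ι → V) (δ α M : ℝ)
      (m m' : ι → V → ℝ) (b : ι → V → ℂ) (Ω : V → ℝ) (Λ : ℝ) (v : V) (j),
      IsCoreData s r β c δ α R M m m' b → Measurable Ω → (∀ z, |Ω z| ≤ Λ) → ‖v‖ ≤ 2 →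
      ∫⁻ ξ, ‖capFourierAngular s Ω δ m b v j ξ‖ₑ ^ 2
        ≤ ENNReal.ofReal (C * δ ^ 2 * (Λ * M) ^ 2 * (δ ^ Module.finrank ℝ V / δ) ^ 2 * α
            * ∑ i ∈ s, β i) := by
  obtain ⟨C, hC, hmain⟩ := lintegral_fourier_sum_tube_le V 2 R one_le_two hR
  refine ⟨C, hC, fun s r β c δ α M m m' b Ω Λ v j hD hΩ hΩb hv => ?_⟩
  have hΛ : 0 ≤ Λ := (abs_nonneg _).trans (hΩb 0)
  have hδ := hD.δ_pos
  have hM := hD.M_nonneg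
  have h1 := hmain volume s r β c δ α v
    (fun i z => ((capped Ω δ v z * ⟪v - ‖z‖⁻¹ • z, stdOrthonormalBasis ℝ V j⟫ * m i z : ℝ) : ℂ))
    (fun _ => id)
    b (fun i => Λ * δ * (M / r i ^ Module.finrank ℝ V)) β (δ * (Λ * M)) hD.δ_pos hD.δ_le
    hD.α_nonneg hv (by positivity) hD.r_pos hD.β_le hD.disj
    (fun i hi => Complex.measurable_ofReal.comp
      (((measurable_capped hΩ δ v).mul (by fun_prop)).mul (hD.kernel i hi).meas))
    (fun i hi z => ?_) (fun i hi => ?_) (fun i hi z hz => ?_)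
    (fun _ _ => measurable_id) hD.b_int hD.b_supp hD.b_norm (fun i hi => le_of_eq (by ring))
  · refine h1.trans (ENNReal.ofReal_le_ofReal (le_of_eq ?_))
    ring
  · rw [Complex.norm_real, Real.norm_eq_abs]
    have := hD.r_pos i hi
    refine abs_mul_mul_le_of_annulus (r := r i)
      (φ := fun z => ⟪v - ‖z‖⁻¹ • z, stdOrthonormalBasis ℝ V j⟫) (by positivity) hΛ hδ.le (hD.kernel i hi).bound
      (hD.kernel i hi).supp (abs_capped_le hΩb δ v) (fun z hz _ _ => ?_) z
    refine (abs_real_inner_le_norm _ _).trans ?_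
    rw [(stdOrthonormalBasis ℝ V).orthonormal.1 j, mul_one, norm_sub_rev]
    exact norm_sub_le_of_capped_ne_zero hz
  · have := hD.r_pos i hi
    positivity
  · have h1 : capped Ω δ v z * ⟪v - ‖z‖⁻¹ • z, stdOrthonormalBasis ℝ V j⟫ * m i z ≠ 0 := by
      exact_mod_cast hz
    exact mem_tube_of_capped_ne_zero hδ.le (left_ne_zero_of_mul (left_ne_zero_of_mul h1))
      ((hD.kernel i hi).supp z (right_ne_zero_of_mul h1)).2

variable (V) in
theorem lintegral_capFourierRadial_le (R : ℝ) (hR : 0 ≤ R) : ∃ C : ℝ, 0 < C ∧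
    ∀ {ι : Type} (s : Finset ι) (r β : ι → ℝ) (c : ι → V) (δ α M : ℝ)
      (m m' : ι → V → ℝ) (b : ι → V → ℂ) (Ω : V → ℝ) (Λ : ℝ) (v : V) (j),
      IsCoreData s r β c δ α R M m m' b → Measurable Ω → (∀ z, |Ω z| ≤ Λ) → ‖v‖ ≤ 2 →
      ∫⁻ ξ, ‖capFourierRadial s Ω δ c m m' b v j ξ‖ₑ ^ 2
        ≤ ENNReal.ofReal (C * δ ^ 2 * (Λ * M) ^ 2 * (δ ^ Module.finrank ℝ V / δ) ^ 2 * α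
            * ∑ i ∈ s, β i) := by
  obtain ⟨C, hC, hmain⟩ := lintegral_fourier_sum_tube_le V 2 R one_le_two hR
  set n := Module.finrank ℝ V with hn
  refine ⟨C * (2 * (n + 2) * (R + 1)) ^ 2, by positivity,
    fun s r β c δ α M m m' b Ω Λ v j hD hΩ hΩb hv => ?_⟩
  have hΛ : 0 ≤ Λ := (abs_nonneg _).trans (hΩb 0)
  have hδ := hD.δ_pos
  have hM := hD.M_nonneg
  have hej : ‖stdOrthonormalBasis ℝ V j‖ ≤ 1 := ((stdOrthonormalBasis ℝ V).orthonormal.1 j).le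
  have hbd : ∀ i ∈ s, ∀ z, |(n - 1 : ℝ) * m i z + m' i z| ≤ (n + 2) * (M / r i ^ n) := by
    intro i hi z
    have h1 := (hD.kernel i hi).bound z
    have h2 := (hD.kernel i hi).bound' z
    have h3 : |(n - 1 : ℝ)| ≤ n + 1 := by
      rw [abs_le]; constructor <;> linarith [Nat.cast_nonneg (α := ℝ) n]
    calc |(n - 1 : ℝ) * m i z + m' i z| ≤ |(n - 1 : ℝ)| * |m i z| + |m' i z| := by
          rw [← abs_mul]; exact abs_add_le _ _
      _ ≤ (n + 1) * (M / r i ^ n) + M / r i ^ n := by gcongr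
      _ = _ := by ring
  have hsp : ∀ i ∈ s, ∀ z, (n - 1 : ℝ) * m i z + m' i z ≠ 0 →
      r i / 2 ≤ ‖z‖ ∧ ‖z‖ ≤ 2 * r i := by
    intro i hi z hz
    by_cases h0 : m i z = 0
    · exact (hD.kernel i hi).supp' z fun h => hz (by rw [h0, h]; ring)
    · exact (hD.kernel i hi).supp z h0
  have h1 := hmain (homotopyMeasure V) s r β c δ α v
    (fun i z => ((capped Ω δ v z * ‖z‖⁻¹ * ((n - 1) * m i z + m' i z) : ℝ) : ℂ))
    (fun i => contraction (c i))
    (fun i x => (⟪x.2 - c i, stdOrthonormalBasis ℝ V j⟫ : ℂ) * b i x.2)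
    (fun i => Λ * (2 / r i) * ((n + 2) * (M / r i ^ n))) (fun i => R * δ * r i * β i)
    (2 * (n + 2) * (R + 1) * δ * (Λ * M)) hD.δ_pos hD.δ_le
    hD.α_nonneg hv (by positivity) hD.r_pos hD.β_le hD.disj
    (fun i hi => Complex.measurable_ofReal.comp
      (((measurable_capped hΩ δ v).mul (by fun_prop)).mul
        (((hD.kernel i hi).meas.const_mul _).add (hD.kernel i hi).meas')))
    (fun i hi z => ?_) (fun i hi => ?_) (fun i hi z hz => ?_)
    (fun i hi => measurable_contraction (c i))
    (fun i hi => integrable_moment (hD.b_int i hi) (hD.b_supp i hi) _ hej)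
    (fun i hi y hy => (norm_contraction_sub_le _ _).trans
      (hD.b_supp i hi _ (right_ne_zero_of_mul hy)))
    (fun i hi => (integral_norm_moment_le (hD.b_int i hi) (hD.b_supp i hi) _ hej).trans ?_)
    (fun i hi => ?_)
  · refine h1.trans (ENNReal.ofReal_le_ofReal (le_of_eq ?_))
    ring
  · rw [Complex.norm_real, Real.norm_eq_abs]
    have := hD.r_pos i hi
    refine abs_mul_mul_le_of_annulus (r := r i) (φ := fun z => ‖z‖⁻¹) (Φ := 2 / r i)
      (by positivity) hΛ (by positivity) (hbd i hi)
      (hsp i hi) (abs_capped_le hΩb δ v) (fun z hz h1 _ => ?_) z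
    rw [abs_of_nonneg (by positivity), ← inv_div]
    gcongr
  · have := hD.r_pos i hi
    positivity
  · have h1 : capped Ω δ v z * ‖z‖⁻¹ * ((n - 1) * m i z + m' i z) ≠ 0 := by
      exact_mod_cast hz
    exact mem_tube_of_capped_ne_zero hδ.le (left_ne_zero_of_mul (left_ne_zero_of_mul h1))
      (hsp i hi z (right_ne_zero_of_mul h1)).2
  · have := hD.r_pos i hi
    exact mul_le_mul_of_nonneg_left (hD.b_norm i hi) (by positivity)
  · have := hD.r_pos i hi
    have h2 := (hD.β_le i hi).1
    have h3 : Λ * (2 / r i) * ((n + 2) * (M / r i ^ n)) * (R * δ * r i * β i)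
        = 2 * (n + 2) * R * δ * (Λ * M) * (β i / r i ^ n) := by
      field_simp
    rw [h3]
    gcongr
    linarith

end Contraction

section ErrorTerms

open scoped FourierTransform RealInnerProductSpace

variable {V : Type*} [NormedAddCommGroup V] [InnerProductSpace ℝ V] [FiniteDimensional ℝ V]
  [MeasurableSpace V] [BorelSpace V]

theorem enorm_sq_eq_ofReal {E : Type*} [NormedAddCommGroup E] (x : E) :
    ‖x‖ₑ ^ 2 = ENNReal.ofReal (‖x‖ ^ 2) := by
  rw [ENNReal.ofReal_pow (norm_nonneg x), ofReal_norm]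

theorem continuous_capFourierRadial {ι : Type} {s : Finset ι} {r β : ι → ℝ} {c : ι → V}
    {δ α R M : ℝ} {m m' : ι → V → ℝ} {b : ι → V → ℂ} {Ω : V → ℝ} {Λ : ℝ}
    (hD : IsCoreData s r β c δ α R M m m' b) (hΩ : Measurable Ω) (hΩb : ∀ z, |Ω z| ≤ Λ)
    (v : V) (j) : Continuous (capFourierRadial s Ω δ c m m' b v j) := by
  have hΛ : 0 ≤ Λ := (abs_nonneg _).trans (hΩb 0)
  have hM := hD.M_nonneg
  unfold capFourierRadial
  refine continuous_finsetSum _ fun i hi => ?_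
  have hr := hD.r_pos i hi
  have hk := hD.kernel i hi
  have hφ : ∀ z : V, capped Ω δ v z ≠ 0 → r i / 2 ≤ ‖z‖ → ‖z‖ ≤ 2 * r i → |‖z‖⁻¹| ≤ 2 / r i := by
    intro z _ h1 _
    rw [abs_of_nonneg (by positivity), ← inv_div]
    gcongr
  refine Continuous.mul (continuous_fourier ?_) (continuous_fourierPush (measurable_contraction _)
    (integrable_moment (hD.b_int i hi) (hD.b_supp i hi) _
      ((stdOrthonormalBasis ℝ V).orthonormal.1 j).le))
  have hB : 0 ≤ M / r i ^ Module.finrank ℝ V := by positivity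
  have h1 := integrable_of_annulus (φ := fun z : V => ‖z‖⁻¹) hB hΛ (by positivity) hk.meas
    (measurable_capped hΩ δ v) (by fun_prop) hk.bound hk.supp (abs_capped_le hΩb δ v) hφ
  have h2 := integrable_of_annulus (φ := fun z : V => ‖z‖⁻¹) hB hΛ (by positivity) hk.meas'
    (measurable_capped hΩ δ v) (by fun_prop) hk.bound' hk.supp' (abs_capped_le hΩb δ v) hφ
  refine ((h1.const_mul (Module.finrank ℝ V - 1 : ℂ)).add h2).congr (ae_of_all _ fun z => ?_)
  simp only [Pi.add_apply]
  push_cast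
  ring

theorem continuous_capFourierAngular {ι : Type} {s : Finset ι} {r β : ι → ℝ} {c : ι → V}
    {δ α R M : ℝ} {m m' : ι → V → ℝ} {b : ι → V → ℂ} {Ω : V → ℝ} {Λ : ℝ}
    (hD : IsCoreData s r β c δ α R M m m' b) (hΩ : Measurable Ω) (hΩb : ∀ z, |Ω z| ≤ Λ)
    (v : V) (j) : Continuous (capFourierAngular s Ω δ m b v j) := by
  have hΛ : 0 ≤ Λ := (abs_nonneg _).trans (hΩb 0)
  have hM := hD.M_nonneg
  unfold capFourierAngular
  refine continuous_finsetSum _ fun i hi => ?_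
  have hr := hD.r_pos i hi
  have hk := hD.kernel i hi
  refine Continuous.mul (continuous_fourier ?_) (continuous_fourierPush measurable_id
    (hD.b_int i hi))
  have hB : 0 ≤ M / r i ^ Module.finrank ℝ V := by positivity
  refine integrable_of_annulus (φ := fun z : V => ⟪v - ‖z‖⁻¹ • z, stdOrthonormalBasis ℝ V j⟫) hB hΛ
    hD.δ_pos.le hk.meas
    (measurable_capped hΩ δ v) (by fun_prop) hk.bound hk.supp (abs_capped_le hΩb δ v)
    (fun z hz _ _ => ?_)
  refine (abs_real_inner_le_norm _ _).trans ?_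
  rw [(stdOrthonormalBasis ℝ V).orthonormal.1 j, mul_one, norm_sub_rev]
  exact norm_sub_le_of_capped_ne_zero hz

variable (V) in
theorem lintegral_capFourier_off_band_le (R : ℝ) (hR : 0 ≤ R) : ∃ C : ℝ, 0 < C ∧
    ∀ {ι : Type} (s : Finset ι) (r β : ι → ℝ) (c : ι → V) (δ α M : ℝ)
      (m m' : ι → V → ℝ) (b : ι → V → ℂ) (Ω : V → ℝ) (Λ : ℝ) (v : V) (ρ : ℝ),
      IsCoreData s r β c δ α R M m m' b → Measurable Ω → (∀ z, |Ω z| ≤ Λ) →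
      (∀ t : ℝ, 0 < t → ∀ z, z ≠ 0 → Ω (t • z) = Ω z) → ‖v‖ ≤ 2 → 0 < ρ →
      ∫⁻ ξ in {ξ | ρ * ‖ξ‖ < |⟪v, ξ⟫|}, ‖capFourier s Ω δ m b v ξ‖ₑ ^ 2
        ≤ ENNReal.ofReal (C * (δ / ρ) ^ 2 * (Λ * M) ^ 2 * (δ ^ Module.finrank ℝ V / δ) ^ 2 * α
            * ∑ i ∈ s, β i) := by
  obtain ⟨C₁, hC₁, hA⟩ := lintegral_capFourierAngular_le V R hR
  obtain ⟨C₂, hC₂, hB⟩ := lintegral_capFourierRadial_le V R hR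
  set n := Module.finrank ℝ V with hn
  refine ⟨2 * (n + 1) ^ 2 * (C₁ + C₂), by positivity,
    fun s r β c δ α M m m' b Ω Λ v ρ hD hΩ hΩb hΩh hv hρ => ?_⟩
  set X : ℝ := δ ^ 2 * (Λ * M) ^ 2 * (δ ^ n / δ) ^ 2 * α * ∑ i ∈ s, β i with hX
  have hX0 : 0 ≤ X := by
    have := hD.α_nonneg
    have : 0 ≤ ∑ i ∈ s, β i := Finset.sum_nonneg fun i hi => (hD.β_le i hi).1
    positivity
  have hpt : ∀ ξ ∈ {ξ : V | ρ * ‖ξ‖ < |⟪v, ξ⟫|}, ‖capFourier s Ω δ m b v ξ‖ₑ ^ 2 ≤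
      ENNReal.ofReal (2 * n / ρ ^ 2) * ∑ j, (‖capFourierRadial s Ω δ c m m' b v j ξ‖ₑ ^ 2 +
        ‖capFourierAngular s Ω δ m b v j ξ‖ₑ ^ 2) := by
    intro ξ hξ
    have hξ : ρ * ‖ξ‖ < |⟪v, ξ⟫| := hξ
    have h1 := abs_inner_mul_norm_capFourier_le hD hΩ hΩb hΩh v ξ
    simp_rw [enorm_sq_eq_ofReal]
    simp_rw [← ENNReal.ofReal_add (sq_nonneg _) (sq_nonneg _)]
    rw [← ENNReal.ofReal_sum_of_nonneg fun _ _ => by positivity,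
      ← ENNReal.ofReal_mul (by positivity)]
    refine ENNReal.ofReal_le_ofReal ?_
    set S := ∑ j, (‖capFourierRadial s Ω δ c m m' b v j ξ‖ +
        ‖capFourierAngular s Ω δ m b v j ξ‖) with hS
    have hξ0 : 0 < ‖ξ‖ := by
      rw [norm_pos_iff]; rintro rfl; simp at hξ
    have h2 : ρ * ‖capFourier s Ω δ m b v ξ‖ ≤ S := by
      have h3 : ‖ξ‖ * (ρ * ‖capFourier s Ω δ m b v ξ‖) ≤ ‖ξ‖ * S := by
        refine le_trans ?_ h1
        rw [← mul_assoc, mul_comm ‖ξ‖ ρ]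
        gcongr
      exact le_of_mul_le_mul_left h3 hξ0
    have h4 : S ^ 2 ≤ n * ∑ j, (‖capFourierRadial s Ω δ c m m' b v j ξ‖ +
        ‖capFourierAngular s Ω δ m b v j ξ‖) ^ 2 := by
      have := sq_sum_le_card_mul_sum_sq (s := Finset.univ)
        (f := fun j => ‖capFourierRadial s Ω δ c m m' b v j ξ‖ +
        ‖capFourierAngular s Ω δ m b v j ξ‖)
      rwa [Finset.card_univ, Fintype.card_fin] at this
    have h5 : ∑ j, (‖capFourierRadial s Ω δ c m m' b v j ξ‖ +
        ‖capFourierAngular s Ω δ m b v j ξ‖) ^ 2 ≤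
        2 * ∑ j, (‖capFourierRadial s Ω δ c m m' b v j ξ‖ ^ 2 +
        ‖capFourierAngular s Ω δ m b v j ξ‖ ^ 2) := by
      rw [Finset.mul_sum]
      exact Finset.sum_le_sum fun j _ => add_sq_le
    have h6 : ‖capFourier s Ω δ m b v ξ‖ ^ 2 = (ρ * ‖capFourier s Ω δ m b v ξ‖) ^ 2 / ρ ^ 2 := by
      field_simp
    rw [h6, div_mul_eq_mul_div]
    gcongr
    calc (ρ * ‖capFourier s Ω δ m b v ξ‖) ^ 2 ≤ S ^ 2 := by gcongr
      _ ≤ _ := h4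
      _ ≤ _ := mul_le_mul_of_nonneg_left h5 (Nat.cast_nonneg n)
      _ = _ := by ring
  have hmR : ∀ j, Measurable fun ξ => ‖capFourierRadial s Ω δ c m m' b v j ξ‖ₑ ^ 2 := fun j =>
    ((continuous_capFourierRadial hD hΩ hΩb v j).measurable.enorm).pow_const 2
  calc ∫⁻ ξ in {ξ | ρ * ‖ξ‖ < |⟪v, ξ⟫|}, ‖capFourier s Ω δ m b v ξ‖ₑ ^ 2
      ≤ ∫⁻ ξ in {ξ | ρ * ‖ξ‖ < |⟪v, ξ⟫|}, ENNReal.ofReal (2 * n / ρ ^ 2) *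
          ∑ j, (‖capFourierRadial s Ω δ c m m' b v j ξ‖ₑ ^ 2 +
            ‖capFourierAngular s Ω δ m b v j ξ‖ₑ ^ 2) :=
        setLIntegral_mono' (measurableSet_lt (by fun_prop) (by fun_prop)) hpt
    _ ≤ ∫⁻ ξ, ENNReal.ofReal (2 * n / ρ ^ 2) *
          ∑ j, (‖capFourierRadial s Ω δ c m m' b v j ξ‖ₑ ^ 2 +
            ‖capFourierAngular s Ω δ m b v j ξ‖ₑ ^ 2) := setLIntegral_le_lintegral _ _
    _ = ENNReal.ofReal (2 * n / ρ ^ 2) *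
          ∑ j, ((∫⁻ ξ, ‖capFourierRadial s Ω δ c m m' b v j ξ‖ₑ ^ 2) +
            ∫⁻ ξ, ‖capFourierAngular s Ω δ m b v j ξ‖ₑ ^ 2) := by
        have hmA : ∀ j, Measurable fun ξ => ‖capFourierAngular s Ω δ m b v j ξ‖ₑ ^ 2 := fun j =>
          ((continuous_capFourierAngular hD hΩ hΩb v j).measurable.enorm).pow_const 2
        rw [lintegral_const_mul _ (Finset.measurable_fun_sum _ fun j _ => by
            exact (hmR j).add (hmA j)),
          lintegral_finsetSum _ fun j _ => by exact (hmR j).add (hmA j)]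
        simp_rw [lintegral_add_left (hmR _)]
    _ ≤ ENNReal.ofReal (2 * n / ρ ^ 2) * ∑ j : Fin n, ENNReal.ofReal ((C₁ + C₂) * X) := by
        gcongr with j
        refine (add_le_add (hB s r β c δ α M m m' b Ω Λ v j hD hΩ hΩb hv)
          (hA s r β c δ α M m m' b Ω Λ v j hD hΩ hΩb hv)).trans ?_
        rw [← ENNReal.ofReal_add]
        · exact ENNReal.ofReal_le_ofReal (le_of_eq (by rw [hX]; ring))
        · exact le_of_le_of_eq (mul_nonneg hC₂.le hX0) (by rw [hX]; ring)
        · exact le_of_le_of_eq (mul_nonneg hC₁.le hX0) (by rw [hX]; ring)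
    _ ≤ _ := by
        rw [← ENNReal.ofReal_sum_of_nonneg fun _ _ => by positivity,
          ← ENNReal.ofReal_mul (by positivity)]
        refine ENNReal.ofReal_le_ofReal ?_
        rw [Finset.sum_const, Finset.card_univ, Fintype.card_fin, nsmul_eq_mul]
        have h7 : 2 * (n + 1) ^ 2 * (C₁ + C₂) * (δ / ρ) ^ 2 * (Λ * M) ^ 2 *
            (δ ^ n / δ) ^ 2 * α * ∑ i ∈ s, β i = 2 * (n + 1) ^ 2 / ρ ^ 2 * ((C₁ + C₂) * X) := by
          rw [hX, div_pow δ ρ]; ring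
        rw [h7]
        have h8 : 2 * n / ρ ^ 2 * (n * ((C₁ + C₂) * X))
          = 2 * (n : ℝ) ^ 2 / ρ ^ 2 * ((C₁ + C₂) * X) := by ring
        rw [h8]
        gcongr
        linarith

end ErrorTerms

section FourierBound

open scoped FourierTransform RealInnerProductSpace

variable {V : Type*} [NormedAddCommGroup V] [InnerProductSpace ℝ V] [FiniteDimensional ℝ V]
  [MeasurableSpace V] [BorelSpace V]

theorem abs_norm_sub_one_le_of_capped_ne_zero {Ω : V → ℝ} {δ : ℝ} {v z : V} (hz : z ≠ 0)
    (h : capped Ω δ v z ≠ 0) : |‖v‖ - 1| ≤ δ := by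
  refine le_trans ?_ (norm_sub_le_of_capped_ne_zero h)
  have h1 : ‖‖z‖⁻¹ • z‖ = 1 := by
    rw [norm_smul, norm_inv, norm_norm, inv_mul_cancel₀ (norm_ne_zero_iff.mpr hz)]
  rw [norm_sub_rev, ← h1]
  exact abs_norm_sub_norm_le _ _

theorem integral_capped (Ω : V → ℝ) (δ : ℝ) (z : V) :
    ∫ v, (capped Ω δ v z : ℂ) = volume.real (closedBall (0 : V) δ) * Ω z := by
  have h1 : (fun v => (capped Ω δ v z : ℂ)) =
      (closedBall (‖z‖⁻¹ • z) δ).indicator fun _ => (Ω z : ℂ) := by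
    ext v
    by_cases h : ‖‖z‖⁻¹ • z - v‖ ≤ δ
    · rw [Set.indicator_of_mem (by rwa [mem_closedBall', dist_eq_norm]), capped, if_pos h]
    · rw [Set.indicator_of_notMem (by rwa [mem_closedBall', dist_eq_norm]), capped, if_neg h,
        Complex.ofReal_zero]
  rw [h1, integral_indicator_const _ measurableSet_closedBall, Complex.real_smul, measureReal_def,
    measureReal_def, Measure.addHaar_closedBall_center]

theorem integrable_capped_prod {r B Λ δ : ℝ} (hr : 0 < r) (hδ1 : δ ≤ 1) {m m' Ω : V → ℝ}
    (hm : IsRadialKernel r B m m') (hΩ : Measurable Ω) (hΩb : ∀ z, |Ω z| ≤ Λ) (ξ : V) :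
    Integrable (fun x : V × V => 𝐞 (-⟪x.2, ξ⟫) • ((capped Ω δ x.1 x.2 * m x.2 : ℝ) : ℂ))
      (volume.prod volume) := by
  have hΛ : 0 ≤ Λ := (abs_nonneg _).trans (hΩb 0)
  have hmeas : Measurable fun x : V × V => ((capped Ω δ x.1 x.2 * m x.2 : ℝ) : ℂ) :=
    Complex.measurable_ofReal.comp
      ((measurable_capped_uncurry hΩ δ).mul (hm.meas.comp measurable_snd))
  have hc : Measurable fun x : V × V => (𝐞 (-⟪x.2, ξ⟫) : ℂ) := Continuous.measurable (by fun_prop)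
  have h1 : IntegrableOn (fun x : V × V => 𝐞 (-⟪x.2, ξ⟫) • ((capped Ω δ x.1 x.2 * m x.2 : ℝ) : ℂ))
      (closedBall 0 2 ×ˢ closedBall 0 (2 * r)) (volume.prod volume) := by
    refine Measure.integrableOn_of_bounded (M := Λ * B) ?_ ?_ (ae_of_all _ fun x => ?_)
    · rw [Measure.prod_prod]
      exact (ENNReal.mul_lt_top measure_closedBall_lt_top measure_closedBall_lt_top).ne
    · simp_rw [Circle.smul_def, smul_eq_mul]
      exact (hc.mul hmeas).aestronglyMeasurable
    · rw [Circle.norm_smul, Complex.norm_real, Real.norm_eq_abs, abs_mul]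
      exact mul_le_mul (abs_capped_le hΩb δ _ _) (hm.bound _) (abs_nonneg _) hΛ
  refine (integrableOn_iff_integrable_of_support_subset fun x hx => ?_).mp h1
  have h2 : capped Ω δ x.1 x.2 * m x.2 ≠ 0 := by
    intro h
    exact hx (by simp only [h, Complex.ofReal_zero, smul_zero])
  have h3 := hm.supp _ (right_ne_zero_of_mul h2)
  have h4 : x.2 ≠ 0 := by
    intro h; rw [h, norm_zero] at h3; linarith
  have h5 := abs_norm_sub_one_le_of_capped_ne_zero h4 (left_ne_zero_of_mul h2)
  rw [Set.mem_prod, mem_closedBall_zero_iff, mem_closedBall_zero_iff]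
  exact ⟨by linarith [(abs_le.mp h5).2], h3.2⟩

theorem integral_fourier_capped {r B Λ δ : ℝ} (hr : 0 < r) (hδ1 : δ ≤ 1)
    {m m' Ω : V → ℝ}
    (hm : IsRadialKernel r B m m') (hΩ : Measurable Ω) (hΩb : ∀ z, |Ω z| ≤ Λ) (ξ : V) :
    ∫ v, 𝓕 (fun z => ((capped Ω δ v z * m z : ℝ) : ℂ)) ξ =
      volume.real (closedBall (0 : V) δ) * 𝓕 (fun z => ((Ω z * m z : ℝ) : ℂ)) ξ := by
  have h1 := integrable_capped_prod (δ := δ) hr hδ1 hm hΩ hΩb ξ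
  simp_rw [Real.fourier_eq]
  rw [integral_integral_swap h1, ← integral_const_mul]
  refine integral_congr_ae (ae_of_all _ fun z => ?_)
  simp_rw [Circle.smul_def, smul_eq_mul, Complex.ofReal_mul]
  rw [integral_const_mul, integral_mul_const, integral_capped]
  ring

theorem integrable_fourier_capped {r B Λ δ : ℝ} (hr : 0 < r) (hδ1 : δ ≤ 1)
    {m m' Ω : V → ℝ}
    (hm : IsRadialKernel r B m m') (hΩ : Measurable Ω) (hΩb : ∀ z, |Ω z| ≤ Λ) (ξ : V) :
    Integrable fun v => 𝓕 (fun z => ((capped Ω δ v z * m z : ℝ) : ℂ)) ξ := by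
  have h1 := (integrable_capped_prod (δ := δ) hr hδ1 hm hΩ hΩb ξ).integral_prod_left
  simpa only [Real.fourier_eq] using h1

/-- The Fourier transform of `∑ i, (Ω m i) * b i`. -/
def roughFourier {ι : Type} (s : Finset ι) (Ω : V → ℝ) (m : ι → V → ℝ) (b : ι → V → ℂ)
    (ξ : V) : ℂ :=
  ∑ i ∈ s, 𝓕 (fun z => ((Ω z * m i z : ℝ) : ℂ)) ξ * fourierPush volume id (b i) ξ

variable {ι : Type} {s : Finset ι} {r β : ι → ℝ} {c : ι → V}
    {δ α R M : ℝ} {m m' : ι → V → ℝ} {b : ι → V → ℂ} {Ω : V → ℝ} {Λ : ℝ}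

theorem integral_capFourier (hD : IsCoreData s r β c δ α R M m m' b) (hΩ : Measurable Ω)
    (hΩb : ∀ z, |Ω z| ≤ Λ) (ξ : V) :
    ∫ v, capFourier s Ω δ m b v ξ =
      volume.real (closedBall (0 : V) δ) * roughFourier s Ω m b ξ := by
  unfold capFourier roughFourier
  rw [integral_finsetSum _ fun i hi => (integrable_fourier_capped (hD.r_pos i hi) hD.δ_le
    (hD.kernel i hi) hΩ hΩb ξ).mul_const _, Finset.mul_sum]
  refine Finset.sum_congr rfl fun i hi => ?_
  rw [integral_mul_const, integral_fourier_capped (hD.r_pos i hi) hD.δ_le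
    (hD.kernel i hi) hΩ hΩb ξ, mul_assoc]

theorem capFourier_eq_zero (hD : IsCoreData s r β c δ α R M m m' b) {v : V}
    (hv : ¬ |‖v‖ - 1| ≤ δ) (ξ : V) : capFourier s Ω δ m b v ξ = 0 := by
  unfold capFourier
  refine Finset.sum_eq_zero fun i hi => ?_
  have : (fun z => ((capped Ω δ v z * m i z : ℝ) : ℂ)) = fun _ => 0 := by
    ext z
    by_cases h1 : m i z = 0
    · rw [h1, mul_zero, Complex.ofReal_zero]
    by_cases h2 : capped Ω δ v z = 0
    · rw [h2, zero_mul, Complex.ofReal_zero]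
    have hz : z ≠ 0 := by
      rintro rfl
      have := (hD.kernel i hi).supp _ h1
      rw [norm_zero] at this
      linarith [hD.r_pos i hi]
    exact absurd (abs_norm_sub_one_le_of_capped_ne_zero hz h2) hv
  rw [this, Real.fourier_eq]
  simp

theorem measurable_capFourier (hD : IsCoreData s r β c δ α R M m m' b) (hΩ : Measurable Ω) :
    Measurable fun x : V × V => capFourier s Ω δ m b x.1 x.2 := by
  unfold capFourier
  refine Finset.measurable_fun_sum _ fun i hi => Measurable.mul ?_
    ((continuous_fourierPush measurable_id (hD.b_int i hi)).measurable.comp measurable_snd)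
  simp_rw [Real.fourier_eq]
  refine StronglyMeasurable.measurable ?_
  have : Measurable fun y : (V × V) × V =>
      (𝐞 (-⟪y.2, y.1.2⟫) : ℂ) * ((capped Ω δ y.1.1 y.2 * m i y.2 : ℝ) : ℂ) := by
    refine Measurable.mul (Continuous.measurable (by fun_prop)) (Complex.measurable_ofReal.comp ?_)
    exact ((measurable_capped_uncurry hΩ δ).comp
      ((measurable_fst.comp measurable_fst).prodMk measurable_snd)).mul
      ((hD.kernel i hi).meas.comp measurable_snd)
  exact this.stronglyMeasurable.integral_prod_right

end FourierBound

section DirectionAverage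

open scoped FourierTransform RealInnerProductSpace

theorem lintegral_sq_le_split {α : Type*} [MeasurableSpace α] {μ : Measure α} {f : α → ℝ≥0∞}
    (hf : Measurable f) {A G : Set α} (hG : MeasurableSet G)
    (h0 : ∀ x ∉ A, f x = 0) :
    (∫⁻ x, f x ∂μ) ^ 2 ≤ 2 * (μ (A \ G) * ∫⁻ x in A, f x ^ 2 ∂μ +
      μ A * ∫⁻ x in A, G.indicator (fun x => f x ^ 2) x ∂μ) := by
  have h1 : ∫⁻ x, f x ∂μ = ∫⁻ x in A \ G, f x ∂μ + ∫⁻ x in A ∩ G, f x ∂μ := by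
    rw [← setLIntegral_eq_of_support_subset (s := A) fun x hx => by
      by_contra h; exact hx (h0 x h)]
    rw [add_comm, lintegral_inter_add_sdiff _ _ hG]
  have h2 := lintegral_sq_le (μ.restrict (A \ G)) hf.aemeasurable
  have h3 := lintegral_sq_le (μ.restrict (A ∩ G)) hf.aemeasurable
  rw [Measure.restrict_apply_univ] at h2 h3
  have h4 : ∫⁻ x in A ∩ G, f x ^ 2 ∂μ = ∫⁻ x in A, G.indicator (fun x => f x ^ 2) x ∂μ := by
    rw [lintegral_indicator hG, Measure.restrict_restrict hG, Set.inter_comm]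
  rw [h1]
  calc (∫⁻ x in A \ G, f x ∂μ + ∫⁻ x in A ∩ G, f x ∂μ) ^ 2
      ≤ 2 * ((∫⁻ x in A \ G, f x ∂μ) ^ 2 + (∫⁻ x in A ∩ G, f x ∂μ) ^ 2) := by
        have := ENNReal.rpow_add_le_mul_rpow_add_rpow (∫⁻ x in A \ G, f x ∂μ)
          (∫⁻ x in A ∩ G, f x ∂μ) (p := 2) one_le_two
        norm_num at this
        exact this
    _ ≤ _ := by
        gcongr
        · exact h2.trans (mul_le_mul_right (lintegral_mono_set Set.sdiff_subset) _)
        · rw [← h4]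
          exact h3.trans (mul_le_mul_left (measure_mono Set.inter_subset_left) _)

variable {V : Type*} [NormedAddCommGroup V] [InnerProductSpace ℝ V] [FiniteDimensional ℝ V]
  [MeasurableSpace V] [BorelSpace V]

variable (V) in
theorem lintegral_roughFourier_le [Nontrivial V] (R : ℝ) (hR : 0 ≤ R) : ∃ C : ℝ, 0 < C ∧
    ∀ {ι : Type} (s : Finset ι) (r β : ι → ℝ) (c : ι → V) (δ α M : ℝ)
      (m m' : ι → V → ℝ) (b : ι → V → ℂ) (Ω : V → ℝ) (Λ : ℝ),
      IsCoreData s r β c δ α R M m m' b → Measurable Ω → (∀ z, |Ω z| ≤ Λ) →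
      (∀ t : ℝ, 0 < t → ∀ z, z ≠ 0 → Ω (t • z) = Ω z) →
      ∫⁻ ξ, ‖roughFourier s Ω m b ξ‖ₑ ^ 2
        ≤ ENNReal.ofReal (C * √δ * (Λ * M) ^ 2 * α * ∑ i ∈ s, β i) := by
  obtain ⟨C₁, hC₁, h1⟩ := lintegral_capFourier_le V R hR
  obtain ⟨C₂, hC₂, h2⟩ := lintegral_capFourier_off_band_le V R hR
  obtain ⟨C₃, hC₃, hband⟩ := volume_annulus_band_le V
  set n := Module.finrank ℝ V with hn
  set κ := volume.real (ball (0 : V) 1) with hκ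
  have hκ0 : 0 < κ := ENNReal.toReal_pos (measure_ball_pos _ _ one_pos).ne' measure_ball_lt_top.ne
  refine ⟨κ⁻¹ ^ 2 * (2 * (C₃ * (C₃ * 2) * C₁ + (C₃ * 2) * (C₃ * 2) * C₂)), by positivity,
    fun s r β c δ α M m m' b Ω Λ hD hΩ hΩb hΩh => ?_⟩
  have hδ := hD.δ_pos
  have hδ1 := hD.δ_le
  have hΛ : 0 ≤ Λ := (abs_nonneg _).trans (hΩb 0)
  have hβ : 0 ≤ ∑ i ∈ s, β i := Finset.sum_nonneg fun i hi => (hD.β_le i hi).1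
  have hα := hD.α_nonneg
  set X : ℝ := (Λ * M) ^ 2 * (δ ^ n / δ) ^ 2 * α * ∑ i ∈ s, β i with hX
  have hX0 : 0 ≤ X := by positivity
  set F : V → V → ℂ := capFourier s Ω δ m b with hF
  set A : Set V := {v | |‖v‖ - 1| ≤ δ} with hA
  have hAm : MeasurableSet A := measurableSet_le (by fun_prop) measurable_const
  set G : V → Set V := fun ξ => {v | √δ * ‖ξ‖ < |⟪v, ξ⟫|} with hG
  have hGm : ∀ ξ, MeasurableSet (G ξ) := fun ξ => measurableSet_lt (by fun_prop) (by fun_prop)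
  have hFm : Measurable fun x : V × V => F x.1 x.2 := measurable_capFourier hD hΩ
  have hA2 : ∀ v ∈ A, ‖v‖ ≤ 2 := fun v hv => by
    have := (abs_le.mp (show |‖v‖ - 1| ≤ δ from hv)).2
    linarith
  have hvolA : volume A ≤ ENNReal.ofReal (C₃ * 2 * δ) := by
    obtain ⟨ξ, hξ⟩ := exists_ne (0 : V)
    refine (measure_mono fun v hv => ?_).trans ((hband ξ δ 2 hξ hδ hδ1 two_pos).trans
      (ENNReal.ofReal_le_ofReal (le_of_eq (by ring))))
    refine ⟨hv, (abs_real_inner_le_norm _ _).trans ?_⟩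
    have := hA2 v hv
    gcongr
  have hvolB : ∀ ξ ≠ 0, volume (A \ G ξ) ≤ ENNReal.ofReal (C₃ * δ * √δ) := fun ξ hξ =>
    (measure_mono (fun v hv => ⟨hv.1, not_lt.mp hv.2⟩ :
      A \ G ξ ⊆ {v | |‖v‖ - 1| ≤ δ ∧ |⟪v, ξ⟫| ≤ √δ * ‖ξ‖})).trans
      (hband ξ δ (√δ) hξ hδ hδ1 (Real.sqrt_pos.mpr hδ))
  have hpt : ∀ᵐ ξ : V, ENNReal.ofReal ((κ * δ ^ n) ^ 2) * ‖roughFourier s Ω m b ξ‖ₑ ^ 2 ≤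
      2 * (ENNReal.ofReal (C₃ * δ * √δ) * (∫⁻ v in A, ‖F v ξ‖ₑ ^ 2) +
        ENNReal.ofReal (C₃ * 2 * δ) *
          ∫⁻ v in A, (G ξ).indicator (fun v => ‖F v ξ‖ₑ ^ 2) v) := by
    filter_upwards [show ∀ᵐ ξ : V, ξ ≠ 0 from Measure.ae_ne volume 0] with ξ hξ
    have h3 := integral_capFourier hD hΩ hΩb ξ
    have h4 : volume.real (closedBall (0 : V) δ) = κ * δ ^ n := by
      rw [measureReal_def, Measure.addHaar_closedBall _ _ hδ.le, ENNReal.toReal_mul,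
        ENNReal.toReal_ofReal (by positivity), mul_comm, hκ, measureReal_def]
    have h5 : ENNReal.ofReal ((κ * δ ^ n) ^ 2) * ‖roughFourier s Ω m b ξ‖ₑ ^ 2
        = ‖∫ v, F v ξ‖ₑ ^ 2 := by
      rw [h3, h4, enorm_mul, mul_pow ‖_‖ₑ, ENNReal.ofReal_pow (by positivity), ← ofReal_norm
        ((κ * δ ^ n : ℝ) : ℂ), Complex.norm_real, Real.norm_of_nonneg (by positivity)]
    rw [h5]
    calc ‖∫ v, F v ξ‖ₑ ^ 2 ≤ (∫⁻ v, ‖F v ξ‖ₑ) ^ 2 := by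
          gcongr; exact enorm_integral_le_lintegral_enorm _
      _ ≤ 2 * (volume (A \ G ξ) * (∫⁻ v in A, ‖F v ξ‖ₑ ^ 2) +
            volume A * ∫⁻ v in A, (G ξ).indicator (fun v => ‖F v ξ‖ₑ ^ 2) v) :=
          lintegral_sq_le_split (f := fun v => ‖F v ξ‖ₑ) (hFm.comp measurable_prodMk_right).enorm (hGm ξ)
          fun v hv => by
            simp only [hF, capFourier_eq_zero hD hv, enorm_zero]
      _ ≤ _ := by
          gcongr
          exact hvolB ξ hξ
  have hm1 : Measurable fun x : V × V => ‖F x.2 x.1‖ₑ ^ 2 :=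
    ((hFm.comp measurable_swap).enorm).pow_const 2
  have hm2 : Measurable fun x : V × V => (G x.1).indicator (fun v => ‖F v x.1‖ₑ ^ 2) x.2 := by
    have : (fun x : V × V => (G x.1).indicator (fun v => ‖F v x.1‖ₑ ^ 2) x.2) =
        Set.indicator {x : V × V | √δ * ‖x.1‖ < |⟪x.2, x.1⟫|} fun x => ‖F x.2 x.1‖ₑ ^ 2 := by
      ext x; rfl
    rw [this]
    exact hm1.indicator (measurableSet_lt (by fun_prop) (by fun_prop))
  have hI1 : ∫⁻ ξ, ∫⁻ v in A, ‖F v ξ‖ₑ ^ 2 ≤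
      ENNReal.ofReal (C₁ * X) * ENNReal.ofReal (C₃ * 2 * δ) := by
    rw [lintegral_lintegral_swap hm1.aemeasurable]
    calc ∫⁻ v in A, ∫⁻ ξ, ‖F v ξ‖ₑ ^ 2 ≤ ∫⁻ v in A, ENNReal.ofReal (C₁ * X) :=
          setLIntegral_mono' hAm fun v hv => (h1 s r β c δ α M m m' b Ω Λ v hD hΩ hΩb
            (hA2 v hv)).trans (ENNReal.ofReal_le_ofReal (le_of_eq (by rw [hX]; ring)))
      _ ≤ _ := by
          rw [setLIntegral_const]
          gcongr
  have hI2 : ∫⁻ ξ, ∫⁻ v in A, (G ξ).indicator (fun v => ‖F v ξ‖ₑ ^ 2) v ≤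
      ENNReal.ofReal (C₂ * δ * X) * ENNReal.ofReal (C₃ * 2 * δ) := by
    rw [lintegral_lintegral_swap hm2.aemeasurable]
    calc ∫⁻ v in A, ∫⁻ ξ, (G ξ).indicator (fun v => ‖F v ξ‖ₑ ^ 2) v
        ≤ ∫⁻ v in A, ENNReal.ofReal (C₂ * δ * X) :=
          setLIntegral_mono' hAm fun v hv => ?_
      _ ≤ _ := by
          rw [setLIntegral_const]
          gcongr
    have h6 := h2 s r β c δ α M m m' b Ω Λ v (√δ) hD hΩ hΩb hΩh (hA2 v hv)
      (Real.sqrt_pos.mpr hδ)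
    rw [← lintegral_indicator (measurableSet_lt (by fun_prop) (by fun_prop))] at h6
    refine le_trans (le_of_eq (lintegral_congr fun ξ => rfl)) (h6.trans ?_)
    refine ENNReal.ofReal_le_ofReal (le_of_eq ?_)
    have h7 : (δ / √δ) ^ 2 = δ := by rw [Real.div_sqrt, Real.sq_sqrt hδ.le]
    rw [h7, hX]; ring
  have hfin : ENNReal.ofReal ((κ * δ ^ n) ^ 2) * ∫⁻ ξ, ‖roughFourier s Ω m b ξ‖ₑ ^ 2 ≤
      2 * (ENNReal.ofReal (C₃ * δ * √δ) *
        (ENNReal.ofReal (C₁ * X) * ENNReal.ofReal (C₃ * 2 * δ)) +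
        ENNReal.ofReal (C₃ * 2 * δ) *
          (ENNReal.ofReal (C₂ * δ * X) * ENNReal.ofReal (C₃ * 2 * δ))) := by
    have hn1 : Measurable fun ξ => ∫⁻ v in A, ‖F v ξ‖ₑ ^ 2 := hm1.lintegral_prod_right'
    have hn2 : Measurable fun ξ => ∫⁻ v in A, (G ξ).indicator (fun v => ‖F v ξ‖ₑ ^ 2) v :=
      hm2.lintegral_prod_right'
    rw [← lintegral_const_mul' _ _ ENNReal.ofReal_ne_top]
    refine (lintegral_mono_ae hpt).trans ?_
    rw [lintegral_const_mul _ (by exact (hn1.const_mul _).add (hn2.const_mul _)),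
      lintegral_add_left (hn1.const_mul _), lintegral_const_mul _ hn1, lintegral_const_mul _ hn2]
    gcongr
  have hκδ : 0 < (κ * δ ^ n) ^ 2 := by positivity
  rw [mul_comm, ← ENNReal.le_div_iff_mul_le (Or.inl (ENNReal.ofReal_pos.mpr hκδ).ne')
    (Or.inl ENNReal.ofReal_ne_top)] at hfin
  refine hfin.trans ?_
  have h2' : (2 : ℝ≥0∞) = ENNReal.ofReal 2 := by simp
  rw [h2', ← ENNReal.ofReal_mul (by positivity), ← ENNReal.ofReal_mul (by positivity),
    ← ENNReal.ofReal_mul (by positivity), ← ENNReal.ofReal_mul (by positivity),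
    ← ENNReal.ofReal_add (by positivity) (by positivity), ← ENNReal.ofReal_mul (by positivity),
    ← ENNReal.ofReal_div_of_pos hκδ]
  refine ENNReal.ofReal_le_ofReal ?_
  have hsd : δ ≤ √δ := by
    calc δ = √δ * √δ := (Real.mul_self_sqrt hδ.le).symm
      _ ≤ √δ * 1 := by gcongr; exact Real.sqrt_le_one.mpr hδ1
      _ = √δ := mul_one _
  rw [div_le_iff₀ hκδ]
  have h8 : κ⁻¹ ^ 2 * (2 * (C₃ * (C₃ * 2) * C₁ + C₃ * 2 * (C₃ * 2) * C₂)) * √δ * (Λ * M) ^ 2 * α *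
      (∑ i ∈ s, β i) * (κ * δ ^ n) ^ 2 =
      (2 * (C₃ * (C₃ * 2) * C₁ + C₃ * 2 * (C₃ * 2) * C₂)) * √δ * (δ ^ 2 * X) := by
    rw [hX]; field_simp
  rw [h8]
  have h9 : 2 * (C₃ * δ * √δ * (C₁ * X * (C₃ * 2 * δ)) +
      C₃ * 2 * δ * (C₂ * δ * X * (C₃ * 2 * δ))) =
      2 * (C₃ * (C₃ * 2) * C₁ * √δ + C₃ * 2 * (C₃ * 2) * C₂ * δ) * (δ ^ 2 * X) := by ring
  rw [h9]
  have h10 : 2 * (C₃ * (C₃ * 2) * C₁ + C₃ * 2 * (C₃ * 2) * C₂) * √δ =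
    2 * (C₃ * (C₃ * 2) * C₁ * √δ + C₃ * 2 * (C₃ * 2) * C₂ * √δ) := by ring
  rw [h10]
  gcongr

end DirectionAverage

section RoughSum

open scoped FourierTransform RealInnerProductSpace

variable {V : Type*} [NormedAddCommGroup V] [InnerProductSpace ℝ V] [FiniteDimensional ℝ V]
  [MeasurableSpace V] [BorelSpace V]

theorem IsRadialKernel.integrable_mul {r B Λ : ℝ} {m m' Ω : V → ℝ} (hm : IsRadialKernel r B m m')
    (hΩ : Measurable Ω) (hΩb : ∀ z, |Ω z| ≤ Λ) :
    Integrable fun z => ((Ω z * m z : ℝ) : ℂ) := by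
  refine integrable_of_bounded_support (B := Λ * B) (R := 2 * r)
    (Complex.measurable_ofReal.comp (hΩ.mul hm.meas)) (fun z => ?_) (fun z hz => ?_)
  · rw [Complex.norm_real, Real.norm_eq_abs, abs_mul]
    exact mul_le_mul (hΩb z) (hm.bound z) (abs_nonneg _) ((abs_nonneg _).trans (hΩb 0))
  · have h1 : Ω z * m z ≠ 0 := by exact_mod_cast hz
    exact (hm.supp z (right_ne_zero_of_mul h1)).2

/-- The core `L²` estimate: the operators with rough kernels `Ω m i` applied to atoms `b i` at
distance `δ⁻¹` times the size of the atoms gain a power of `δ`. -/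
theorem lintegral_roughSum_le (V : Type*) [NormedAddCommGroup V] [InnerProductSpace ℝ V]
    [FiniteDimensional ℝ V] [MeasurableSpace V] [BorelSpace V] [Nontrivial V] (R : ℝ) (hR : 0 ≤ R) :
    ∃ C : ℝ, 0 < C ∧
    ∀ {ι : Type} (s : Finset ι) (r β : ι → ℝ) (c : ι → V) (δ α M : ℝ)
      (m m' : ι → V → ℝ) (b : ι → V → ℂ) (Ω : V → ℝ) (Λ : ℝ),
      IsCoreData s r β c δ α R M m m' b → Measurable Ω → (∀ z, |Ω z| ≤ Λ) →
      (∀ t : ℝ, 0 < t → ∀ z, z ≠ 0 → Ω (t • z) = Ω z) →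
      ∫⁻ x, ‖∑ i ∈ s, ∫ y, b i y * ((Ω (x - y) * m i (x - y) : ℝ) : ℂ)‖ₑ ^ 2
        ≤ ENNReal.ofReal (C * √δ * (Λ * M) ^ 2 * α * ∑ i ∈ s, β i) := by
  obtain ⟨C, hC, hmain⟩ := lintegral_roughFourier_le V R hR
  refine ⟨C, hC, fun s r β c δ α M m m' b Ω Λ hD hΩ hΩb hΩh => ?_⟩
  have hΛ : 0 ≤ Λ := (abs_nonneg _).trans (hΩb 0)
  have hint : ∀ i ∈ s, Integrable fun x => ∫ y, b i y * ((Ω (x - y) * m i (x - y) : ℝ) : ℂ) :=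
    fun i hi => (integrable_conv_push (p := fun y : V => y) (Complex.measurable_ofReal.comp
      (hΩ.mul (hD.kernel i hi).meas)) ((hD.kernel i hi).integrable_mul hΩ hΩb) measurable_id
      (hD.b_int i hi)).integral_prod_left
  have hL2 : ∀ i ∈ s,
      MemLp (fun x => ∫ y, b i y * ((Ω (x - y) * m i (x - y) : ℝ) : ℂ)) 2 := by
    intro i hi
    refine (memLp_two_iff_integrable_sq_norm (hint i hi).aestronglyMeasurable).mpr ?_
    simp_rw [sq]
    refine (hint i hi).norm.bdd_mul (c := (∫ y, ‖b i y‖) * (Λ * (M / r i ^ Module.finrank ℝ V)))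
      (hint i hi).norm.aestronglyMeasurable (ae_of_all _ fun x => ?_)
    rw [norm_norm, ← integral_mul_const]
    refine norm_integral_le_of_norm_le ((hD.b_int i hi).norm.mul_const _)
      (ae_of_all _ fun y => ?_)
    rw [norm_mul, Complex.norm_real, Real.norm_eq_abs, abs_mul]
    gcongr
    · exact hΩb _
    · exact (hD.kernel i hi).bound _
  have hF : ∀ ξ, 𝓕 (fun x => ∑ i ∈ s, ∫ y, b i y * ((Ω (x - y) * m i (x - y) : ℝ) : ℂ)) ξ =
      roughFourier s Ω m b ξ := by
    intro ξ
    unfold roughFourier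
    rw [Real.fourier_eq]
    simp_rw [Finset.smul_sum]
    rw [integral_finsetSum]
    · refine Finset.sum_congr rfl fun i hi => ?_
      rw [← Real.fourier_eq, ← fourier_conv_push (p := id)
        (h := fun z => ((Ω z * m i z : ℝ) : ℂ)) (Complex.measurable_ofReal.comp
        (hΩ.mul (hD.kernel i hi).meas)) ((hD.kernel i hi).integrable_mul hΩ hΩb) measurable_id
        (hD.b_int i hi)]
      rfl
    · intro i hi
      exact (Real.fourierIntegral_convergent_iff ξ).mpr (hint i hi)
  rw [← lintegral_enorm_sq_fourier (integrable_finsetSum _ hint) (memLp_finsetSum _ hL2)]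
  simp_rw [hF]
  exact hmain s r β c δ α M m m' b Ω Λ hD hΩ hΩb hΩh

end RoughSum

section MultiIndex

variable {d : ℕ}

/-- The list of coordinates, with multiplicities, of a multi-index. -/
def multiList (α : Fin d → ℕ) : List (Fin d) :=
  (List.finRange d).flatMap fun i => List.replicate (α i) i

theorem count_multiList (α : Fin d → ℕ) (i : Fin d) : (multiList α).count i = α i := by
  unfold multiList
  rw [List.count_flatMap]
  simp only [Function.comp_def, List.count_replicate, beq_iff_eq]
  rw [← List.ofFn_eq_map, List.sum_ofFn]
  simp

theorem length_multiList (α : Fin d → ℕ) : (multiList α).length = ∑ i, α i := by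
  unfold multiList
  rw [List.length_flatMap]
  simp only [List.length_replicate]
  rw [← List.ofFn_eq_map, List.sum_ofFn]

theorem multiList_add_single_perm (α : Fin d → ℕ) (i : Fin d) :
    (multiList (α + Pi.single i 1)).Perm (i :: multiList α) := by
  rw [List.perm_iff_count]
  intro j
  rw [count_multiList, List.count_cons, count_multiList, Pi.add_apply, Pi.single_apply]
  by_cases h : i = j
  · simp [h]
  · simp [h, Ne.symm h]

theorem contDiff_pderivCoord {n : ℕ} {g : EuclideanSpace ℝ (Fin d) → ℝ}
    (hg : ContDiff ℝ ((n + 1 : ℕ) : ℕ∞) g) (i : Fin d) :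
    ContDiff ℝ (n : ℕ∞) (pderivCoord d i g) := by
  unfold pderivCoord
  exact (hg.fderiv_right (by norm_cast)).clm_apply contDiff_const

theorem contDiff_foldr_pderivCoord {n : ℕ} {g : EuclideanSpace ℝ (Fin d) → ℝ} :
    ∀ L : List (Fin d), ContDiff ℝ ((n + L.length : ℕ) : ℕ∞) g →
      ContDiff ℝ (n : ℕ∞) (L.foldr (pderivCoord d) g)
  | [], hg => by simpa using hg
  | i :: L, hg => by
    have h1 := contDiff_foldr_pderivCoord (n := n + 1) L
      (by rw [List.length_cons] at hg; convert hg using 2; norm_cast; ring)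
    exact contDiff_pderivCoord h1 i

theorem pderivCoord_comm {g : EuclideanSpace ℝ (Fin d) → ℝ} (hg : ContDiff ℝ ((2 : ℕ) : ℕ∞) g)
    (i j : Fin d) : pderivCoord d i (pderivCoord d j g) = pderivCoord d j (pderivCoord d i g) := by
  ext x
  have h1 : ∀ y, DifferentiableAt ℝ (fderiv ℝ g) y := fun y =>
    ((hg.fderiv_right (m := 1) (by norm_cast)).differentiable (by simp)) y
  have h2 : ∀ i j : Fin d, pderivCoord d i (pderivCoord d j g) x =
      fderiv ℝ (fderiv ℝ g) x (EuclideanSpace.single i 1) (EuclideanSpace.single j 1) := by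
    intro i j
    unfold pderivCoord
    rw [fderiv_clm_apply (h1 x) (differentiableAt_const _)]
    simp
  rw [h2, h2]
  exact (hg.contDiffAt.isSymmSndFDerivAt (by simp)).eq _ _

theorem foldr_pderivCoord_perm {L₁ L₂ : List (Fin d)} (h : L₁.Perm L₂)
    {g : EuclideanSpace ℝ (Fin d) → ℝ} (hg : ContDiff ℝ ((L₁.length : ℕ) : ℕ∞) g) :
    L₁.foldr (pderivCoord d) g = L₂.foldr (pderivCoord d) g := by
  induction h with
  | nil => rfl
  | cons i _ ih =>
    rw [List.foldr_cons, List.foldr_cons, ih (hg.of_le (by norm_cast; simp))]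
  | swap i j L =>
    rw [List.foldr_cons, List.foldr_cons, List.foldr_cons, List.foldr_cons]
    exact pderivCoord_comm (contDiff_foldr_pderivCoord (n := 2) L
      (by convert hg using 2; norm_cast; simp; ring)) _ _
  | trans h₁ _ ih₁ ih₂ =>
    rw [ih₁ hg, ih₂ (by rwa [← h₁.length_eq])]

theorem contDiff_mderiv {n l : ℕ} {A : EuclideanSpace ℝ (Fin d) → ℝ} (hA : ContDiff ℝ (l : ℕ∞) A)
    {α : Fin d → ℕ} (hα : n + ∑ i, α i ≤ l) : ContDiff ℝ (n : ℕ∞) (mderiv d α A) :=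
  contDiff_foldr_pderivCoord (multiList α) (hA.of_le (by rw [length_multiList]; exact_mod_cast hα))

theorem pderivCoord_mderiv {l : ℕ} {A : EuclideanSpace ℝ (Fin d) → ℝ} (hA : ContDiff ℝ (l : ℕ∞) A)
    {α : Fin d → ℕ} (hα : ∑ i, α i < l) (i : Fin d) :
    pderivCoord d i (mderiv d α A) = mderiv d (α + Pi.single i 1) A := by
  refine (foldr_pderivCoord_perm (multiList_add_single_perm α i) (hA.of_le ?_)).symm
  rw [length_multiList]
  simp only [Pi.add_apply, Finset.sum_add_distrib, Finset.sum_pi_single', Finset.mem_univ, if_true]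
  exact_mod_cast hα

theorem mderiv_zero (A : EuclideanSpace ℝ (Fin d) → ℝ) : mderiv d 0 A = A := by
  have h : multiList (0 : Fin d → ℕ) = [] := by
    rw [← List.length_eq_zero_iff, length_multiList]
    simp
  change (multiList (0 : Fin d → ℕ)).foldr (pderivCoord d) A = A
  rw [h, List.foldr_nil]

/-- The homogeneous part of degree `m` of the Taylor expansion of `A` at `y`. -/
def taylorPart (A : EuclideanSpace ℝ (Fin d) → ℝ) (m : ℕ) (y z : EuclideanSpace ℝ (Fin d)) : ℝ :=
  ∑ α ∈ Finset.piAntidiag Finset.univ m,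
    mderiv d α A y / (∏ i, (Nat.factorial (α i) : ℝ)) * ∏ i, z i ^ α i

theorem mem_piAntidiag_univ {m : ℕ} {α : Fin d → ℕ} :
    α ∈ Finset.piAntidiag Finset.univ m ↔ ∑ i, α i = m := by
  simp [Finset.mem_piAntidiag]

theorem taylorPart_zero (A : EuclideanSpace ℝ (Fin d) → ℝ) (y z : EuclideanSpace ℝ (Fin d)) :
    taylorPart A 0 y z = A y := by
  simp [taylorPart, mderiv_zero]

theorem hasFDerivAt_apply_eq_sum {g : EuclideanSpace ℝ (Fin d) → ℝ}
    (x z : EuclideanSpace ℝ (Fin d)) : fderiv ℝ g x z = ∑ i, z i * pderivCoord d i g x := by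
  have h1 : z = ∑ i, z i • EuclideanSpace.single i (1 : ℝ) := by
    ext j
    simp [Finset.sum_apply, Pi.single_apply]
  conv_lhs => rw [h1]
  rw [map_sum]
  simp [pderivCoord]

theorem sum_taylorPart_succ {l m : ℕ} {A : EuclideanSpace ℝ (Fin d) → ℝ}
    (hA : ContDiff ℝ (l : ℕ∞) A) (hm : m < l) (y z : EuclideanSpace ℝ (Fin d)) :
    ∑ α ∈ Finset.piAntidiag Finset.univ m,
      (∑ i, z i * pderivCoord d i (mderiv d α A) y) / (∏ i, (Nat.factorial (α i) : ℝ)) *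
        ∏ i, z i ^ α i = (m + 1) * taylorPart A (m + 1) y z := by
  have h1 : (m + 1) * taylorPart A (m + 1) y z =
      ∑ i, ∑ β ∈ Finset.piAntidiag Finset.univ (m + 1), (β i : ℝ) *
        (mderiv d β A y / (∏ i, (Nat.factorial (β i) : ℝ)) * ∏ i, z i ^ β i) := by
    rw [Finset.sum_comm, taylorPart, Finset.mul_sum]
    refine Finset.sum_congr rfl fun β hβ => ?_
    rw [← Finset.sum_mul]
    congr 1
    have := mem_piAntidiag_univ.mp hβ
    exact_mod_cast this.symm
  rw [h1]
  simp_rw [Finset.sum_div, Finset.sum_mul]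
  rw [Finset.sum_comm]
  refine Finset.sum_congr rfl fun i _ => ?_
  rw [← Finset.sum_filter_of_ne (s := Finset.piAntidiag Finset.univ (m + 1)) (p := fun β => β i ≠ 0)
    (fun β _ h h0 => h (by rw [h0, Nat.cast_zero, zero_mul]))]
  refine Finset.sum_nbij' (fun α => α + Pi.single i 1) (fun β => β - Pi.single i 1) ?_ ?_ ?_ ?_ ?_
  · intro α hα
    rw [Finset.mem_filter, mem_piAntidiag_univ]
    rw [mem_piAntidiag_univ] at hα
    simp [Finset.sum_add_distrib, hα]
  · intro β hβ
    rw [Finset.mem_filter, mem_piAntidiag_univ] at hβ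
    rw [mem_piAntidiag_univ]
    have h2 : (β - Pi.single i 1) + Pi.single i 1 = β := by
      ext j
      by_cases hj : j = i
      · subst hj; have := hβ.2; simp; omega
      · simp [hj]
    have h3 := hβ.1
    rw [← h2] at h3
    simp only [Pi.add_apply, Finset.sum_add_distrib, Finset.sum_pi_single', Finset.mem_univ,
      if_true] at h3
    omega
  · intro α _
    ext j
    simp
  · intro β hβ
    rw [Finset.mem_filter] at hβ
    ext j
    by_cases hj : j = i
    · subst hj; have := hβ.2; simp; omega
    · simp [hj]
  · intro α hα
    rw [mem_piAntidiag_univ] at hα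
    rw [pderivCoord_mderiv hA (by omega)]
    have h2 : ∏ j, (Nat.factorial ((α + Pi.single i 1 : Fin d → ℕ) j) : ℝ) =
        (α i + 1) * ∏ j, (Nat.factorial (α j) : ℝ) := by
      rw [← Finset.mul_prod_erase _ _ (Finset.mem_univ i),
        ← Finset.mul_prod_erase _ (fun j => (Nat.factorial (α j) : ℝ)) (Finset.mem_univ i)]
      rw [Pi.add_apply, Pi.single_eq_same, Nat.factorial_succ, Nat.cast_mul, mul_assoc]
      push_cast
      congr 2
      refine Finset.prod_congr rfl fun j hj => ?_
      simp [Finset.ne_of_mem_erase hj]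
    have h3 : ∏ j, z j ^ ((α + Pi.single i 1 : Fin d → ℕ) j) = z i * ∏ j, z j ^ α j := by
      rw [← Finset.mul_prod_erase _ _ (Finset.mem_univ i),
        ← Finset.mul_prod_erase _ (fun j => z j ^ α j) (Finset.mem_univ i)]
      rw [Pi.add_apply, Pi.single_eq_same, pow_succ']
      rw [mul_assoc]
      congr 2
      refine Finset.prod_congr rfl fun j hj => ?_
      simp [Finset.ne_of_mem_erase hj]
    rw [h2, h3]
    have h4 : (∏ j, (Nat.factorial (α j) : ℝ)) ≠ 0 :=
      Finset.prod_ne_zero_iff.mpr fun j _ => Nat.cast_ne_zero.mpr (Nat.factorial_ne_zero _)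
    have h5 : (((α + Pi.single i 1 : Fin d → ℕ) i : ℕ) : ℝ) = α i + 1 := by simp
    rw [h5]
    have h6 : (α i + 1 : ℝ) ≠ 0 := by positivity
    field_simp

theorem hasDerivAt_taylorPart {l m : ℕ} {A : EuclideanSpace ℝ (Fin d) → ℝ}
    (hA : ContDiff ℝ (l : ℕ∞) A) (hm : m < l) (y z : EuclideanSpace ℝ (Fin d)) (t : ℝ) :
    HasDerivAt (fun t : ℝ => taylorPart A m (y + t • z) z)
      ((m + 1) * taylorPart A (m + 1) (y + t • z) z) t := by
  rw [← sum_taylorPart_succ hA hm]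
  unfold taylorPart
  refine HasDerivAt.fun_sum fun α hα => HasDerivAt.mul_const (HasDerivAt.div_const ?_ _) _
  rw [← hasFDerivAt_apply_eq_sum]
  rw [mem_piAntidiag_univ] at hα
  have h1 : DifferentiableAt ℝ (mderiv d α A) (y + t • z) :=
    ((contDiff_mderiv (n := 1) hA (by omega)).differentiable (by simp)) _
  have h2 : HasDerivAt (fun t : ℝ => y + t • z) z t := by
    simpa using ((hasDerivAt_id t).smul_const z).const_add y
  exact h1.hasFDerivAt.comp_hasDerivAt t h2

end MultiIndex

section Taylor

theorem abs_sub_taylor_le {M : ℝ} (hM : 0 ≤ M) (n : ℕ) : ∀ (G : ℕ → ℝ → ℝ)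
    (_ : ∀ m < n, ∀ t, HasDerivAt (G m) (G (m + 1) t) t)
    (_ : ∀ t ∈ Set.Icc (0 : ℝ) 1, |G n t| ≤ M), ∀ t ∈ Set.Icc (0 : ℝ) 1,
      |G 0 t - ∑ m ∈ Finset.range n, t ^ m / (Nat.factorial m : ℝ) * G m 0| ≤ M := by
  induction n with
  | zero =>
    intro G _ hb t ht
    simpa using hb t ht
  | succ n ih =>
    intro G hG hb t ht
    have h1 := ih (fun m => G (m + 1)) (fun m hm => hG (m + 1) (by omega)) hb
    have h2 : ∀ s : ℝ, HasDerivAt (fun s : ℝ => G 0 s -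
        ∑ m ∈ Finset.range (n + 1), s ^ m / (Nat.factorial m : ℝ) * G m 0)
        (G 1 s - ∑ m ∈ Finset.range n, s ^ m / (Nat.factorial m : ℝ) * G (m + 1) 0) s := by
      intro s
      refine (hG 0 (by omega) s).sub ?_
      simp_rw [Finset.sum_range_succ']
      simp only [pow_zero]
      refine HasDerivAt.add_const _ (HasDerivAt.fun_sum fun m _ => HasDerivAt.mul_const ?_ _)
      have h3 := (hasDerivAt_pow (m + 1) s).div_const ((Nat.factorial (m + 1) : ℕ) : ℝ)
      convert h3 using 1
      rw [Nat.factorial_succ]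
      have h4 : ((Nat.factorial m : ℕ) : ℝ) ≠ 0 := Nat.cast_ne_zero.mpr (Nat.factorial_ne_zero _)
      push_cast
      field_simp
    have h3 := (convex_Icc (0 : ℝ) 1).norm_image_sub_le_of_norm_hasDerivWithin_le
      (fun s _ => (h2 s).hasDerivWithinAt) (fun s hs => h1 s hs)
      (Set.left_mem_Icc.mpr zero_le_one) ht
    have h4 : G 0 0 - ∑ m ∈ Finset.range (n + 1), (0 : ℝ) ^ m / (Nat.factorial m : ℝ) * G m 0
        = 0 := by
      rw [Finset.sum_range_succ']
      simp
    rw [h4, sub_zero, Real.norm_eq_abs] at h3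
    refine h3.trans ?_
    rw [sub_zero, Real.norm_eq_abs, abs_of_nonneg ht.1]
    exact mul_le_of_le_one_right hM ht.2

variable {d : ℕ}

theorem abs_monomial_le (z : EuclideanSpace ℝ (Fin d)) {m : ℕ} {α : Fin d → ℕ}
    (hα : ∑ i, α i = m) : |∏ i, z i ^ α i| ≤ ‖z‖ ^ m := by
  rw [Finset.abs_prod, ← hα, ← Finset.prod_pow_eq_pow_sum]
  refine Finset.prod_le_prod (fun i _ => abs_nonneg _) fun i _ => ?_
  rw [abs_pow]
  exact pow_le_pow_left₀ (abs_nonneg _) (PiLp.norm_apply_le z i) _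

theorem abs_sum_monomial_le {m : ℕ} {c : (Fin d → ℕ) → ℝ} {S : ℝ}
    (hc : ∀ α, ∑ i, α i = m → |c α| ≤ S) (z : EuclideanSpace ℝ (Fin d)) :
    |∑ α ∈ Finset.piAntidiag Finset.univ m,
      c α / (∏ i, (Nat.factorial (α i) : ℝ)) * ∏ i, z i ^ α i| ≤
      (Finset.piAntidiag (Finset.univ : Finset (Fin d)) m).card * (S * ‖z‖ ^ m) := by
  refine (Finset.abs_sum_le_sum_abs _ _).trans ?_
  rw [← nsmul_eq_mul]
  refine Finset.sum_le_card_nsmul _ _ _ fun α hα => ?_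
  rw [mem_piAntidiag_univ] at hα
  have h1 : (1 : ℝ) ≤ ∏ i, (Nat.factorial (α i) : ℝ) :=
    by exact_mod_cast Finset.one_le_prod' fun i _ => Nat.factorial_pos (α i)
  rw [abs_mul, abs_div, abs_of_nonneg (zero_le_one.trans h1)]
  exact mul_le_mul ((div_le_self (abs_nonneg _) h1).trans (hc α hα)) (abs_monomial_le z hα)
    (abs_nonneg _) ((abs_nonneg _).trans (hc α hα))

theorem abs_taylorPart_le {A : EuclideanSpace ℝ (Fin d) → ℝ} {m : ℕ} {S : ℝ}
    (hS : ∀ α : Fin d → ℕ, ∑ i, α i = m → ∀ x, |mderiv d α A x| ≤ S)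
    (y z : EuclideanSpace ℝ (Fin d)) : |taylorPart A m y z| ≤
      (Finset.piAntidiag (Finset.univ : Finset (Fin d)) m).card * (S * ‖z‖ ^ m) :=
  abs_sum_monomial_le (fun α hα => hS α hα y) z

theorem abs_mderiv_sub_le {l m : ℕ} {A : EuclideanSpace ℝ (Fin d) → ℝ}
    (hA : ContDiff ℝ (l : ℕ∞) A) (hm : m + 1 = l) {S : ℝ}
    (hS : ∀ α : Fin d → ℕ, ∑ i, α i = l → ∀ x, |mderiv d α A x| ≤ S)
    {α : Fin d → ℕ} (hα : ∑ i, α i = m) (x y : EuclideanSpace ℝ (Fin d)) :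
    |mderiv d α A x - mderiv d α A y| ≤ d * S * ‖x - y‖ := by
  have h1 : Differentiable ℝ (mderiv d α A) :=
    (contDiff_mderiv (n := 1) hA (by omega)).differentiable (by simp)
  have h3 : 0 ≤ d * S := by
    rcases Nat.eq_zero_or_pos d with h | h
    · simp [h]
    · refine mul_nonneg (by positivity) ?_
      refine (abs_nonneg _).trans (hS (Pi.single ⟨0, h⟩ l) (by simp) 0)
  have h2 : ∀ z, ‖fderiv ℝ (mderiv d α A) z‖ ≤ d * S := by
    intro z
    refine ContinuousLinearMap.opNorm_le_bound _ h3 fun v => ?_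
    rw [hasFDerivAt_apply_eq_sum]
    refine (norm_sum_le _ _).trans ?_
    rw [mul_assoc, ← nsmul_eq_mul]
    refine (Finset.sum_le_card_nsmul _ _ (S * ‖v‖) fun i _ => ?_).trans (by simp)
    rw [pderivCoord_mderiv hA (by omega), norm_mul, mul_comm]
    refine mul_le_mul (hS _ ?_ _) (PiLp.norm_apply_le v i) (norm_nonneg _) ?_
    · simp [Finset.sum_add_distrib, hα, hm]
    · exact (abs_nonneg _).trans (hS (α + Pi.single i 1)
        (by simp [Finset.sum_add_distrib, hα, hm]) z)
  have := convex_univ.norm_image_sub_le_of_norm_fderiv_le (𝕜 := ℝ) (fun z _ => h1 z)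
    (fun z _ => h2 z) (Set.mem_univ y) (Set.mem_univ x)
  rwa [Real.norm_eq_abs] at this

/-- The Taylor remainder of order `l` of `A` at `c`, evaluated at `c + z`. -/
def taylorRem (A : EuclideanSpace ℝ (Fin d) → ℝ) (l : ℕ) (c z : EuclideanSpace ℝ (Fin d)) : ℝ :=
  A (c + z) - ∑ m ∈ Finset.range l, taylorPart A m c z

/-- The radial derivative of the Taylor remainder. -/
def taylorRemRadial (A : EuclideanSpace ℝ (Fin d) → ℝ) (l : ℕ)
    (c z : EuclideanSpace ℝ (Fin d)) : ℝ :=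
  taylorPart A 1 (c + z) z - ∑ m ∈ Finset.range l, m * taylorPart A m c z

/-- A constant dominating the bounds for Taylor remainders of order `l`. -/
def taylorConst (d l : ℕ) : ℝ :=
  2 * (d + 1) * (Nat.factorial l) *
    ((Finset.piAntidiag (Finset.univ : Finset (Fin d)) l).card +
      (Finset.piAntidiag (Finset.univ : Finset (Fin d)) (l - 1)).card + 1)

theorem taylorConst_pos (d l : ℕ) : 0 < taylorConst d l := by
  unfold taylorConst
  have : 0 < (Nat.factorial l : ℝ) := by exact_mod_cast Nat.factorial_pos l
  positivity

theorem le_taylorConst (d l : ℕ) : (Nat.factorial l : ℝ) *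
    (Finset.piAntidiag (Finset.univ : Finset (Fin d)) l).card ≤ taylorConst d l := by
  unfold taylorConst
  have h1 : (0 : ℝ) ≤ (Nat.factorial l : ℝ) := by positivity
  have h2 : (0 : ℝ) ≤ (Finset.piAntidiag (Finset.univ : Finset (Fin d)) l).card := by positivity
  have h3 : (0 : ℝ) ≤ (Finset.piAntidiag (Finset.univ : Finset (Fin d)) (l - 1)).card := by
    positivity
  have h4 : (0 : ℝ) ≤ d := by positivity
  rw [mul_comm (2 * (d + 1 : ℝ)), mul_assoc]
  refine mul_le_mul_of_nonneg_left ?_ h1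
  nlinarith [mul_nonneg h4 h2, mul_nonneg h4 h3]

theorem le_taylorConst' (d l : ℕ) : 2 * ((Nat.factorial (l - 1) : ℝ) *
    ((Finset.piAntidiag (Finset.univ : Finset (Fin d)) (l - 1)).card * d)) ≤ taylorConst d l := by
  unfold taylorConst
  have h1 : (0 : ℝ) ≤ (Nat.factorial (l - 1) : ℝ) := by positivity
  have h5 : (Nat.factorial (l - 1) : ℝ) ≤ Nat.factorial l :=
    by exact_mod_cast Nat.factorial_le (Nat.sub_le l 1)
  have h2 : (0 : ℝ) ≤ (Finset.piAntidiag (Finset.univ : Finset (Fin d)) l).card := by positivity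
  have h3 : (0 : ℝ) ≤ (Finset.piAntidiag (Finset.univ : Finset (Fin d)) (l - 1)).card := by
    positivity
  have h4 : (0 : ℝ) ≤ d := by positivity
  generalize (Nat.factorial (l - 1) : ℝ) = a at *
  generalize ((Finset.piAntidiag (Finset.univ : Finset (Fin d)) (l - 1)).card : ℝ) = b at *
  generalize ((Finset.piAntidiag (Finset.univ : Finset (Fin d)) l).card : ℝ) = e at *
  calc 2 * (a * (b * d)) = 2 * d * a * b := by ring
    _ ≤ _ := mul_le_mul (mul_le_mul (by linarith) h5 h1 (by positivity)) (by linarith) h3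
      (by have := h1.trans h5; positivity)

variable {l : ℕ} {A : EuclideanSpace ℝ (Fin d) → ℝ} {S : ℝ}

theorem abs_taylorRem_le (hA : ContDiff ℝ (l : ℕ∞) A)
    (hS : ∀ α : Fin d → ℕ, ∑ i, α i = l → ∀ x, |mderiv d α A x| ≤ S) (hS0 : 0 ≤ S)
    (c z : EuclideanSpace ℝ (Fin d)) :
    |taylorRem A l c z| ≤ taylorConst d l * S * ‖z‖ ^ l := by
  have h1 := abs_sub_taylor_le (M := taylorConst d l * S * ‖z‖ ^ l)
    (mul_nonneg (mul_nonneg (taylorConst_pos d l).le hS0) (by positivity)) l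
    (fun m t => (Nat.factorial m : ℝ) * taylorPart A m (c + t • z) z)
    (fun m hm t => by
      refine ((hasDerivAt_taylorPart hA hm c z t).const_mul _).congr_deriv ?_
      rw [Nat.factorial_succ]
      push_cast
      ring)
    (fun t _ => by
      rw [abs_mul, Nat.abs_cast]
      calc _ ≤ (Nat.factorial l : ℝ) *
            ((Finset.piAntidiag (Finset.univ : Finset (Fin d)) l).card * (S * ‖z‖ ^ l)) :=
          mul_le_mul_of_nonneg_left (abs_taylorPart_le hS _ _) (by positivity)
        _ = ((Nat.factorial l : ℝ) *
            (Finset.piAntidiag (Finset.univ : Finset (Fin d)) l).card) * (S * ‖z‖ ^ l) := by ring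
        _ ≤ _ := by
          rw [mul_assoc (taylorConst d l)]
          exact mul_le_mul_of_nonneg_right (le_taylorConst d l) (by positivity))
    1 (by simp)
  refine le_of_eq_of_le ?_ h1
  unfold taylorRem
  simp only [Nat.factorial_zero, Nat.cast_one, one_mul, taylorPart_zero, one_smul, one_pow,
    zero_smul, add_zero]
  congr 2
  refine Finset.sum_congr rfl fun m _ => ?_
  have h4 : ((Nat.factorial m : ℕ) : ℝ) ≠ 0 := Nat.cast_ne_zero.mpr (Nat.factorial_ne_zero _)
  field_simp

theorem abs_taylorRemRadial_le (hA : ContDiff ℝ (l : ℕ∞) A) (hl : 1 ≤ l)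
    (hS : ∀ α : Fin d → ℕ, ∑ i, α i = l → ∀ x, |mderiv d α A x| ≤ S) (hS0 : 0 ≤ S)
    (c z : EuclideanSpace ℝ (Fin d)) :
    |taylorRemRadial A l c z| ≤ taylorConst d l * S * ‖z‖ ^ l := by
  obtain ⟨n, rfl⟩ : ∃ n, l = n + 1 := ⟨l - 1, by omega⟩
  have h1 := abs_sub_taylor_le (M := taylorConst d (n + 1) * S * ‖z‖ ^ (n + 1))
    (mul_nonneg (mul_nonneg (taylorConst_pos d _).le hS0) (by positivity)) n
    (fun m t => (Nat.factorial (m + 1) : ℝ) * taylorPart A (m + 1) (c + t • z) z)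
    (fun m hm t => by
      refine ((hasDerivAt_taylorPart hA (by omega) c z t).const_mul _).congr_deriv ?_
      rw [Nat.factorial_succ (m + 1)]
      push_cast
      ring)
    (fun t _ => by
      rw [abs_mul, Nat.abs_cast]
      calc _ ≤ (Nat.factorial (n + 1) : ℝ) *
            ((Finset.piAntidiag (Finset.univ : Finset (Fin d)) (n + 1)).card *
              (S * ‖z‖ ^ (n + 1))) :=
          mul_le_mul_of_nonneg_left (abs_taylorPart_le hS _ _) (by positivity)
        _ = ((Nat.factorial (n + 1) : ℝ) *
            (Finset.piAntidiag (Finset.univ : Finset (Fin d)) (n + 1)).card) *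
              (S * ‖z‖ ^ (n + 1)) := by ring
        _ ≤ _ := by
          rw [mul_assoc (taylorConst d (n + 1))]
          exact mul_le_mul_of_nonneg_right (le_taylorConst d _) (by positivity))
    1 (by simp)
  refine le_of_eq_of_le ?_ h1
  unfold taylorRemRadial
  rw [Finset.sum_range_succ']
  simp only [Nat.cast_zero, zero_mul, add_zero, one_smul, one_pow, zero_smul, zero_add,
    Nat.factorial_one, Nat.cast_one, one_mul]
  congr 2
  refine Finset.sum_congr rfl fun m _ => ?_
  have h4 : ((Nat.factorial m : ℕ) : ℝ) ≠ 0 := Nat.cast_ne_zero.mpr (Nat.factorial_ne_zero _)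
  rw [Nat.factorial_succ]
  push_cast
  field_simp

theorem abs_taylorRem_sub_le (hA : ContDiff ℝ (l : ℕ∞) A) (hl : 1 ≤ l)
    (hS : ∀ α : Fin d → ℕ, ∑ i, α i = l → ∀ x, |mderiv d α A x| ≤ S) (hS0 : 0 ≤ S)
    (y c z : EuclideanSpace ℝ (Fin d)) :
    |taylorRem A l y z - taylorRem A l c z| ≤
      taylorConst d l * S * ‖y - c‖ * ‖z‖ ^ (l - 1) := by
  obtain ⟨n, rfl⟩ : ∃ n, l = n + 1 := ⟨l - 1, by omega⟩
  rw [Nat.add_sub_cancel]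
  set M : ℝ := (Nat.factorial n : ℝ) * ((Finset.piAntidiag (Finset.univ : Finset (Fin d)) n).card *
    (d * S * ‖y - c‖ * ‖z‖ ^ n)) with hM
  have hM0 : 0 ≤ M := by positivity
  set G : ℕ → ℝ → ℝ := fun m t => (Nat.factorial m : ℝ) *
    (taylorPart A m (y + t • z) z - taylorPart A m (c + t • z) z) with hG
  have hb : ∀ t, |G n t| ≤ M := by
    intro t
    rw [hG, hM]
    simp only
    rw [abs_mul, Nat.abs_cast]
    refine mul_le_mul_of_nonneg_left ?_ (by positivity)
    have h1 := abs_sum_monomial_le (m := n)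
      (c := fun α => mderiv d α A (y + t • z) - mderiv d α A (c + t • z)) (S := d * S * ‖y - c‖)
      (fun α hα => by
        have := abs_mderiv_sub_le hA rfl hS hα (y + t • z) (c + t • z)
        rwa [add_sub_add_right_eq_sub] at this) z
    refine le_of_eq_of_le ?_ h1
    unfold taylorPart
    rw [← Finset.sum_sub_distrib]
    congr 1
    exact Finset.sum_congr rfl fun α _ => by ring
  have h1 := abs_sub_taylor_le hM0 n G
    (fun m hm t => by
      refine (((hasDerivAt_taylorPart hA (by omega : m < n + 1) y z t).sub
        (hasDerivAt_taylorPart hA (by omega : m < n + 1) c z t)).const_mul _).congr_deriv ?_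
      rw [hG]
      simp only
      rw [Nat.factorial_succ]
      push_cast
      ring)
    (fun t _ => hb t) 1 (by simp)
  have h2 : taylorRem A (n + 1) y z - taylorRem A (n + 1) c z =
      (G 0 1 - ∑ m ∈ Finset.range n, (1 : ℝ) ^ m / (Nat.factorial m : ℝ) * G m 0) -
        (1 / (Nat.factorial n : ℝ)) * G n 0 := by
    have h4 : ∀ m, ((Nat.factorial m : ℕ) : ℝ) ≠ 0 := fun m =>
      Nat.cast_ne_zero.mpr (Nat.factorial_ne_zero _)
    have h5 : ∀ m, (1 : ℝ) ^ m / (Nat.factorial m : ℝ) * G m 0 =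
        taylorPart A m y z - taylorPart A m c z := by
      intro m
      rw [hG]
      simp only [zero_smul, add_zero, one_pow]
      have := h4 m
      field_simp
    simp_rw [h5]
    have h6 := h5 n
    rw [one_pow] at h6
    rw [h6]
    unfold taylorRem
    rw [Finset.sum_range_succ, Finset.sum_range_succ, Finset.sum_sub_distrib, hG]
    simp only [one_smul, taylorPart_zero, Nat.factorial_zero, Nat.cast_one, one_mul]
    ring
  rw [h2]
  have h3 : |(1 / (Nat.factorial n : ℝ)) * G n 0| ≤ M := by
    rw [abs_mul]
    refine (mul_le_of_le_one_left (abs_nonneg _) ?_).trans (hb 0)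
    rw [abs_of_nonneg (by positivity)]
    exact (div_le_one (by exact_mod_cast Nat.factorial_pos n)).mpr
      (by exact_mod_cast Nat.one_le_iff_ne_zero.mpr (Nat.factorial_ne_zero n))
  refine (abs_sub _ _).trans ((add_le_add h1 h3).trans ?_)
  have h4 := mul_le_mul_of_nonneg_right (le_taylorConst' d (n + 1))
    (show 0 ≤ S * ‖y - c‖ * ‖z‖ ^ n by positivity)
  rw [Nat.add_sub_cancel] at h4
  calc M + M = _ := by rw [hM]; ring
    _ ≤ _ := h4
    _ = _ := by ring

end Taylor

section BandCut

/-- A smooth cutoff on the half-line, equal to `1` on `r ≤ 1` and to `0` on `r ≥ 2`. -/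
def stepCut (r : ℝ) : ℝ := Real.smoothTransition (2 - r)

/-- A smooth cutoff to the dyadic band `1 / 2 ≤ r ≤ 2`. -/
def bandCut (r : ℝ) : ℝ := stepCut r - stepCut (2 * r)

theorem stepCut_of_le {r : ℝ} (h : r ≤ 1) : stepCut r = 1 :=
  Real.smoothTransition.one_of_one_le (by linarith)

theorem stepCut_of_ge {r : ℝ} (h : 2 ≤ r) : stepCut r = 0 :=
  Real.smoothTransition.zero_of_nonpos (by linarith)

theorem contDiff_bandCut : ContDiff ℝ (1 : ℕ∞) bandCut := by
  unfold bandCut stepCut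
  exact (Real.smoothTransition.contDiff.comp (contDiff_const.sub contDiff_id)).sub
    (Real.smoothTransition.contDiff.comp (contDiff_const.sub (contDiff_const.mul contDiff_id)))

theorem bandCut_ne_zero {r : ℝ} (h : bandCut r ≠ 0) : 1 / 2 ≤ r ∧ r ≤ 2 := by
  by_contra h1
  refine h ?_
  rw [not_and_or, not_le, not_le] at h1
  unfold bandCut
  rcases h1 with h1 | h1
  · rw [stepCut_of_le (by linarith), stepCut_of_le (by linarith), sub_self]
  · rw [stepCut_of_ge h1.le, stepCut_of_ge (by linarith), sub_self]

theorem abs_bandCut_le (r : ℝ) : |bandCut r| ≤ 1 := by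
  unfold bandCut stepCut
  rw [abs_le]
  have := Real.smoothTransition.nonneg (2 - r)
  have := Real.smoothTransition.nonneg (2 - 2 * r)
  have := Real.smoothTransition.le_one (2 - r)
  have := Real.smoothTransition.le_one (2 - 2 * r)
  constructor <;> linarith

theorem deriv_bandCut_ne_zero {r : ℝ} (h : deriv bandCut r ≠ 0) : 1 / 2 ≤ r ∧ r ≤ 2 := by
  have h1 : Function.support bandCut ⊆ Set.Icc (1 / 2) 2 := fun r hr => bandCut_ne_zero hr
  exact (closure_minimal h1 isClosed_Icc) (support_deriv_subset h)

theorem exists_abs_deriv_bandCut_le : ∃ B : ℝ, 0 ≤ B ∧ ∀ r, |deriv bandCut r| ≤ B := by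
  have h1 : Continuous (deriv bandCut) := contDiff_bandCut.continuous_deriv (by simp)
  obtain ⟨B, hB⟩ := isCompact_Icc.exists_bound_of_continuousOn
    (s := Set.Icc (1 / 2 : ℝ) 2) h1.continuousOn
  refine ⟨max B 0, le_max_right _ _, fun r => ?_⟩
  by_cases h : deriv bandCut r = 0
  · rw [h, abs_zero]
    exact le_max_right _ _
  · exact (hB r (deriv_bandCut_ne_zero h)).trans (le_max_left _ _)

theorem sum_bandCut {r : ℝ} (hr : 1 ≤ r) {N : ℕ} (hN : r ≤ 2 ^ N) :
    ∑ s ∈ Finset.range (N + 1), bandCut (r / 2 ^ s) = 1 := by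
  have h1 : ∀ n : ℕ, ∑ s ∈ Finset.range (n + 1), bandCut (r / 2 ^ s) = stepCut (r / 2 ^ n) := by
    intro n
    induction n with
    | zero =>
      simp [bandCut, stepCut_of_ge (show (2 : ℝ) ≤ 2 * r by linarith)]
    | succ n ih =>
      rw [Finset.sum_range_succ, ih, bandCut]
      rw [show 2 * (r / 2 ^ (n + 1)) = r / 2 ^ n by field_simp; ring]
      ring
  rw [h1, stepCut_of_le]
  exact (div_le_one (by positivity)).mpr hN

end BandCut

section KernelPiece

variable {d : ℕ}

theorem abs_mderiv_le_sumSupDeriv {l : ℕ} {A : EuclideanSpace ℝ (Fin d) → ℝ}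
    (hA : ∀ α : Fin d → ℕ, (∑ i, α i) = l → ∃ M : ℝ, ∀ x, |mderiv d α A x| ≤ M)
    {α : Fin d → ℕ} (hα : ∑ i, α i = l) (x : EuclideanSpace ℝ (Fin d)) :
    |mderiv d α A x| ≤ sumSupDeriv d l A := by
  have h1 : ∀ i, α i < l + 1 := fun i => by
    have := Finset.single_le_sum (f := α) (fun _ _ => Nat.zero_le _) (Finset.mem_univ i)
    omega
  obtain ⟨M, hM⟩ := hA α hα
  have h2 : |mderiv d α A x| ≤ ⨆ x : EuclideanSpace ℝ (Fin d), |mderiv d α A x| :=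
    le_ciSup (f := fun x => |mderiv d α A x|) ⟨M, by rintro _ ⟨y, rfl⟩; exact hM y⟩ x
  refine h2.trans ?_
  unfold sumSupDeriv
  refine Finset.single_le_sum
    (f := fun α : Fin d → Fin (l + 1) => ⨆ x, |mderiv d (fun i => (α i : ℕ)) A x|)
    (a := fun i => (⟨α i, h1 i⟩ : Fin (l + 1))) (fun β _ => Real.iSup_nonneg fun _ => abs_nonneg _) ?_
  simpa using hα

theorem sumSupDeriv_nonneg (l : ℕ) (A : EuclideanSpace ℝ (Fin d) → ℝ) : 0 ≤ sumSupDeriv d l A :=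
  Finset.sum_nonneg fun _ _ => Real.iSup_nonneg fun _ => abs_nonneg _

theorem Pl_eq_taylorRem (l : ℕ) (A : EuclideanSpace ℝ (Fin d) → ℝ)
    (x y : EuclideanSpace ℝ (Fin d)) : Pl d l A x y = taylorRem A l y (x - y) := by
  unfold Pl taylorRem taylorPart
  rw [add_sub_cancel]
  congr 1
  rw [Finset.sum_sigma' (Finset.range l)]
  refine Finset.sum_bij' (fun α _ => ⟨∑ i, (α i : ℕ), fun i => (α i : ℕ)⟩)
    (fun p hp => fun i => (⟨p.2 i, by
      rw [Finset.mem_sigma, mem_piAntidiag_univ, Finset.mem_range] at hp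
      have := Finset.single_le_sum (f := p.2) (fun _ _ => Nat.zero_le _) (Finset.mem_univ i)
      omega⟩ : Fin l)) ?_ ?_ ?_ ?_ ?_
  · intro α hα
    rw [Finset.mem_sigma, mem_piAntidiag_univ, Finset.mem_range]
    exact ⟨(Finset.mem_filter.mp hα).2, rfl⟩
  · intro p hp
    rw [Finset.mem_sigma, mem_piAntidiag_univ, Finset.mem_range] at hp
    simp only [Finset.mem_filter, Finset.mem_univ, true_and]
    rw [hp.2]
    exact hp.1
  · intro α _
    rfl
  · rintro ⟨m, β⟩ hp
    rw [Finset.mem_sigma, mem_piAntidiag_univ, Finset.mem_range] at hp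
    simp only at hp ⊢
    rw [hp.2]
  · intro α _
    simp

theorem taylorPart_smul (A : EuclideanSpace ℝ (Fin d) → ℝ) (m : ℕ)
    (y z : EuclideanSpace ℝ (Fin d)) (t : ℝ) :
    taylorPart A m y (t • z) = t ^ m * taylorPart A m y z := by
  unfold taylorPart
  rw [Finset.mul_sum]
  refine Finset.sum_congr rfl fun α hα => ?_
  rw [mem_piAntidiag_univ] at hα
  have : ∏ i, (t • z) i ^ α i = t ^ m * ∏ i, z i ^ α i := by
    rw [← hα, ← Finset.prod_pow_eq_pow_sum, ← Finset.prod_mul_distrib]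
    exact Finset.prod_congr rfl fun i _ => by simp [mul_pow]
  rw [this]
  ring

theorem continuous_taylorPart {l m : ℕ} {A : EuclideanSpace ℝ (Fin d) → ℝ}
    (hA : ContDiff ℝ (l : ℕ∞) A) (hm : m ≤ l) :
    Continuous fun p : EuclideanSpace ℝ (Fin d) × EuclideanSpace ℝ (Fin d) =>
      taylorPart A m p.1 p.2 := by
  unfold taylorPart
  refine continuous_finsetSum _ fun α hα => ?_
  rw [mem_piAntidiag_univ] at hα
  have h1 : Continuous (mderiv d α A) := (contDiff_mderiv (n := 0) hA (by omega)).continuous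
  refine ((h1.comp continuous_fst).div_const _).mul (continuous_finsetProd _ fun i _ => ?_)
  fun_prop

theorem continuous_taylorRem {l : ℕ} {A : EuclideanSpace ℝ (Fin d) → ℝ}
    (hA : ContDiff ℝ (l : ℕ∞) A) :
    Continuous fun p : EuclideanSpace ℝ (Fin d) × EuclideanSpace ℝ (Fin d) =>
      taylorRem A l p.1 p.2 := by
  unfold taylorRem
  exact (hA.continuous.comp (continuous_fst.add continuous_snd)).sub
    (continuous_finsetSum _ fun m hm => continuous_taylorPart hA (Finset.mem_range.mp hm).le)

theorem hasDerivAt_taylorRem {l : ℕ} {A : EuclideanSpace ℝ (Fin d) → ℝ}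
    (hA : ContDiff ℝ (l : ℕ∞) A) (hl : 1 ≤ l) (c z : EuclideanSpace ℝ (Fin d)) {t : ℝ}
    (ht : 0 < t) :
    HasDerivAt (fun t : ℝ => taylorRem A l c (t • z)) (taylorRemRadial A l c (t • z) / t) t := by
  have h1 := hasDerivAt_taylorPart hA (m := 0) hl c z t
  have h2 : HasDerivAt (fun t : ℝ => ∑ m ∈ Finset.range l, t ^ m * taylorPart A m c z)
      (∑ m ∈ Finset.range l, (m * t ^ (m - 1)) * taylorPart A m c z) t :=
    HasDerivAt.fun_sum fun m _ => (hasDerivAt_pow m t).mul_const _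
  have h3 := h1.sub h2
  have h4 : (fun t : ℝ => taylorRem A l c (t • z)) = fun t : ℝ =>
      taylorPart A 0 (c + t • z) z - ∑ m ∈ Finset.range l, t ^ m * taylorPart A m c z := by
    ext t
    unfold taylorRem
    simp_rw [taylorPart_smul A _ c z t]
    rw [taylorPart_zero]
  rw [h4]
  refine h3.congr_deriv ?_
  unfold taylorRemRadial
  rw [eq_div_iff ht.ne', sub_mul, Finset.sum_mul]
  congr 1
  · rw [taylorPart_smul]
    simp
    ring
  · refine Finset.sum_congr rfl fun m _ => ?_
    rw [taylorPart_smul]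
    rcases m with _ | m
    · simp
    · simp only [Nat.add_sub_cancel]
      ring

/-- The dyadic piece at scale `r` of the commutator kernel frozen at `c`, without `Ω`. -/
def kernelPiece (A : EuclideanSpace ℝ (Fin d) → ℝ) (l : ℕ) (r : ℝ)
    (c z : EuclideanSpace ℝ (Fin d)) : ℝ :=
  bandCut (‖z‖ / r) * ((‖z‖ ^ (d + l))⁻¹ * taylorRem A l c z)

/-- The radial derivative of `kernelPiece`. -/
def kernelPieceRadial (A : EuclideanSpace ℝ (Fin d) → ℝ) (l : ℕ) (r : ℝ)
    (c z : EuclideanSpace ℝ (Fin d)) : ℝ :=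
  ‖z‖ / r * deriv bandCut (‖z‖ / r) * ((‖z‖ ^ (d + l))⁻¹ * taylorRem A l c z) +
    bandCut (‖z‖ / r) * ((‖z‖ ^ (d + l))⁻¹ *
      (taylorRemRadial A l c z - (d + l : ℕ) * taylorRem A l c z))

theorem hasDerivAt_kernelPiece {l : ℕ} {A : EuclideanSpace ℝ (Fin d) → ℝ}
    (hA : ContDiff ℝ (l : ℕ∞) A) (hl : 1 ≤ l) {r : ℝ} (hr : 0 < r)
    (c : EuclideanSpace ℝ (Fin d)) {z : EuclideanSpace ℝ (Fin d)} (hz : z ≠ 0) {t : ℝ}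
    (ht : 0 < t) :
    HasDerivAt (fun t : ℝ => kernelPiece A l r c (t • z))
      (kernelPieceRadial A l r c (t • z) / t) t := by
  have hz' : 0 < ‖z‖ := norm_pos_iff.mpr hz
  have h1 : (fun t : ℝ => kernelPiece A l r c (t • z)) =ᶠ[𝓝 t] fun t : ℝ =>
      bandCut (t * (‖z‖ / r)) * ((t ^ (d + l) * ‖z‖ ^ (d + l))⁻¹ * taylorRem A l c (t • z)) := by
    filter_upwards [lt_mem_nhds ht] with s hs
    unfold kernelPiece
    rw [norm_smul, Real.norm_of_nonneg hs.le, mul_pow, mul_div_assoc]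
  refine HasDerivAt.congr_of_eventuallyEq ?_ h1
  have h2 : HasDerivAt (fun t : ℝ => bandCut (t * (‖z‖ / r)))
      (deriv bandCut (t * (‖z‖ / r)) * (‖z‖ / r)) t := by
    have h3 : HasDerivAt bandCut (deriv bandCut (t * (‖z‖ / r))) (t * (‖z‖ / r)) :=
      ((contDiff_bandCut.differentiable (by simp)) _).hasDerivAt
    exact h3.comp t (by simpa using (hasDerivAt_id t).mul_const (‖z‖ / r))
  have h4 : HasDerivAt (fun t : ℝ => (t ^ (d + l) * ‖z‖ ^ (d + l))⁻¹)
      (-((d + l : ℕ) * (t ^ (d + l) * ‖z‖ ^ (d + l))⁻¹ / t)) t := by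
    refine (((hasDerivAt_pow (d + l) t).mul_const (‖z‖ ^ (d + l))).inv
      (by positivity)).congr_deriv ?_
    obtain ⟨n, hn⟩ : ∃ n, d + l = n + 1 := ⟨d + l - 1, by omega⟩
    rw [hn, Nat.add_sub_cancel]
    field_simp
    ring
  refine (h2.mul (h4.mul (hasDerivAt_taylorRem hA hl c z ht))).congr_deriv ?_
  unfold kernelPieceRadial
  rw [norm_smul, Real.norm_of_nonneg ht.le, mul_pow, mul_div_assoc]
  simp only [Pi.mul_apply]
  field_simp
  ring

theorem isRadialKernel_kernelPiece (d l : ℕ) (hl : 1 ≤ l) : ∃ K : ℝ, 0 < K ∧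
    ∀ {A : EuclideanSpace ℝ (Fin d) → ℝ} {S : ℝ}, ContDiff ℝ (l : ℕ∞) A →
      (∀ α : Fin d → ℕ, ∑ i, α i = l → ∀ x, |mderiv d α A x| ≤ S) → 0 ≤ S →
      ∀ {r : ℝ}, 0 < r → ∀ c, IsRadialKernel r (K * S / r ^ d)
        (kernelPiece A l r c) (kernelPieceRadial A l r c) := by
  obtain ⟨B, hB0, hB⟩ := exists_abs_deriv_bandCut_le
  have hT := taylorConst_pos d l
  set K : ℝ := (2 * B + (1 + (d + l : ℕ))) * taylorConst d l * 2 ^ d with hK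
  refine ⟨K, by positivity, fun {A S} hA hS hS0 {r} hr c => ?_⟩
  have hrem := abs_taylorRem_le hA hS hS0 c
  have hrad := abs_taylorRemRadial_le hA hl hS hS0 c
  have hsupp : ∀ z : EuclideanSpace ℝ (Fin d), 1 / 2 ≤ ‖z‖ / r ∧ ‖z‖ / r ≤ 2 →
      r / 2 ≤ ‖z‖ ∧ ‖z‖ ≤ 2 * r := by
    intro z h
    rw [le_div_iff₀ hr, div_le_iff₀ hr] at h
    exact ⟨by linarith [h.1], h.2⟩
  have hpow : ∀ z : EuclideanSpace ℝ (Fin d), r / 2 ≤ ‖z‖ → ∀ a : ℝ, ∀ k : ℝ, 0 ≤ k →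
      |a| ≤ k * ‖z‖ ^ l → (‖z‖ ^ (d + l))⁻¹ * |a| ≤ k * 2 ^ d / r ^ d := by
    intro z h a k hk ha
    have hz : 0 < ‖z‖ := lt_of_lt_of_le (by positivity) h
    calc (‖z‖ ^ (d + l))⁻¹ * |a| ≤ (‖z‖ ^ (d + l))⁻¹ * (k * ‖z‖ ^ l) := by gcongr
      _ = k / ‖z‖ ^ d := by rw [pow_add]; field_simp
      _ ≤ k / (r / 2) ^ d := by gcongr
      _ = _ := by rw [div_pow]; field_simp
  have hcr : Continuous fun z => taylorRem A l c z :=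
    (continuous_taylorRem hA).comp (Continuous.prodMk_right c)
  have hcd : Continuous fun z => taylorRemRadial A l c z := by
    unfold taylorRemRadial
    refine Continuous.sub ?_ (continuous_finsetSum _ fun m hm => continuous_const.mul
      ((continuous_taylorPart hA (Finset.mem_range.mp hm).le).comp (Continuous.prodMk_right c)))
    exact (continuous_taylorPart hA hl).comp ((continuous_const.add continuous_id).prodMk
      continuous_id)
  have hd1 : Continuous (deriv bandCut) := contDiff_bandCut.continuous_deriv (by simp)
  have hd0 : Continuous bandCut := contDiff_bandCut.continuous
  constructor
  · unfold kernelPiece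
    exact (hd0.measurable.comp (measurable_norm.div_const r)).mul
      ((measurable_norm.pow_const _).inv.mul hcr.measurable)
  · unfold kernelPieceRadial
    exact (((measurable_norm.div_const r).mul (hd1.measurable.comp
      (measurable_norm.div_const r))).mul
      ((measurable_norm.pow_const _).inv.mul hcr.measurable)).add
      ((hd0.measurable.comp (measurable_norm.div_const r)).mul
      ((measurable_norm.pow_const _).inv.mul
        (hcd.measurable.sub (hcr.measurable.const_mul _))))
  · intro z
    unfold kernelPiece
    by_cases h : bandCut (‖z‖ / r) = 0
    · rw [h, zero_mul, abs_zero]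
      positivity
    · have h1 := hsupp z (bandCut_ne_zero h)
      rw [abs_mul, abs_mul, abs_of_nonneg (a := (‖z‖ ^ (d + l))⁻¹) (by positivity)]
      refine (mul_le_of_le_one_left (by positivity) (abs_bandCut_le _)).trans
        ((hpow z h1.1 _ (taylorConst d l * S) (by positivity) (hrem z)).trans ?_)
      rw [hK]
      have h2 : 1 ≤ (2 * B + (1 + (d + l : ℕ))) := by
        have : (0 : ℝ) ≤ ((d + l : ℕ) : ℝ) := by positivity
        linarith
      calc taylorConst d l * S * 2 ^ d / r ^ d = 1 * (taylorConst d l * S * 2 ^ d / r ^ d) := by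
            ring
        _ ≤ (2 * B + (1 + (d + l : ℕ))) * (taylorConst d l * S * 2 ^ d / r ^ d) := by gcongr
        _ = _ := by ring
  · intro z
    unfold kernelPieceRadial
    by_cases h : 1 / 2 ≤ ‖z‖ / r ∧ ‖z‖ / r ≤ 2
    · have h1 := hsupp z h
      have h2 : |taylorRemRadial A l c z - (d + l : ℕ) * taylorRem A l c z| ≤
          (1 + (d + l : ℕ)) * (taylorConst d l * S) * ‖z‖ ^ l := by
        refine (abs_sub _ _).trans ?_
        rw [abs_mul, Nat.abs_cast]
        calc _ ≤ taylorConst d l * S * ‖z‖ ^ l +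
              ((d + l : ℕ) : ℝ) * (taylorConst d l * S * ‖z‖ ^ l) := by
              gcongr
              · exact hrad z
              · exact hrem z
          _ = _ := by ring
      have h3 := hpow z h1.1 _ _ (by positivity) h2
      have h4 := hpow z h1.1 _ (taylorConst d l * S) (by positivity) (hrem z)
      refine (abs_add_le _ _).trans ?_
      rw [abs_mul, abs_mul, abs_mul, abs_mul (bandCut _), abs_mul (‖z‖ ^ (d + l))⁻¹,
        abs_of_nonneg (a := (‖z‖ ^ (d + l))⁻¹) (by positivity),
        abs_of_nonneg (a := ‖z‖ / r) (by positivity)]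
      calc _ ≤ 2 * B * (taylorConst d l * S * 2 ^ d / r ^ d) +
            1 * ((1 + (d + l : ℕ)) * (taylorConst d l * S) * 2 ^ d / r ^ d) := by
            gcongr
            · exact h.2
            · exact hB _
            · exact abs_bandCut_le _
        _ = _ := by rw [hK]; ring
    · have h1 : bandCut (‖z‖ / r) = 0 := by
        by_contra h2
        exact h (bandCut_ne_zero h2)
      have h2 : deriv bandCut (‖z‖ / r) = 0 := by
        by_contra h2
        exact h (deriv_bandCut_ne_zero h2)
      rw [h1, h2]
      simp only [mul_zero, zero_mul, add_zero, abs_zero]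
      positivity
  · intro z h
    exact hsupp z (bandCut_ne_zero fun h0 => h (by unfold kernelPiece; rw [h0, zero_mul]))
  · intro z h
    refine hsupp z (by_contra fun h0 => h ?_)
    have h1 : bandCut (‖z‖ / r) = 0 := by
      by_contra h2
      exact h0 (bandCut_ne_zero h2)
    have h2 : deriv bandCut (‖z‖ / r) = 0 := by
      by_contra h2
      exact h0 (deriv_bandCut_ne_zero h2)
    unfold kernelPieceRadial
    rw [h1, h2]
    simp
  · intro z hz t ht
    exact hasDerivAt_kernelPiece hA hl hr c hz ht

end KernelPiece

section Polar

variable {E : Type*} [NormedAddCommGroup E] [NormedSpace ℝ E] [FiniteDimensional ℝ E]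
  [MeasurableSpace E] [BorelSpace E] [Nontrivial E]

theorem lintegral_ball_of_homogeneous (μ : Measure E) [μ.IsAddHaarMeasure] {W : E → ℝ≥0∞}
    (hW : Measurable W) (hhom : ∀ t : ℝ, 0 < t → ∀ z : E, z ≠ 0 → W (t • z) = W z)
    {r : ℝ} (hr : 0 < r) :
    ∫⁻ z in ball (0 : E) r, W z ∂μ =
      (∫⁻ θ : sphere (0 : E) 1, W θ ∂μ.toSphere) *
        ENNReal.ofReal (r ^ Module.finrank ℝ E / Module.finrank ℝ E) := by
  have hfin : 0 < Module.finrank ℝ E := Module.finrank_pos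
  set g : sphere (0 : E) 1 × Set.Ioi (0 : ℝ) → ℝ≥0∞ := fun p =>
    W p.1 * (Set.Iio (⟨r, hr⟩ : Set.Ioi (0 : ℝ))).indicator 1 p.2 with hg
  have h1 : ∀ x : ({0}ᶜ : Set E), g (homeomorphUnitSphereProd E x) =
      (ball (0 : E) r).indicator W x := by
    intro x
    have hx : (x : E) ≠ 0 := x.2
    have hx' : 0 < ‖(x : E)‖ := norm_pos_iff.mpr hx
    simp only [hg, homeomorphUnitSphereProd_apply_fst_coe]
    rw [hhom _ (inv_pos.mpr hx') _ hx]
    by_cases h : ‖(x : E)‖ < r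
    · rw [Set.indicator_of_mem, Set.indicator_of_mem (mem_ball_zero_iff.mpr h), Pi.one_apply,
        mul_one]
      rw [Set.mem_Iio, ← Subtype.coe_lt_coe]
      simpa using h
    · rw [Set.indicator_of_notMem, Set.indicator_of_notMem (by rwa [mem_ball_zero_iff]), mul_zero]
      rw [Set.mem_Iio, ← Subtype.coe_lt_coe]
      simpa using h
  have h2 := (μ.measurePreserving_homeomorphUnitSphereProd).lintegral_comp_emb
    (Homeomorph.measurableEmbedding _) g
  simp_rw [h1] at h2
  rw [lintegral_subtype_comap (measurableSet_singleton (0 : E)).compl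
    (fun x => (ball (0 : E) r).indicator W x), restrict_compl_singleton,
    lintegral_indicator measurableSet_ball] at h2
  rw [h2, hg]
  simp only
  rw [lintegral_prod_mul (f := fun θ : sphere (0 : E) 1 => W θ)
    (hW.comp measurable_subtype_coe).aemeasurable
    ((measurable_one.indicator measurableSet_Iio).aemeasurable)]
  congr 1
  rw [lintegral_indicator_one measurableSet_Iio, Measure.volumeIoiPow_apply_Iio]
  have h3 : Module.finrank ℝ E - 1 + 1 = Module.finrank ℝ E := by omega
  rw [h3]
  congr 2
  rw [← h3]
  push_cast
  rfl

end Polar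

section LogSum

theorem sum_indicator_pow_lt_le {q : ℝ} (hq : 1 < q) {x : ℝ} (n : ℕ) :
    ∑ s ∈ Finset.range n, (if q ^ s < x then (1 : ℝ) else 0) ≤
      (1 + (Real.log q)⁻¹) * (1 + max (Real.log x) 0) := by
  have hlq : 0 < Real.log q := Real.log_pos hq
  have hm : 0 ≤ max (Real.log x) 0 := le_max_right _ _
  rw [← Finset.sum_filter, Finset.sum_const, nsmul_eq_mul, mul_one]
  have h1 : Finset.filter (fun s => q ^ s < x) (Finset.range n) ⊆
      Finset.range (⌊(Real.log q)⁻¹ * max (Real.log x) 0⌋₊ + 1) := by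
    intro s hs
    rw [Finset.mem_filter] at hs
    rw [Finset.mem_range, Nat.lt_succ_iff]
    refine Nat.le_floor ?_
    have h2 := Real.log_lt_log (by positivity) hs.2
    rw [Real.log_pow] at h2
    rw [inv_mul_eq_div, le_div_iff₀ hlq]
    exact h2.le.trans (le_max_left _ _)
  have h2 : ((Finset.filter (fun s => q ^ s < x) (Finset.range n)).card : ℝ) ≤
      (⌊(Real.log q)⁻¹ * max (Real.log x) 0⌋₊ : ℝ) + 1 := by
    have := Finset.card_le_card h1
    rw [Finset.card_range] at this
    exact_mod_cast this
  have h3 := Nat.floor_le (show 0 ≤ (Real.log q)⁻¹ * max (Real.log x) 0 by positivity)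
  have h4 : 0 ≤ (Real.log q)⁻¹ := by positivity
  nlinarith

end LogSum

section OmegaBounds

variable {d : ℕ} {Ω : EuclideanSpace ℝ (Fin d) → ℝ}

instance : IsFiniteMeasure (sphereMeasure d) := by
  unfold sphereMeasure
  infer_instance

theorem measurable_sphere_abs (hΩ : Measurable Ω) :
    Measurable fun θ : sphere (0 : EuclideanSpace ℝ (Fin d)) 1 => |Ω θ| :=
  (hΩ.comp measurable_subtype_coe).abs

theorem integrable_sphere_abs (hΩ : Measurable Ω)
    (hL : Integrable (fun θ : sphere (0 : EuclideanSpace ℝ (Fin d)) 1 =>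
      |Ω θ| * Real.log (2 + |Ω θ|)) (sphereMeasure d)) :
    Integrable (fun θ : sphere (0 : EuclideanSpace ℝ (Fin d)) 1 => |Ω θ|) (sphereMeasure d) := by
  refine (hL.const_mul (Real.log 2)⁻¹).mono' (measurable_sphere_abs hΩ).aestronglyMeasurable
    (ae_of_all _ fun θ => ?_)
  rw [Real.norm_of_nonneg (abs_nonneg _), inv_mul_eq_div, le_div_iff₀ (Real.log_pos one_lt_two)]
  exact mul_le_mul_of_nonneg_left (Real.log_le_log two_pos (by linarith [abs_nonneg (Ω θ)]))
    (abs_nonneg _)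

theorem integrable_sphere_one_add_log (hΩ : Measurable Ω)
    (hL : Integrable (fun θ : sphere (0 : EuclideanSpace ℝ (Fin d)) 1 =>
      |Ω θ| * Real.log (2 + |Ω θ|)) (sphereMeasure d)) (N : ℝ) :
    Integrable (fun θ : sphere (0 : EuclideanSpace ℝ (Fin d)) 1 =>
      |Ω θ| * (1 + max (Real.log (|Ω θ| / N)) 0)) (sphereMeasure d) := by
  have hm := measurable_sphere_abs hΩ
  refine (hL.add ((integrable_sphere_abs hΩ hL).const_mul (1 + |Real.log N|))).mono'
    (hm.mul (measurable_const.add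
      ((Real.measurable_log.comp (hm.div_const N)).max measurable_const))).aestronglyMeasurable
    (ae_of_all _ fun θ => ?_)
  have h0 := abs_nonneg (Ω θ)
  rw [Real.norm_of_nonneg (mul_nonneg h0 (by positivity)), Pi.add_apply]
  have h1 : 0 ≤ Real.log (2 + |Ω θ|) := Real.log_nonneg (by linarith)
  have h2 : max (Real.log (|Ω θ| / N)) 0 ≤ Real.log (2 + |Ω θ|) + |Real.log N| := by
    refine max_le ?_ (by positivity)
    rcases eq_or_ne N 0 with h | h
    · rw [h, _root_.div_zero, Real.log_zero]
      positivity
    rcases eq_or_ne (|Ω θ|) 0 with h' | h'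
    · rw [h', zero_div, Real.log_zero]
      have := Real.log_nonneg one_le_two
      rw [add_zero]
      positivity
    rw [Real.log_div h' h]
    have h3 := Real.log_le_log (lt_of_le_of_ne h0 h'.symm) (show |Ω θ| ≤ 2 + |Ω θ| by linarith)
    linarith [neg_abs_le (Real.log N)]
  nlinarith

theorem sphL1_nonneg : 0 ≤ sphL1 d Ω := integral_nonneg fun _ => abs_nonneg _

theorem sphLlogL_nonneg : 0 ≤ sphLlogL d Ω := integral_nonneg fun θ =>
  mul_nonneg (abs_nonneg _) (Real.log_nonneg (by linarith [abs_nonneg (Ω θ)]))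

theorem integral_one_add_log_nonneg (N : ℝ) :
    0 ≤ ∫ θ : sphere (0 : EuclideanSpace ℝ (Fin d)) 1,
      |Ω θ| * (1 + max (Real.log (|Ω θ| / N)) 0) ∂(sphereMeasure d) :=
  integral_nonneg fun _ => mul_nonneg (abs_nonneg _) (by positivity)

theorem sphLlogL_le_COmega : sphLlogL d Ω ≤ COmega d Ω :=
  le_add_of_nonneg_right (integral_one_add_log_nonneg _)

theorem COmega_nonneg : 0 ≤ COmega d Ω :=
  add_nonneg sphLlogL_nonneg (integral_one_add_log_nonneg _)

theorem sphL1_le_COmega (hΩ : Measurable Ω)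
    (hL : Integrable (fun θ : sphere (0 : EuclideanSpace ℝ (Fin d)) 1 =>
      |Ω θ| * Real.log (2 + |Ω θ|)) (sphereMeasure d)) : sphL1 d Ω ≤ COmega d Ω := by
  refine le_trans ?_ (le_add_of_nonneg_left sphLlogL_nonneg)
  refine integral_mono (integrable_sphere_abs hΩ hL) (integrable_sphere_one_add_log hΩ hL _)
    fun θ => le_mul_of_one_le_right (abs_nonneg _) ?_
  linarith [le_max_right (Real.log (|Ω θ| / sphL1 d Ω)) 0]

theorem sphL1_pos (hΩ : Measurable Ω)
    (hL : Integrable (fun θ : sphere (0 : EuclideanSpace ℝ (Fin d)) 1 =>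
      |Ω θ| * Real.log (2 + |Ω θ|)) (sphereMeasure d)) (hC : 0 < COmega d Ω) :
    0 < sphL1 d Ω := by
  refine lt_of_le_of_ne sphL1_nonneg fun h => hC.ne' ?_
  have h1 : (fun θ : sphere (0 : EuclideanSpace ℝ (Fin d)) 1 => |Ω θ|) =ᵐ[sphereMeasure d] 0 :=
    (integral_eq_zero_iff_of_nonneg (fun _ => abs_nonneg _) (integrable_sphere_abs hΩ hL)).mp h.symm
  unfold COmega sphLlogL
  rw [integral_eq_zero_of_ae, integral_eq_zero_of_ae, add_zero]
  · filter_upwards [h1] with θ hθ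
    rw [Pi.zero_apply] at hθ
    rw [hθ, zero_mul, Pi.zero_apply]
  · filter_upwards [h1] with θ hθ
    rw [Pi.zero_apply] at hθ
    rw [hθ, zero_mul, Pi.zero_apply]

theorem sum_lintegral_large_le {q : ℝ} (hq : 1 < q) (hΩ : Measurable Ω)
    (hL : Integrable (fun θ : sphere (0 : EuclideanSpace ℝ (Fin d)) 1 =>
      |Ω θ| * Real.log (2 + |Ω θ|)) (sphereMeasure d)) (hN : 0 < sphL1 d Ω) (n : ℕ) :
    ∑ s ∈ Finset.range n, ∫⁻ θ : sphere (0 : EuclideanSpace ℝ (Fin d)) 1,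
        ENNReal.ofReal (if q ^ s * sphL1 d Ω < |Ω θ| then |Ω θ| else 0) ∂(sphereMeasure d) ≤
      ENNReal.ofReal ((1 + (Real.log q)⁻¹) * COmega d Ω) := by
  have hm := measurable_sphere_abs hΩ
  have hlq : 0 < Real.log q := Real.log_pos hq
  rw [← lintegral_finsetSum _ fun s _ => (Measurable.ite
    (measurableSet_lt measurable_const hm) hm measurable_const).ennreal_ofReal]
  have h1 : ∀ θ : sphere (0 : EuclideanSpace ℝ (Fin d)) 1,
      ∑ s ∈ Finset.range n, ENNReal.ofReal (if q ^ s * sphL1 d Ω < |Ω θ| then |Ω θ| else 0) ≤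
      ENNReal.ofReal ((1 + (Real.log q)⁻¹) *
        (|Ω θ| * (1 + max (Real.log (|Ω θ| / sphL1 d Ω)) 0))) := by
    intro θ
    rw [← ENNReal.ofReal_sum_of_nonneg fun s _ => by split_ifs <;> simp]
    refine ENNReal.ofReal_le_ofReal ?_
    have h2 := mul_le_mul_of_nonneg_left
      (sum_indicator_pow_lt_le hq (x := |Ω θ| / sphL1 d Ω) n) (abs_nonneg (Ω θ))
    refine le_of_eq_of_le ?_ (h2.trans_eq (by ring))
    rw [Finset.mul_sum]
    refine Finset.sum_congr rfl fun s _ => ?_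
    rw [mul_ite, mul_one, mul_zero]
    simp only [lt_div_iff₀ hN]
  refine (lintegral_mono h1).trans ?_
  rw [← ofReal_integral_eq_lintegral_ofReal
    ((integrable_sphere_one_add_log hΩ hL _).const_mul _)
    (ae_of_all _ fun θ => mul_nonneg (by positivity) (mul_nonneg (abs_nonneg _) (by positivity)))]
  refine ENNReal.ofReal_le_ofReal ?_
  rw [integral_const_mul]
  exact mul_le_mul_of_nonneg_left (le_add_of_nonneg_left sphLlogL_nonneg) (by positivity)

theorem lintegral_sphere_eq (hΩ : Measurable Ω)
    (hL : Integrable (fun θ : sphere (0 : EuclideanSpace ℝ (Fin d)) 1 =>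
      |Ω θ| * Real.log (2 + |Ω θ|)) (sphereMeasure d)) :
    ∫⁻ θ : sphere (0 : EuclideanSpace ℝ (Fin d)) 1, ENNReal.ofReal |Ω θ| ∂(sphereMeasure d) =
      ENNReal.ofReal (sphL1 d Ω) :=
  (ofReal_integral_eq_lintegral_ofReal (integrable_sphere_abs hΩ hL)
    (ae_of_all _ fun _ => abs_nonneg _)).symm

/-- Integrals of homogeneous functions over dyadic bands. -/
theorem lintegral_band_le (hd : 1 ≤ d) {W : EuclideanSpace ℝ (Fin d) → ℝ} (hW : Measurable W)
    (hhom : ∀ t : ℝ, 0 < t → ∀ z : EuclideanSpace ℝ (Fin d), z ≠ 0 → W (t • z) = W z)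
    {r : ℝ} (hr : 0 < r) {g : EuclideanSpace ℝ (Fin d) → ℝ} {c : ℝ} (hc : 0 ≤ c)
    (hg : ∀ z, |g z| ≤ c * |W z|) (hsupp : ∀ z, g z ≠ 0 → ‖z‖ ≤ 2 * r) :
    ∫⁻ z, ENNReal.ofReal |g z| ≤ ENNReal.ofReal (c * (3 * r) ^ d) *
      ∫⁻ θ : sphere (0 : EuclideanSpace ℝ (Fin d)) 1,
        ENNReal.ofReal |W θ| ∂(sphereMeasure d) := by
  have : Nontrivial (EuclideanSpace ℝ (Fin d)) := by
    have : Nonempty (Fin d) := ⟨⟨0, hd⟩⟩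
    infer_instance
  have h1 : ∀ z, ENNReal.ofReal |g z| ≤ (ball (0 : EuclideanSpace ℝ (Fin d)) (3 * r)).indicator
      (fun z => ENNReal.ofReal c * ENNReal.ofReal |W z|) z := by
    intro z
    by_cases h : g z = 0
    · simp [h]
    · rw [Set.indicator_of_mem (by rw [mem_ball_zero_iff]; linarith [hsupp z h]),
        ← ENNReal.ofReal_mul hc]
      exact ENNReal.ofReal_le_ofReal (hg z)
  refine (lintegral_mono h1).trans ?_
  rw [lintegral_indicator measurableSet_ball,
    lintegral_const_mul _ (by exact hW.abs.ennreal_ofReal),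
    lintegral_ball_of_homogeneous volume hW.abs.ennreal_ofReal
      (fun t ht z hz => by rw [hhom t ht z hz]) (by positivity : 0 < 3 * r),
    finrank_euclideanSpace_fin, ENNReal.ofReal_mul hc, mul_assoc, mul_comm (∫⁻ _, _ ∂_)]
  unfold sphereMeasure
  gcongr
  exact div_le_self (by positivity) (by exact_mod_cast hd)

end OmegaBounds

section Cubes

variable {d : ℕ}

/-- The index of the cube of side `h` containing `x`. -/
def cubeIdx (h : ℝ) (x : EuclideanSpace ℝ (Fin d)) : Fin d → ℤ := fun i => ⌊x i / h⌋

/-- The half-open cube of side `h` and index `k`. -/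
def cube (h : ℝ) (k : Fin d → ℤ) : Set (EuclideanSpace ℝ (Fin d)) := {x | cubeIdx h x = k}

/-- The centre of the cube of side `h` and index `k`. -/
def cubeCenter (h : ℝ) (k : Fin d → ℤ) : EuclideanSpace ℝ (Fin d) :=
  WithLp.toLp 2 fun i => ((k i : ℝ) + 1 / 2) * h

theorem mem_cube_iff {h : ℝ} (hh : 0 < h) {k : Fin d → ℤ} {x : EuclideanSpace ℝ (Fin d)} :
    x ∈ cube h k ↔ ∀ i, x i ∈ Set.Ico (k i * h) (k i * h + h) := by
  change cubeIdx h x = k ↔ _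
  unfold cubeIdx
  rw [funext_iff]
  refine forall_congr' fun i => ?_
  rw [Int.floor_eq_iff, le_div_iff₀ hh, div_lt_iff₀ hh, add_mul, one_mul, Set.mem_Ico]

theorem cube_eq_preimage {h : ℝ} (hh : 0 < h) (k : Fin d → ℤ) :
    cube h k = WithLp.ofLp ⁻¹' (Set.univ.pi fun i => Set.Ico (k i * h) (k i * h + h)) := by
  ext x
  rw [mem_cube_iff hh]
  simp only [Set.mem_preimage, Set.mem_pi, Set.mem_univ, true_imp_iff]

theorem measurableSet_cube {h : ℝ} (hh : 0 < h) (k : Fin d → ℤ) : MeasurableSet (cube h k) := by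
  rw [cube_eq_preimage hh]
  exact (MeasurableSet.univ_pi fun i => measurableSet_Ico).preimage
    (PiLp.volume_preserving_ofLp (Fin d)).measurable

theorem volume_cube {h : ℝ} (hh : 0 < h) (k : Fin d → ℤ) :
    volume (cube h k) = ENNReal.ofReal (h ^ d) := by
  rw [cube_eq_preimage hh, (PiLp.volume_preserving_ofLp (Fin d)).measure_preimage
    (MeasurableSet.univ_pi fun i => measurableSet_Ico).nullMeasurableSet, Real.volume_pi_Ico]
  simp [ENNReal.ofReal_pow hh.le]

theorem norm_sub_cubeCenter_le {h : ℝ} (hh : 0 < h) {k : Fin d → ℤ}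
    {x : EuclideanSpace ℝ (Fin d)} (hx : x ∈ cube h k) : ‖x - cubeCenter h k‖ ≤ d * h := by
  rw [mem_cube_iff hh] at hx
  have h1 : ∀ i, |(x - cubeCenter h k) i| ≤ h := by
    intro i
    have := hx i
    rw [PiLp.sub_apply, cubeCenter, abs_le]
    constructor <;> nlinarith [this.1, this.2]
  calc ‖x - cubeCenter h k‖
      = ‖∑ i, (x - cubeCenter h k) i • EuclideanSpace.single i (1 : ℝ)‖ := by
        congr 1
        ext j
        simp [Pi.single_apply]
    _ ≤ ∑ i, ‖(x - cubeCenter h k) i • EuclideanSpace.single i (1 : ℝ)‖ := norm_sum_le _ _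
    _ ≤ ∑ _i : Fin d, h := Finset.sum_le_sum fun i _ => by
        rw [norm_smul, PiLp.norm_single, norm_one, mul_one]
        exact h1 i
    _ = d * h := by simp

theorem ball_cubeCenter_subset {h : ℝ} (hh : 0 < h) (k : Fin d → ℤ) :
    ball (cubeCenter h k) (h / 2) ⊆ cube h k := by
  intro x hx
  rw [mem_cube_iff hh]
  intro i
  rw [mem_ball, dist_eq_norm] at hx
  have h1 := (PiLp.norm_apply_le (x - cubeCenter h k) i).trans_lt hx
  rw [PiLp.sub_apply, cubeCenter, Real.norm_eq_abs, abs_lt] at h1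
  constructor <;> nlinarith [h1.1, h1.2]

theorem cubeIdx_double (h : ℝ) (x : EuclideanSpace ℝ (Fin d)) (i : Fin d) :
    cubeIdx (h * 2) x i = cubeIdx h x i / 2 := by
  unfold cubeIdx
  have := Int.floor_div_natCast (x i / h) 2
  rw [div_div] at this
  exact_mod_cast this

theorem cubeIdx_pow_eq {h : ℝ} {x y : EuclideanSpace ℝ (Fin d)} {j : ℕ}
    (hxy : cubeIdx (h * 2 ^ j) x = cubeIdx (h * 2 ^ j) y) {n : ℕ} (hn : j ≤ n) :
    cubeIdx (h * 2 ^ n) x = cubeIdx (h * 2 ^ n) y := by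
  induction n, hn using Nat.le_induction with
  | base => exact hxy
  | succ n _ ih =>
    ext i
    rw [pow_succ, ← mul_assoc, cubeIdx_double, cubeIdx_double, ih]

end Cubes

section CalderonZygmund

variable {d : ℕ}

theorem exists_stopping_cubes (hd : 1 ≤ d) {f : EuclideanSpace ℝ (Fin d) → ℂ} (hf : Continuous f)
    (hc : HasCompactSupport f) {α : ℝ} (hα : 0 < α) {h : ℝ} (hh : 0 < h) :
    ∃ s : Finset (ℕ × (Fin d → ℤ)),
      (∀ i ∈ s, α * (h * 2 ^ i.1) ^ d ≤ ∫ x in cube (h * 2 ^ i.1) i.2, ‖f x‖) ∧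
      (∀ i ∈ s, ∫ x in cube (h * 2 ^ i.1) i.2, ‖f x‖ ≤ 2 ^ d * α * (h * 2 ^ i.1) ^ d) ∧
      ((s : Set (ℕ × (Fin d → ℤ))).PairwiseDisjoint fun i => cube (h * 2 ^ i.1) i.2) ∧
      (∀ x, (∀ i ∈ s, x ∉ cube (h * 2 ^ i.1) i.2) →
        ∫ y in cube h (cubeIdx h x), ‖f y‖ ≤ α * h ^ d) := by
  have hfi : Integrable fun x => ‖f x‖ := (hf.integrable_of_hasCompactSupport hc).norm
  set F : ℕ → (Fin d → ℤ) → ℝ := fun j k => ∫ x in cube (h * 2 ^ j) k, ‖f x‖ with hF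
  set bad : ℕ → EuclideanSpace ℝ (Fin d) → Prop := fun j x =>
    α * (h * 2 ^ j) ^ d < F j (cubeIdx (h * 2 ^ j) x) with hbad
  have hside : ∀ j : ℕ, 0 < h * 2 ^ j := fun j => by positivity
  obtain ⟨J, hJ⟩ : ∃ J : ℕ, ∀ j ≥ J, ∀ x, ¬ bad j x := by
    obtain ⟨J, hJ⟩ := pow_unbounded_of_one_lt ((∫ x, ‖f x‖) / (α * h ^ d)) (one_lt_two : (1 : ℝ) < 2)
    refine ⟨J, fun j hj x => not_lt.mpr ?_⟩
    refine (setIntegral_le_integral hfi (ae_of_all _ fun _ => norm_nonneg _)).trans ?_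
    rw [div_lt_iff₀ (by positivity)] at hJ
    refine hJ.le.trans ?_
    calc (2 : ℝ) ^ J * (α * h ^ d) ≤ (2 ^ j) ^ d * (α * h ^ d) := by
          gcongr
          refine (pow_le_pow_right₀ one_le_two hj).trans ?_
          exact le_self_pow₀ (one_le_pow₀ one_le_two) (by omega)
      _ = _ := by rw [mul_pow]; ring
  set selected : ℕ → EuclideanSpace ℝ (Fin d) → Prop := fun j x =>
    bad j x ∧ ∀ n, j < n → ¬ bad n x with hsel
  have hbadx : ∀ j x y, cubeIdx (h * 2 ^ j) x = cubeIdx (h * 2 ^ j) y → ∀ n ≥ j,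
      (bad n x ↔ bad n y) := by
    intro j x y hxy n hn
    simp only [hbad, cubeIdx_pow_eq hxy hn]
  have hsel_congr : ∀ j x y, cubeIdx (h * 2 ^ j) x = cubeIdx (h * 2 ^ j) y → selected j x → selected j y := by
    rintro j x y hxy ⟨h1, h2⟩
    exact ⟨(hbadx j x y hxy j le_rfl).mp h1, fun n hn h3 =>
      h2 n hn ((hbadx j x y hxy n hn.le).mpr h3)⟩
  have hsel_unique : ∀ x j n, selected j x → selected n x → j = n := by
    rintro x j n ⟨h1, h2⟩ ⟨h3, h4⟩
    rcases lt_trichotomy j n with h5 | h5 | h5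
    · exact absurd h3 (h2 n h5)
    · exact h5
    · exact absurd h1 (h4 j h5)
  have hexists : ∀ x j, bad j x → ∃ n, selected n x := by
    classical
    intro x j hj
    have hne : ((Finset.range J).filter fun n => bad n x).Nonempty := by
      refine ⟨j, Finset.mem_filter.mpr ⟨Finset.mem_range.mpr ?_, hj⟩⟩
      by_contra hjJ
      exact hJ j (not_lt.mp hjJ) x hj
    refine ⟨_, (Finset.mem_filter.mp (Finset.max'_mem _ hne)).2, fun n hn hb => ?_⟩
    refine absurd (Finset.le_max' ((Finset.range J).filter fun n => bad n x) n ?_) (not_le.mpr hn)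
    refine Finset.mem_filter.mpr ⟨Finset.mem_range.mpr ?_, hb⟩
    by_contra hjJ
    exact hJ n (not_lt.mp hjJ) x hb
  set S : Set (ℕ × (Fin d → ℤ)) := {i | ∃ x, cubeIdx (h * 2 ^ i.1) x = i.2 ∧ selected i.1 x} with hS
  have hfin : S.Finite := by
    obtain ⟨R, hR0, hR⟩ : ∃ R : ℝ, 0 < R ∧ ∀ x, f x ≠ 0 → ‖x‖ ≤ R := by
      obtain ⟨R, hR⟩ := hc.isCompact.isBounded.exists_norm_le
      exact ⟨max R 1, by positivity, fun x hx =>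
        (hR x (subset_tsupport f hx)).trans (le_max_left _ _)⟩
    refine ((Set.finite_Iio J).prod (Set.finite_Icc (fun _ : Fin d => ⌊-(R / h)⌋)
      (fun _ => ⌊R / h⌋))).subset ?_
    rintro ⟨j, k⟩ ⟨x, hxk, hx⟩
    simp only at hxk hx
    refine ⟨?_, ?_⟩
    · by_contra hjJ
      exact hJ j (not_lt.mp hjJ) x hx.1
    have h1 : ∃ y ∈ cube (h * 2 ^ j) k, f y ≠ 0 := by
      by_contra! h2
      have h3 := hx.1
      simp only [hbad, hF] at h3
      rw [hxk, setIntegral_eq_zero_of_forall_eq_zero fun y hy => by rw [h2 y hy, norm_zero]] at h3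
      have := hside j
      exact absurd h3 (not_lt.mpr (by positivity))
    obtain ⟨y, hy, hfy⟩ := h1
    have hyk : cubeIdx (h * 2 ^ j) y = k := hy
    have h2 : ∀ i, |y i / (h * 2 ^ j)| ≤ R / h := by
      intro i
      rw [abs_div, abs_of_pos (hside j)]
      refine div_le_div₀ hR0.le ((PiLp.norm_apply_le y i).trans (hR y hfy)) hh ?_
      exact le_mul_of_one_le_right hh.le (one_le_pow₀ one_le_two)
    simp only [Set.mem_Icc]
    constructor
    · intro i
      rw [← hyk]
      exact Int.floor_le_floor (abs_le.mp (h2 i)).1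
    · intro i
      rw [← hyk]
      exact Int.floor_le_floor (abs_le.mp (h2 i)).2
  refine ⟨hfin.toFinset, ?_, ?_, ?_, ?_⟩
  · intro i hi
    rw [Set.Finite.mem_toFinset] at hi
    obtain ⟨x, hxk, hx⟩ := hi
    have := hx.1.le
    rwa [hxk] at this
  · intro i hi
    rw [Set.Finite.mem_toFinset] at hi
    obtain ⟨x, hxk, hx⟩ := hi
    have h1 := not_lt.mp (hx.2 (i.1 + 1) (Nat.lt_succ_self _))
    have h2 : cube (h * 2 ^ i.1) i.2 ⊆ cube (h * 2 ^ (i.1 + 1)) (cubeIdx (h * 2 ^ (i.1 + 1)) x) := by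
      intro y hy
      have hy' : cubeIdx (h * 2 ^ i.1) y = i.2 := hy
      exact cubeIdx_pow_eq (hy'.trans hxk.symm) (Nat.le_succ _)
    calc _ ≤ F (i.1 + 1) (cubeIdx (h * 2 ^ (i.1 + 1)) x) :=
          setIntegral_mono_set hfi.integrableOn (ae_of_all _ fun _ => norm_nonneg _)
            h2.eventuallyLE
      _ ≤ _ := h1
      _ = _ := by rw [pow_succ, ← mul_assoc, mul_pow _ (2 : ℝ)]; ring
  · rintro i hi n hn hne
    rw [Set.Finite.coe_toFinset] at hi hn
    obtain ⟨x, hxk, hx⟩ := hi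
    obtain ⟨y, hyk, hy⟩ := hn
    refine Set.disjoint_left.mpr fun z hz1 hz2 => hne ?_
    have hz1' : cubeIdx (h * 2 ^ i.1) z = i.2 := hz1
    have hz2' : cubeIdx (h * 2 ^ n.1) z = n.2 := hz2
    have h1 := hsel_unique z i.1 n.1 (hsel_congr _ _ _ (hxk.trans hz1'.symm) hx)
      (hsel_congr _ _ _ (hyk.trans hz2'.symm) hy)
    refine Prod.ext h1 ?_
    rw [← hz1', ← hz2', h1]
  · intro x hx
    by_contra h1
    have h2 : bad 0 x := by
      simp only [hbad, hF, pow_zero, mul_one]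
      exact not_le.mp h1
    obtain ⟨n, hn⟩ := hexists x 0 h2
    exact hx (n, cubeIdx (h * 2 ^ n) x) (hfin.mem_toFinset.mpr ⟨x, rfl, hn⟩) rfl

end CalderonZygmund

section CalderonZygmund

/-- The mean-zero part of `f` on the set `Q`. -/
def localBad {X : Type*} [MeasureSpace X] (Q : Set X) (f : X → ℂ) : X → ℂ :=
  Q.indicator fun x => f x - ⨍ y in Q, f y

section LocalBad

variable {X : Type*} [MeasureSpace X] {Q : Set X} {f : X → ℂ}

theorem integrable_localBad (hQ : MeasurableSet Q) (hQ' : volume Q ≠ ∞) (hf : Integrable f) :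
    Integrable (localBad Q f) := by
  rw [localBad, integrable_indicator_iff hQ]
  exact hf.integrableOn.sub (integrableOn_const hQ')

theorem integral_localBad (hQ : MeasurableSet Q) (hQ' : volume Q ≠ ∞) (f : X → ℂ) :
    ∫ x, localBad Q f x = 0 := by
  have : IsFiniteMeasure (volume.restrict Q) := ⟨by simpa using hQ'.lt_top⟩
  rw [localBad, integral_indicator hQ]
  exact integral_sub_average _ _

theorem norm_setAverage_mul_le (hQ' : volume Q ≠ ∞) (f : X → ℂ) :
    volume.real Q * ‖⨍ y in Q, f y‖ ≤ ∫ y in Q, ‖f y‖ := by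
  have : IsFiniteMeasure (volume.restrict Q) := ⟨by simpa using hQ'.lt_top⟩
  have h := measure_smul_setAverage f hQ'
  calc volume.real Q * ‖⨍ y in Q, f y‖ = ‖volume.real Q • ⨍ y in Q, f y‖ := by
        rw [norm_smul, Real.norm_of_nonneg measureReal_nonneg]
    _ ≤ _ := by rw [h]; exact norm_integral_le_integral_norm _

theorem integral_norm_localBad_le (hQ : MeasurableSet Q) (hQ' : volume Q ≠ ∞) (hf : Integrable f) :
    ∫ x, ‖localBad Q f x‖ ≤ 2 * ∫ x in Q, ‖f x‖ := by
  have : IsFiniteMeasure (volume.restrict Q) := ⟨by simpa using hQ'.lt_top⟩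
  have h1 : (fun x => ‖localBad Q f x‖) = Q.indicator fun x => ‖f x - ⨍ y in Q, f y‖ := by
    ext x
    rw [localBad, norm_indicator_eq_indicator_norm]
  rw [h1, integral_indicator hQ]
  calc ∫ x in Q, ‖f x - ⨍ y in Q, f y‖ ≤ ∫ x in Q, (‖f x‖ + ‖⨍ y in Q, f y‖) :=
        integral_mono (hf.integrableOn.sub (integrableOn_const hQ')).norm
          (hf.integrableOn.norm.add (integrableOn_const hQ')) fun x => norm_sub_le _ _
    _ = (∫ x in Q, ‖f x‖) + volume.real Q * ‖⨍ y in Q, f y‖ := by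
        rw [integral_add hf.integrableOn.norm (integrableOn_const hQ'), setIntegral_const,
          smul_eq_mul]
    _ ≤ _ := by linarith [norm_setAverage_mul_le hQ' f]

end LocalBad

variable {d : ℕ}

theorem sum_setIntegral_cube_le {f : EuclideanSpace ℝ (Fin d) → ℂ} (hf : Integrable f) {ι : Type*}
    {s : Finset ι} {Q : ι → Set (EuclideanSpace ℝ (Fin d))} (hQ : ∀ i ∈ s, MeasurableSet (Q i))
    (hd : (s : Set ι).PairwiseDisjoint Q) : ∑ i ∈ s, ∫ x in Q i, ‖f x‖ ≤ ∫ x, ‖f x‖ := by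
  rw [← integral_biUnion_finset s hQ hd fun i _ => hf.norm.integrableOn]
  exact setIntegral_le_integral hf.norm (ae_of_all _ fun _ => norm_nonneg _)

theorem sum_localBad_eq {f : EuclideanSpace ℝ (Fin d) → ℂ} {ι : Type*}
    {s : Finset ι} {Q : ι → Set (EuclideanSpace ℝ (Fin d))}
    (hd : (s : Set ι).PairwiseDisjoint Q) {i : ι} (hi : i ∈ s) {x : EuclideanSpace ℝ (Fin d)}
    (hx : x ∈ Q i) : ∑ j ∈ s, localBad (Q j) f x = f x - ⨍ y in Q i, f y := by
  rw [Finset.sum_eq_single_of_mem i hi, localBad, Set.indicator_of_mem hx]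
  intro j hj hji
  refine Set.indicator_of_notMem (fun h => ?_) _
  exact Set.disjoint_left.mp (hd hj hi hji) h hx

theorem real_volume_cube {h : ℝ} (hh : 0 < h) (k : Fin d → ℤ) : volume.real (cube h k) = h ^ d := by
  rw [Measure.real, volume_cube hh, ENNReal.toReal_ofReal (by positivity)]

/-- The Calderón–Zygmund decomposition of a continuous function along finitely many dyadic cubes. -/
theorem exists_sharp_decomposition (hd : 1 ≤ d) {f : EuclideanSpace ℝ (Fin d) → ℂ}
    (hf : Continuous f) (hc : HasCompactSupport f) {α : ℝ} (hα : 0 < α) :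
    ∃ h : ℝ, 0 < h ∧ ∃ s : Finset (ℕ × (Fin d → ℤ)),
      (∀ i ∈ s, α * (h * 2 ^ i.1) ^ d ≤ ∫ y in cube (h * 2 ^ i.1) i.2, ‖f y‖) ∧
      (∀ i ∈ s, ∫ y in cube (h * 2 ^ i.1) i.2, ‖f y‖ ≤ 2 ^ d * α * (h * 2 ^ i.1) ^ d) ∧
      (s : Set (ℕ × (Fin d → ℤ))).PairwiseDisjoint (fun i => cube (h * 2 ^ i.1) i.2) ∧
      ∀ x, ‖f x - ∑ i ∈ s, localBad (cube (h * 2 ^ i.1) i.2) f x‖ ≤ (2 ^ d + 2) * α := by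
  have hu : UniformContinuous f := hc.uniformContinuous_of_continuous hf
  obtain ⟨τ, hτ, hτ'⟩ := Metric.uniformContinuous_iff.mp hu α hα
  have hint : Integrable f := hf.integrable_of_hasCompactSupport hc
  set h : ℝ := τ / (4 * (d + 1)) with hhdef
  have hh : 0 < h := by positivity
  obtain ⟨s, h1, h2, h3, h4⟩ := exists_stopping_cubes hd hf hc hα hh
  refine ⟨h, hh, s, h1, h2, h3, fun x => ?_⟩
  have hfin : ∀ (h : ℝ) (k : Fin d → ℤ), 0 < h → volume (cube h k) ≠ ∞ := fun h k hh => by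
    rw [volume_cube hh]; exact ENNReal.ofReal_ne_top
  by_cases hx : ∃ i ∈ s, x ∈ cube (h * 2 ^ i.1) i.2
  · obtain ⟨i, hi, hxi⟩ := hx
    have hρ : 0 < h * 2 ^ i.1 := by positivity
    rw [sum_localBad_eq h3 hi hxi, _root_.sub_sub_cancel]
    have h5 := (norm_setAverage_mul_le (hfin _ i.2 hρ) f).trans (h2 i hi)
    rw [real_volume_cube hρ] at h5
    have h6 : ‖⨍ y in cube (h * 2 ^ i.1) i.2, f y‖ ≤ 2 ^ d * α :=
      le_of_mul_le_mul_left (by linarith) (pow_pos hρ d)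
    linarith
  · push Not at hx
    have h0 : ∑ i ∈ s, localBad (cube (h * 2 ^ i.1) i.2) f x = 0 :=
      Finset.sum_eq_zero fun i hi => Set.indicator_of_notMem (hx i hi) _
    rw [h0, sub_zero]
    have h5 := h4 x hx
    have hxc : x ∈ cube h (cubeIdx h x) := rfl
    have h6 : ∀ y ∈ cube h (cubeIdx h x), ‖f x‖ - α ≤ ‖f y‖ := by
      intro y hy
      have h7 := norm_sub_cubeCenter_le hh hy
      have h8 := norm_sub_cubeCenter_le hh hxc
      have h9 : dist x y < τ := by
        rw [dist_eq_norm, ← sub_sub_sub_cancel_right x y (cubeCenter h (cubeIdx h x))]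
        refine (norm_sub_le _ _).trans_lt ?_
        have : d * h + d * h < τ := by
          rw [hhdef]
          field_simp
          nlinarith
        linarith
      have h10 := hτ' h9
      rw [dist_eq_norm] at h10
      linarith [norm_sub_norm_le (f x) (f y)]
    have h7 : (‖f x‖ - α) * h ^ d ≤ ∫ y in cube h (cubeIdx h x), ‖f y‖ := by
      rw [← real_volume_cube hh (cubeIdx h x)]
      exact setIntegral_ge_of_const_le_real (measurableSet_cube hh _) (hfin _ _ hh) h6
        hint.norm.integrableOn
    have h8 : ‖f x‖ - α ≤ α := le_of_mul_le_mul_right (h7.trans h5) (by positivity)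
    have : (0:ℝ) ≤ 2 ^ d * α := by positivity
    linarith

end CalderonZygmund

section SmoothDecomposition

open scoped Convolution

variable {d : ℕ}

/-- A smooth Calderón–Zygmund decomposition `f = (f - ∑ b i) + ∑ b i` at height `α`. -/
structure IsSmoothDecomposition {ι : Type} (f : EuclideanSpace ℝ (Fin d) → ℂ) (α : ℝ) (s : Finset ι)
    (ρ : ι → ℝ) (c : ι → EuclideanSpace ℝ (Fin d)) (b : ι → EuclideanSpace ℝ (Fin d) → ℂ) :
    Prop where
  side_pos : ∀ i, 0 < ρ i
  disj : (s : Set ι).PairwiseDisjoint fun i => ball (c i) (ρ i / 2)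
  smooth : ∀ i ∈ s, ContDiff ℝ (⊤ : ℕ∞) (b i)
  compact_supp : ∀ i ∈ s, HasCompactSupport (b i)
  mean : ∀ i ∈ s, ∫ y, b i y = 0
  norm_le : ∀ i ∈ s, ∫ y, ‖b i y‖ ≤ 2 ^ (d + 1) * α * ρ i ^ d
  supp : ∀ i ∈ s, ∀ y, b i y ≠ 0 → ‖y - c i‖ ≤ (d + 1) * ρ i
  sum_side : ∑ i ∈ s, α * ρ i ^ d ≤ ∫ y, ‖f y‖
  sum_norm : ∑ i ∈ s, ∫ y, ‖b i y‖ ≤ 2 * ∫ y, ‖f y‖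
  good_le : ∀ x, ‖f x - ∑ i ∈ s, b i x‖ ≤ (2 ^ d + 3) * α

/-- Convolution against a normed bump function. -/
def mollify (φ : ContDiffBump (0 : EuclideanSpace ℝ (Fin d))) (b : EuclideanSpace ℝ (Fin d) → ℂ) :
    EuclideanSpace ℝ (Fin d) → ℂ :=
  φ.normed volume ⋆[ContinuousLinearMap.lsmul ℝ ℝ, volume] b

section Mollify

variable (φ : ContDiffBump (0 : EuclideanSpace ℝ (Fin d))) {b : EuclideanSpace ℝ (Fin d) → ℂ}

theorem mollify_apply (b : EuclideanSpace ℝ (Fin d) → ℂ) (x : EuclideanSpace ℝ (Fin d)) :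
    mollify φ b x = ∫ t, φ.normed volume t • b (x - t) := rfl

theorem contDiff_mollify (hb : Integrable b) : ContDiff ℝ (⊤ : ℕ∞) (mollify φ b) :=
  φ.hasCompactSupport_normed.contDiff_convolution_left _ φ.contDiff_normed hb.locallyIntegrable

theorem integrable_smul_sub_right (hb : Integrable b) (x : EuclideanSpace ℝ (Fin d)) :
    Integrable fun t => φ.normed volume t • b (x - t) :=
  φ.hasCompactSupport_normed.convolutionExists_left (ContinuousLinearMap.lsmul ℝ ℝ)
    φ.continuous_normed hb.locallyIntegrable x

theorem integral_mollify (hb : Integrable b) : ∫ x, mollify φ b x = ∫ x, b x := by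
  rw [mollify, integral_convolution _ φ.integrable_normed hb, φ.integral_normed]
  simp

theorem integral_norm_mollify_le (hb : Integrable b) : ∫ x, ‖mollify φ b x‖ ≤ ∫ x, ‖b x‖ := by
  have h1 : ∫ x, (φ.normed volume ⋆[ContinuousLinearMap.lsmul ℝ ℝ, volume] fun x => ‖b x‖) x =
      ∫ x, ‖b x‖ := by
    rw [integral_convolution _ φ.integrable_normed hb.norm, φ.integral_normed]
    simp
  rw [← h1]
  refine integral_mono (Integrable.integrable_convolution _ φ.integrable_normed hb).norm
    (Integrable.integrable_convolution _ φ.integrable_normed hb.norm) fun x => ?_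
  refine (norm_integral_le_integral_norm _).trans (le_of_eq ?_)
  refine integral_congr_ae (ae_of_all _ fun t => ?_)
  simp only [ContinuousLinearMap.lsmul_apply, norm_smul, Real.norm_of_nonneg (φ.nonneg_normed t),
    smul_eq_mul]

theorem exists_of_mollify_ne_zero {x : EuclideanSpace ℝ (Fin d)} (hx : mollify φ b x ≠ 0) :
    ∃ y, b y ≠ 0 ∧ ‖x - y‖ ≤ φ.rOut := by
  by_contra! h
  refine hx ?_
  rw [mollify_apply]
  refine integral_eq_zero_of_ae (ae_of_all _ fun t => ?_)
  by_cases h1 : b (x - t) = 0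
  · simp [h1]
  · have h2 := h _ h1
    rw [_root_.sub_sub_cancel] at h2
    have : t ∉ Function.support (φ.normed volume) := by
      rw [φ.support_normed_eq, mem_ball_zero_iff]
      exact not_lt.mpr h2.le
    rw [Function.notMem_support] at this
    simp [this]

theorem hasCompactSupport_of_norm_sub_le {b : EuclideanSpace ℝ (Fin d) → ℂ}
    {c : EuclideanSpace ℝ (Fin d)} {R : ℝ} (h : ∀ y, b y ≠ 0 → ‖y - c‖ ≤ R) :
    HasCompactSupport b :=
  HasCompactSupport.intro (isCompact_closedBall c R) fun y hy => by
    by_contra h'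
    exact hy (by rw [mem_closedBall, dist_eq_norm]; exact h y h')

theorem norm_sub_sum_mollify_le {ι : Type} {s : Finset ι} {b : ι → EuclideanSpace ℝ (Fin d) → ℂ}
    (hb : ∀ i ∈ s, Integrable (b i)) {f : EuclideanSpace ℝ (Fin d) → ℂ}
    {B a : ℝ} (hB : ∀ x, ‖f x - ∑ i ∈ s, b i x‖ ≤ B)
    (ha : ∀ x t, ‖t‖ < φ.rOut → ‖f x - f (x - t)‖ ≤ a) (x : EuclideanSpace ℝ (Fin d)) :
    ‖f x - ∑ i ∈ s, mollify φ (b i) x‖ ≤ B + a := by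
  have h1 : ∑ i ∈ s, mollify φ (b i) x = ∫ t, φ.normed volume t • ∑ i ∈ s, b i (x - t) := by
    simp_rw [mollify_apply, Finset.smul_sum]
    rw [integral_finsetSum]
    exact fun i hi => integrable_smul_sub_right φ (hb i hi) x
  have h2 : f x = ∫ t, φ.normed volume t • f x := by
    rw [integral_smul_const, φ.integral_normed, one_smul]
  have hi1 : Integrable fun t => φ.normed volume t • f x := φ.integrable_normed.smul_const _
  have hi2 : Integrable fun t => φ.normed volume t • ∑ i ∈ s, b i (x - t) := by
    simp_rw [Finset.smul_sum]
    exact integrable_finsetSum _ fun i hi => integrable_smul_sub_right φ (hb i hi) x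
  rw [h1]
  nth_rewrite 1 [h2]
  rw [← integral_sub hi1 hi2]
  have h3 : ∫ t, φ.normed volume t * (B + a) = B + a := by
    rw [integral_mul_const, φ.integral_normed, one_mul]
  rw [← h3]
  refine norm_integral_le_of_norm_le (φ.integrable_normed.mul_const _) (ae_of_all _ fun t => ?_)
  by_cases ht : ‖t‖ < φ.rOut
  · rw [← smul_sub, norm_smul, Real.norm_of_nonneg (φ.nonneg_normed t)]
    refine mul_le_mul_of_nonneg_left ?_ (φ.nonneg_normed t)
    have h4 : f x - ∑ i ∈ s, b i (x - t) =
        (f (x - t) - ∑ i ∈ s, b i (x - t)) + (f x - f (x - t)) := by ring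
    rw [h4]
    exact (norm_add_le _ _).trans (add_le_add (hB _) (ha x t ht))
  · have : t ∉ Function.support (φ.normed volume) := by
      rw [φ.support_normed_eq, mem_ball_zero_iff]
      exact ht
    rw [Function.notMem_support] at this
    simp [this]

end Mollify

theorem exists_smooth_decomposition (hd : 1 ≤ d) {f : EuclideanSpace ℝ (Fin d) → ℂ}
    (hf : Continuous f) (hc : HasCompactSupport f) {α : ℝ} (hα : 0 < α) :
    ∃ (s : Finset (ℕ × (Fin d → ℤ))) (ρ : ℕ × (Fin d → ℤ) → ℝ)
      (c : ℕ × (Fin d → ℤ) → EuclideanSpace ℝ (Fin d))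
      (b : ℕ × (Fin d → ℤ) → EuclideanSpace ℝ (Fin d) → ℂ),
      IsSmoothDecomposition f α s ρ c b := by
  have hint : Integrable f := hf.integrable_of_hasCompactSupport hc
  obtain ⟨h, hh, s, h1, h2, h3, h4⟩ := exists_sharp_decomposition hd hf hc hα
  obtain ⟨τ, hτ, hτ'⟩ := Metric.uniformContinuous_iff.mp
    (hc.uniformContinuous_of_continuous hf) α hα
  have hr : 0 < min τ h := lt_min hτ hh
  set φ : ContDiffBump (0 : EuclideanSpace ℝ (Fin d)) :=
    ⟨min τ h / 2, min τ h, by linarith, by linarith⟩ with hφ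
  have hφr : φ.rOut = min τ h := rfl
  have hρ : ∀ i : ℕ × (Fin d → ℤ), 0 < h * 2 ^ i.1 := fun i => by positivity
  have hρh : ∀ i : ℕ × (Fin d → ℤ), h ≤ h * 2 ^ i.1 := fun i =>
    le_mul_of_one_le_right hh.le (one_le_pow₀ (by norm_num))
  have hfin : ∀ i : ℕ × (Fin d → ℤ), volume (cube (h * 2 ^ i.1) i.2) ≠ ∞ := fun i => by
    rw [volume_cube (hρ i)]; exact ENNReal.ofReal_ne_top
  have hm : ∀ i : ℕ × (Fin d → ℤ), MeasurableSet (cube (h * 2 ^ i.1) i.2) :=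
    fun i => measurableSet_cube (hρ i) _
  have hb : ∀ i : ℕ × (Fin d → ℤ), Integrable (localBad (cube (h * 2 ^ i.1) i.2) f) :=
    fun i => integrable_localBad (hm i) (hfin i) hint
  have hsupp : ∀ (i : ℕ × (Fin d → ℤ)) (y : EuclideanSpace ℝ (Fin d)),
      mollify φ (localBad (cube (h * 2 ^ i.1) i.2) f) y ≠ 0 →
      ‖y - cubeCenter (h * 2 ^ i.1) i.2‖ ≤ (d + 1) * (h * 2 ^ i.1) := by
    intro i y hy
    obtain ⟨z, hz, hzy⟩ := exists_of_mollify_ne_zero φ hy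
    have hz' : z ∈ cube (h * 2 ^ i.1) i.2 := Set.mem_of_indicator_ne_zero hz
    have h5 := norm_sub_cubeCenter_le (hρ i) hz'
    have h6 := norm_sub_le_norm_sub_add_norm_sub y z (cubeCenter (h * 2 ^ i.1) i.2)
    have h7 := hρh i
    have h8 : min τ h ≤ h := min_le_right _ _
    rw [hφr] at hzy
    linarith
  have hnorm : ∀ i : ℕ × (Fin d → ℤ), ∫ y, ‖mollify φ (localBad (cube (h * 2 ^ i.1) i.2) f) y‖ ≤
      2 * ∫ y in cube (h * 2 ^ i.1) i.2, ‖f y‖ := fun i =>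
    (integral_norm_mollify_le φ (hb i)).trans (integral_norm_localBad_le (hm i) (hfin i) hint)
  have hsum := sum_setIntegral_cube_le hint (fun i _ => hm i) h3
  refine ⟨s, fun i => h * 2 ^ i.1, fun i => cubeCenter (h * 2 ^ i.1) i.2,
    fun i => mollify φ (localBad (cube (h * 2 ^ i.1) i.2) f), ⟨hρ, ?_, ?_, ?_, ?_, ?_, ?_, ?_, ?_,
    ?_⟩⟩
  · exact fun i hi j hj hij => (h3 hi hj hij).mono (ball_cubeCenter_subset (hρ i) _)
      (ball_cubeCenter_subset (hρ j) _)
  · exact fun i _ => contDiff_mollify φ (hb i)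
  · exact fun i _ => hasCompactSupport_of_norm_sub_le (hsupp i)
  · intro i _
    rw [integral_mollify φ (hb i), integral_localBad (hm i) (hfin i)]
  · intro i hi
    refine (hnorm i).trans ?_
    have := h2 i hi
    rw [pow_succ]
    linarith
  · exact fun i _ y hy => hsupp i y hy
  · exact (Finset.sum_le_sum h1).trans hsum
  · refine (Finset.sum_le_sum fun i _ => hnorm i).trans ?_
    rw [← Finset.mul_sum]
    linarith
  · intro x
    have h5 := norm_sub_sum_mollify_le φ (a := α) (fun i _ => hb i) h4 (fun x t ht => ?_) x
    · linarith
    · have h6 : dist x (x - t) < τ := by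
        rw [dist_eq_norm, _root_.sub_sub_cancel]
        rw [hφr] at ht
        exact ht.trans_le (min_le_left _ _)
      have := hτ' h6
      rw [dist_eq_norm] at this
      exact this.le

end SmoothDecomposition

section CommutatorKernel

variable {d l : ℕ} {A Ω : EuclideanSpace ℝ (Fin d) → ℝ} {S : ℝ}

/-- The kernel of the Bajsanski–Coifman commutator. -/
def commKernel (d l : ℕ) (A Ω : EuclideanSpace ℝ (Fin d) → ℝ) (x y : EuclideanSpace ℝ (Fin d)) : ℝ :=
  Ω (x - y) / ‖x - y‖ ^ d * (Pl d l A x y / ‖x - y‖ ^ l)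

theorem commKernel_eq (x y : EuclideanSpace ℝ (Fin d)) : commKernel d l A Ω x y =
    Ω (x - y) * ((‖x - y‖ ^ (d + l))⁻¹ * taylorRem A l y (x - y)) := by
  rw [commKernel, Pl_eq_taylorRem, pow_add, mul_inv]
  ring

theorem abs_commKernel_le (hA : ContDiff ℝ (l : ℕ∞) A)
    (hS : ∀ α : Fin d → ℕ, ∑ i, α i = l → ∀ x, |mderiv d α A x| ≤ S) (hS0 : 0 ≤ S)
    {ε : ℝ} (hε : 0 < ε) {x y : EuclideanSpace ℝ (Fin d)} (hxy : ε ≤ ‖x - y‖) :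
    |commKernel d l A Ω x y| ≤ taylorConst d l * S / ε ^ d * |Ω (x - y)| := by
  have hz : 0 < ‖x - y‖ := hε.trans_le hxy
  have hT := taylorConst_pos d l
  rw [commKernel_eq, abs_mul, abs_mul, abs_of_nonneg (by positivity : 0 ≤ (‖x - y‖ ^ (d + l))⁻¹),
    mul_comm]
  refine mul_le_mul_of_nonneg_right ?_ (abs_nonneg _)
  calc (‖x - y‖ ^ (d + l))⁻¹ * |taylorRem A l y (x - y)|
      ≤ (‖x - y‖ ^ (d + l))⁻¹ * (taylorConst d l * S * ‖x - y‖ ^ l) := by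
        gcongr; exact abs_taylorRem_le hA hS hS0 _ _
    _ = taylorConst d l * S / ‖x - y‖ ^ d := by rw [pow_add]; field_simp
    _ ≤ _ := by gcongr

theorem measurable_taylorRem_sub (hA : ContDiff ℝ (l : ℕ∞) A) (x : EuclideanSpace ℝ (Fin d)) :
    Measurable fun y => taylorRem A l y (x - y) :=
  ((continuous_taylorRem hA).comp (continuous_id.prodMk (continuous_const.sub continuous_id))).measurable

theorem measurable_commKernel (hA : ContDiff ℝ (l : ℕ∞) A) (hΩ : Measurable Ω)
    (x : EuclideanSpace ℝ (Fin d)) : Measurable (commKernel d l A Ω x) := by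
  have h : commKernel d l A Ω x = fun y =>
      Ω (x - y) * ((‖x - y‖ ^ (d + l))⁻¹ * taylorRem A l y (x - y)) :=
    funext fun y => commKernel_eq x y
  rw [h]
  have h1 : Measurable fun y : EuclideanSpace ℝ (Fin d) => x - y := measurable_const.sub measurable_id
  exact (hΩ.comp h1).mul (((h1.norm.pow_const _).inv).mul (measurable_taylorRem_sub hA x))

theorem measurable_kernelPiece_sub (hA : ContDiff ℝ (l : ℕ∞) A) (r : ℝ)
    (x : EuclideanSpace ℝ (Fin d)) : Measurable fun y => kernelPiece A l r y (x - y) := by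
  have h1 : Measurable fun y : EuclideanSpace ℝ (Fin d) => x - y := measurable_const.sub measurable_id
  exact (contDiff_bandCut.continuous.measurable.comp (h1.norm.div_const r)).mul
    (((h1.norm.pow_const _).inv).mul (measurable_taylorRem_sub hA x))

theorem sum_kernelPiece {ρ : ℝ} (hρ : 0 < ρ) {x y : EuclideanSpace ℝ (Fin d)} {N : ℕ}
    (h1 : ρ ≤ ‖x - y‖) (h2 : ‖x - y‖ ≤ 2 ^ N * ρ) :
    ∑ n ∈ Finset.range (N + 1), Ω (x - y) * kernelPiece A l (2 ^ n * ρ) y (x - y) =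
      commKernel d l A Ω x y := by
  rw [commKernel_eq]
  have h3 := sum_bandCut (r := ‖x - y‖ / ρ) ((one_le_div hρ).mpr h1) ((div_le_iff₀ hρ).mpr h2)
  rw [← Finset.mul_sum]
  congr 1
  unfold kernelPiece
  rw [← Finset.sum_mul]
  simp_rw [div_div, mul_comm ρ] at h3
  rw [h3, one_mul]

theorem abs_kernelPiece_sub_le (hA : ContDiff ℝ (l : ℕ∞) A) (hl : 1 ≤ l)
    (hS : ∀ α : Fin d → ℕ, ∑ i, α i = l → ∀ x, |mderiv d α A x| ≤ S) (hS0 : 0 ≤ S)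
    {r : ℝ} (hr : 0 < r) (y c z : EuclideanSpace ℝ (Fin d)) :
    |kernelPiece A l r y z - kernelPiece A l r c z| ≤
      2 ^ (d + 1) * taylorConst d l * S / r ^ d * (‖y - c‖ / r) := by
  have hT := taylorConst_pos d l
  have h0 : kernelPiece A l r y z - kernelPiece A l r c z =
      bandCut (‖z‖ / r) * ((‖z‖ ^ (d + l))⁻¹ * (taylorRem A l y z - taylorRem A l c z)) := by
    unfold kernelPiece; ring
  rw [h0]
  by_cases hb : bandCut (‖z‖ / r) = 0
  · rw [hb, zero_mul, abs_zero]; positivity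
  · have h1 := (bandCut_ne_zero hb).1
    rw [le_div_iff₀ hr] at h1
    have hz : 0 < ‖z‖ := by linarith
    rw [abs_mul, abs_mul, abs_of_nonneg (by positivity : 0 ≤ (‖z‖ ^ (d + l))⁻¹)]
    calc |bandCut (‖z‖ / r)| * ((‖z‖ ^ (d + l))⁻¹ * |taylorRem A l y z - taylorRem A l c z|)
        ≤ 1 * ((‖z‖ ^ (d + l))⁻¹ * (taylorConst d l * S * ‖y - c‖ * ‖z‖ ^ (l - 1))) := by
          gcongr
          · exact abs_bandCut_le _
          · exact abs_taylorRem_sub_le hA hl hS hS0 _ _ _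
      _ = taylorConst d l * S * ‖y - c‖ / ‖z‖ ^ (d + 1) := by
          obtain ⟨n, rfl⟩ : ∃ n, l = n + 1 := ⟨l - 1, by omega⟩
          rw [Nat.add_sub_cancel, ← add_assoc, add_right_comm d n 1, pow_add _ (d + 1) n]
          field_simp
      _ ≤ taylorConst d l * S * ‖y - c‖ / (1 / 2 * r) ^ (d + 1) := by gcongr
      _ = _ := by rw [mul_pow, pow_succ r, one_div, inv_pow]; field_simp

/-- `Ω` truncated at height `a`. -/
def truncTop (Ω : EuclideanSpace ℝ (Fin d) → ℝ) (a : ℝ) (z : EuclideanSpace ℝ (Fin d)) : ℝ :=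
  if a < |Ω z| then 0 else Ω z

/-- The function controlling the error of truncating `Ω` at height `a` and freezing the kernel. -/
def errorWeight (Ω : EuclideanSpace ℝ (Fin d) → ℝ) (a δ : ℝ) (z : EuclideanSpace ℝ (Fin d)) : ℝ :=
  (if a < |Ω z| then |Ω z| else 0) + δ * |Ω z|

theorem measurable_truncTop (hΩ : Measurable Ω) (a : ℝ) : Measurable (truncTop Ω a) :=
  Measurable.ite (measurableSet_lt measurable_const hΩ.abs) measurable_const hΩ

theorem abs_truncTop_le {a : ℝ} (ha : 0 ≤ a) (z : EuclideanSpace ℝ (Fin d)) :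
    |truncTop Ω a z| ≤ a := by
  unfold truncTop
  split_ifs with h
  · simpa using ha
  · exact not_lt.mp h

theorem abs_truncTop_le_abs (a : ℝ) (z : EuclideanSpace ℝ (Fin d)) :
    |truncTop Ω a z| ≤ |Ω z| := by
  unfold truncTop
  split_ifs with h
  · simp
  · exact le_rfl

theorem measurable_errorWeight (hΩ : Measurable Ω) (a δ : ℝ) : Measurable (errorWeight Ω a δ) :=
  (Measurable.ite (measurableSet_lt measurable_const hΩ.abs) hΩ.abs measurable_const).add
    (hΩ.abs.const_mul _)

theorem errorWeight_nonneg {a δ : ℝ} (hδ : 0 ≤ δ) (z : EuclideanSpace ℝ (Fin d)) :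
    0 ≤ errorWeight Ω a δ z := by
  unfold errorWeight
  split_ifs <;> positivity

theorem exists_abs_kernelPiece_freeze_le (d l : ℕ) (hl : 1 ≤ l) : ∃ D : ℝ, 0 < D ∧
    ∀ {A Ω : EuclideanSpace ℝ (Fin d) → ℝ} {S : ℝ}, ContDiff ℝ (l : ℕ∞) A →
      (∀ α : Fin d → ℕ, ∑ i, α i = l → ∀ x, |mderiv d α A x| ≤ S) → 0 ≤ S →
      ∀ {r δ a : ℝ}, 0 < r → 0 ≤ δ → ∀ {y c z : EuclideanSpace ℝ (Fin d)},
        ‖y - c‖ ≤ (d + 1) * (δ * r) →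
        |Ω z * kernelPiece A l r y z - truncTop Ω a z * kernelPiece A l r c z| ≤
          (closedBall 0 (2 * r)).indicator (fun z => D * S / r ^ d * errorWeight Ω a δ z) z := by
  obtain ⟨K, hK, hK'⟩ := isRadialKernel_kernelPiece d l hl
  have hT := taylorConst_pos d l
  refine ⟨K + 2 ^ (d + 1) * taylorConst d l * (d + 1), by positivity,
    fun {A Ω S} hA hS hS0 {r δ a} hr hδ {y c z} hyc => ?_⟩
  by_cases hz : ‖z‖ ≤ 2 * r
  · rw [Set.indicator_of_mem (by simpa using hz)]
    have h1 := abs_kernelPiece_sub_le hA hl hS hS0 hr y c z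
    have h2 := (hK' hA hS hS0 hr y).bound z
    have h3 : Ω z * kernelPiece A l r y z - truncTop Ω a z * kernelPiece A l r c z =
        (Ω z - truncTop Ω a z) * kernelPiece A l r y z +
          truncTop Ω a z * (kernelPiece A l r y z - kernelPiece A l r c z) := by ring
    have h4 : |Ω z - truncTop Ω a z| = if a < |Ω z| then |Ω z| else 0 := by
      unfold truncTop
      split_ifs <;> simp
    have h5 : ‖y - c‖ / r ≤ (d + 1) * δ := by
      rw [div_le_iff₀ hr]; linarith
    have h6 : 0 ≤ if a < |Ω z| then |Ω z| else 0 := by split_ifs <;> positivity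
    rw [h3]
    refine (abs_add_le _ _).trans ?_
    rw [abs_mul, abs_mul, h4]
    unfold errorWeight
    set w : ℝ := if a < |Ω z| then |Ω z| else 0
    calc w * |kernelPiece A l r y z| +
          |truncTop Ω a z| * |kernelPiece A l r y z - kernelPiece A l r c z|
        ≤ w * (K * S / r ^ d) +
          |Ω z| * (2 ^ (d + 1) * taylorConst d l * S / r ^ d * ((d + 1) * δ)) := by
          exact add_le_add (mul_le_mul_of_nonneg_left h2 h6)
            (mul_le_mul (abs_truncTop_le_abs _ _)
              (h1.trans (mul_le_mul_of_nonneg_left h5 (by positivity))) (abs_nonneg _)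
              (abs_nonneg _))
      _ = K * (S / r ^ d * w) +
          2 ^ (d + 1) * taylorConst d l * (d + 1) * (S / r ^ d * (δ * |Ω z|)) := by ring
      _ ≤ (K + 2 ^ (d + 1) * taylorConst d l * (d + 1)) * (S / r ^ d * w) +
          (K + 2 ^ (d + 1) * taylorConst d l * (d + 1)) * (S / r ^ d * (δ * |Ω z|)) := by
          gcongr
          · exact le_add_of_nonneg_right (by positivity)
          · exact le_add_of_nonneg_left hK.le
      _ = _ := by ring
  · rw [Set.indicator_of_notMem (by simpa using hz)]
    have h1 : ∀ c, kernelPiece A l r c z = 0 := fun c => by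
      by_contra h
      exact hz ((hK' hA hS hS0 hr c).supp z h).2
    rw [h1, h1]
    simp

theorem locallyIntegrable_of_homogeneous (hd : 1 ≤ d) (hΩ : Measurable Ω)
    (hhom : ∀ t : ℝ, 0 < t → ∀ z : EuclideanSpace ℝ (Fin d), z ≠ 0 → Ω (t • z) = Ω z)
    (hL : Integrable (fun θ : sphere (0 : EuclideanSpace ℝ (Fin d)) 1 =>
      |Ω θ| * Real.log (2 + |Ω θ|)) (sphereMeasure d)) : LocallyIntegrable Ω := by
  rw [locallyIntegrable_iff]
  intro k hk
  obtain ⟨R, hR⟩ := hk.isBounded.subset_closedBall (0 : EuclideanSpace ℝ (Fin d))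
  have h1 := lintegral_band_le (r := max R 1) (c := 1) hd hΩ hhom (by positivity) zero_le_one
    (g := (closedBall 0 R).indicator Ω) (fun z => by
      by_cases hz : z ∈ closedBall (0 : EuclideanSpace ℝ (Fin d)) R
      · rw [Set.indicator_of_mem hz, one_mul]
      · rw [Set.indicator_of_notMem hz]; simp) (fun z hz => by
      have h2 := Set.mem_of_indicator_ne_zero hz
      rw [mem_closedBall_zero_iff] at h2
      have h3 := le_max_left R 1
      have h4 := le_max_right R 1
      linarith)
  rw [lintegral_sphere_eq hΩ hL] at h1
  have h2 : Integrable ((closedBall 0 R).indicator Ω) := by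
    refine ⟨(hΩ.indicator measurableSet_closedBall).aestronglyMeasurable, ?_⟩
    rw [HasFiniteIntegral]
    simp_rw [← ofReal_norm, Real.norm_eq_abs]
    exact h1.trans_lt (ENNReal.mul_lt_top ENNReal.ofReal_lt_top ENNReal.ofReal_lt_top)
  exact ((integrable_indicator_iff measurableSet_closedBall).mp h2).mono_set hR

theorem integrable_norm_mul_abs_sub (hΩ : LocallyIntegrable Ω) {F : EuclideanSpace ℝ (Fin d) → ℂ}
    (hF : Continuous F) (hc : HasCompactSupport F) (x : EuclideanSpace ℝ (Fin d)) :
    Integrable fun y => ‖F y‖ * |Ω (x - y)| :=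
  hc.norm.convolutionExists_left (ContinuousLinearMap.mul ℝ ℝ) hF.norm
    (g := fun z => |Ω z|) (fun z => (hΩ z).norm) x

theorem integrableOn_commKernel_mul (hA : ContDiff ℝ (l : ℕ∞) A)
    (hS : ∀ α : Fin d → ℕ, ∑ i, α i = l → ∀ x, |mderiv d α A x| ≤ S) (hS0 : 0 ≤ S)
    (hΩ : Measurable Ω) (hΩ' : LocallyIntegrable Ω) {F : EuclideanSpace ℝ (Fin d) → ℂ}
    (hF : Continuous F) (hc : HasCompactSupport F) (x : EuclideanSpace ℝ (Fin d)) {ε : ℝ}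
    (hε : 0 < ε) :
    IntegrableOn (fun y => ((commKernel d l A Ω x y : ℝ) : ℂ) * F y) {y | ε < ‖x - y‖} := by
  refine Integrable.mono' (g := fun y => taylorConst d l * S / ε ^ d * (‖F y‖ * |Ω (x - y)|))
    ((integrable_norm_mul_abs_sub hΩ' hF hc x).const_mul _).integrableOn
    ((Complex.measurable_ofReal.comp (measurable_commKernel hA hΩ x)).mul
      hF.measurable).aestronglyMeasurable ?_
  refine (ae_restrict_iff' (measurableSet_lt measurable_const
    (measurable_const.sub measurable_id).norm)).mpr (ae_of_all _ fun y hy => ?_)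
  simp only [Set.mem_ofPred_eq, Pi.sub_apply, id_eq] at hy
  rw [norm_mul, Complex.norm_real, Real.norm_eq_abs]
  have := mul_le_mul_of_nonneg_right
    (abs_commKernel_le (Ω := Ω) hA hS hS0 hε (le_of_lt hy)) (norm_nonneg (F y))
  linarith

end CommutatorKernel

section ScaleDecomposition

variable {d l : ℕ} {A Ω : EuclideanSpace ℝ (Fin d) → ℝ} {S : ℝ} {ι : Type}

/-- The part of the operator at scale `n` handled by the `L²` estimate. -/
def mainPiece (A Ω : EuclideanSpace ℝ (Fin d) → ℝ) (l : ℕ) (s : Finset ι) (ρ : ι → ℝ)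
    (c : ι → EuclideanSpace ℝ (Fin d)) (b : ι → EuclideanSpace ℝ (Fin d) → ℂ) (a : ℝ) (n : ℕ)
    (x : EuclideanSpace ℝ (Fin d)) : ℂ :=
  ∑ i ∈ s, ∫ y, b i y *
    ((truncTop Ω a (x - y) * kernelPiece A l (2 ^ n * ρ i) (c i) (x - y) : ℝ) : ℂ)

/-- The part of the operator at scale `n` handled by an `L¹` estimate. -/
def errorPiece (Ω : EuclideanSpace ℝ (Fin d) → ℝ) (D : ℝ) (s : Finset ι) (ρ : ι → ℝ)
    (b : ι → EuclideanSpace ℝ (Fin d) → ℂ) (a : ℝ) (n : ℕ)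
    (x : EuclideanSpace ℝ (Fin d)) : ℝ≥0∞ :=
  ∑ i ∈ s, ∫⁻ y, ‖b i y‖ₑ * ENNReal.ofReal ((closedBall 0 (2 * (2 ^ n * ρ i))).indicator
    (fun z => D / (2 ^ n * ρ i) ^ d * errorWeight Ω a (2 ^ n)⁻¹ z) (x - y))

theorem integrable_mul_of_abs_le (hΩ' : LocallyIntegrable Ω) {F : EuclideanSpace ℝ (Fin d) → ℂ}
    (hF : Continuous F) (hc : HasCompactSupport F) (x : EuclideanSpace ℝ (Fin d))
    {k : EuclideanSpace ℝ (Fin d) → ℝ} (hk : Measurable k) {B : ℝ}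
    (hB : ∀ y, |k y| ≤ B * |Ω (x - y)|) : Integrable fun y => F y * ((k y : ℝ) : ℂ) := by
  refine Integrable.mono' (g := fun y => B * (‖F y‖ * |Ω (x - y)|))
    ((integrable_norm_mul_abs_sub hΩ' hF hc x).const_mul _)
    (hF.measurable.mul (Complex.measurable_ofReal.comp hk)).aestronglyMeasurable
    (ae_of_all _ fun y => ?_)
  rw [norm_mul, Complex.norm_real, Real.norm_eq_abs]
  have := mul_le_mul_of_nonneg_left (hB y) (norm_nonneg (F y))
  linarith

theorem exists_enorm_sum_commKernel_le (d l : ℕ) (hl : 1 ≤ l) : ∃ D : ℝ, 0 < D ∧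
    ∀ {A Ω : EuclideanSpace ℝ (Fin d) → ℝ} {S : ℝ}, ContDiff ℝ (l : ℕ∞) A →
      (∀ α : Fin d → ℕ, ∑ i, α i = l → ∀ x, |mderiv d α A x| ≤ S) → 0 ≤ S →
      Measurable Ω → LocallyIntegrable Ω →
      ∀ {ι : Type} {f : EuclideanSpace ℝ (Fin d) → ℂ} {α : ℝ} {s : Finset ι} {ρ : ι → ℝ}
        {c : ι → EuclideanSpace ℝ (Fin d)} {b : ι → EuclideanSpace ℝ (Fin d) → ℂ},
        IsSmoothDecomposition f α s ρ c b → ∀ (a : ℕ → ℝ) {x : EuclideanSpace ℝ (Fin d)},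
        (∀ i ∈ s, (d + 2) * ρ i ≤ ‖x - c i‖) →
        ‖∑ i ∈ s, ∫ y, ((commKernel d l A Ω x y : ℝ) : ℂ) * b i y‖ₑ ≤
          (∑' n, ‖mainPiece A Ω l s ρ c b (a n) n x‖ₑ) +
            ∑' n, errorPiece Ω (D * S) s ρ b (a n) n x := by
  obtain ⟨D, hD, hD'⟩ := exists_abs_kernelPiece_freeze_le d l hl
  obtain ⟨K, hK, hK'⟩ := isRadialKernel_kernelPiece d l hl
  refine ⟨D, hD, fun {A Ω S} hA hS hS0 hΩ hΩ' {ι f α s ρ c b} hb a {x} hx => ?_⟩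
  have hρ := hb.side_pos
  have hfar : ∀ i ∈ s, ∀ y, b i y ≠ 0 → ρ i ≤ ‖x - y‖ := by
    intro i hi y hy
    have h1 := hx i hi
    have h2 := hb.supp i hi y hy
    have h3 := norm_sub_le_norm_sub_add_norm_sub x y (c i)
    linarith
  obtain ⟨N, hN⟩ : ∃ N : ℕ, ∀ i ∈ s, ∀ y, b i y ≠ 0 → ‖x - y‖ ≤ 2 ^ N * ρ i := by
    have h1 : ∀ i, ∃ N : ℕ, (‖x - c i‖ + (d + 1) * ρ i) / ρ i ≤ (2 : ℝ) ^ N := fun i =>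
      (pow_unbounded_of_one_lt _ (by norm_num)).imp fun _ h => h.le
    choose N hN using h1
    refine ⟨s.sup N, fun i hi y hy => ?_⟩
    have h2 := hb.supp i hi y hy
    have h3 := norm_sub_le_norm_sub_add_norm_sub x (c i) y
    rw [norm_sub_rev (c i) y] at h3
    have h4 := (div_le_iff₀ (hρ i)).mp (hN i)
    have h5 : (2 : ℝ) ^ N i * ρ i ≤ 2 ^ s.sup N * ρ i :=
      mul_le_mul_of_nonneg_right (pow_le_pow_right₀ (by norm_num) (Finset.le_sup hi)) (hρ i).le
    linarith
  have hr : ∀ (n : ℕ) i, 0 < 2 ^ n * ρ i := fun n i => mul_pos (by positivity) (hρ i)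
  have hsub : Measurable fun y : EuclideanSpace ℝ (Fin d) => x - y :=
    measurable_const.sub measurable_id
  have hint1 : ∀ n, ∀ i ∈ s, Integrable fun y =>
      b i y * ((Ω (x - y) * kernelPiece A l (2 ^ n * ρ i) y (x - y) : ℝ) : ℂ) := by
    intro n i hi
    refine integrable_mul_of_abs_le hΩ' (hb.smooth i hi).continuous (hb.compact_supp i hi) x
      ((hΩ.comp hsub).mul (measurable_kernelPiece_sub hA _ x)) (B := K * S / (2 ^ n * ρ i) ^ d)
      fun y => ?_
    rw [abs_mul, mul_comm]
    exact mul_le_mul_of_nonneg_right ((hK' hA hS hS0 (hr n i) y).bound _) (abs_nonneg _)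
  have hint2 : ∀ n, ∀ i ∈ s, Integrable fun y =>
      b i y * ((truncTop Ω (a n) (x - y) * kernelPiece A l (2 ^ n * ρ i) (c i) (x - y) : ℝ) : ℂ) := by
    intro n i hi
    refine integrable_mul_of_abs_le hΩ' (hb.smooth i hi).continuous (hb.compact_supp i hi) x
      (((measurable_truncTop hΩ _).comp hsub).mul
        ((hK' hA hS hS0 (hr n i) (c i)).meas.comp hsub)) (B := K * S / (2 ^ n * ρ i) ^ d)
      fun y => ?_
    rw [abs_mul, mul_comm]
    exact mul_le_mul ((hK' hA hS hS0 (hr n i) (c i)).bound _) (abs_truncTop_le_abs _ _)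
      (abs_nonneg _) (by have := hr n i; positivity)
  have hscale : ∑ i ∈ s, ∫ y, ((commKernel d l A Ω x y : ℝ) : ℂ) * b i y =
      ∑ n ∈ Finset.range (N + 1), ∑ i ∈ s, ∫ y,
        b i y * ((Ω (x - y) * kernelPiece A l (2 ^ n * ρ i) y (x - y) : ℝ) : ℂ) := by
    rw [Finset.sum_comm]
    refine Finset.sum_congr rfl fun i hi => ?_
    rw [← integral_finsetSum _ fun n _ => hint1 n i hi]
    refine integral_congr_ae (ae_of_all _ fun y => ?_)
    simp only
    rw [← Finset.mul_sum, ← Complex.ofReal_sum]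
    by_cases hy : b i y = 0
    · rw [hy, mul_zero, zero_mul]
    · rw [sum_kernelPiece (hρ i) (hfar i hi y hy) (hN i hi y hy), mul_comm]
  have hpiece : ∀ n, ‖∑ i ∈ s, ∫ y,
        b i y * ((Ω (x - y) * kernelPiece A l (2 ^ n * ρ i) y (x - y) : ℝ) : ℂ)‖ₑ ≤
      ‖mainPiece A Ω l s ρ c b (a n) n x‖ₑ + errorPiece Ω (D * S) s ρ b (a n) n x := by
    intro n
    have h1 : ∑ i ∈ s, ∫ y,
        b i y * ((Ω (x - y) * kernelPiece A l (2 ^ n * ρ i) y (x - y) : ℝ) : ℂ) =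
        mainPiece A Ω l s ρ c b (a n) n x + ∑ i ∈ s, ∫ y, b i y *
          ((Ω (x - y) * kernelPiece A l (2 ^ n * ρ i) y (x - y) -
            truncTop Ω (a n) (x - y) * kernelPiece A l (2 ^ n * ρ i) (c i) (x - y) : ℝ) : ℂ) := by
      unfold mainPiece
      rw [← Finset.sum_add_distrib]
      refine Finset.sum_congr rfl fun i hi => ?_
      rw [← sub_eq_iff_eq_add', ← integral_sub (hint1 n i hi) (hint2 n i hi)]
      refine integral_congr_ae (ae_of_all _ fun y => ?_)
      simp only
      push_cast
      ring
    rw [h1]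
    refine (enorm_add_le _ _).trans (add_le_add_right ?_ _)
    refine (enorm_sum_le _ _).trans (Finset.sum_le_sum fun i hi => ?_)
    refine (enorm_integral_le_lintegral_enorm _).trans (lintegral_mono fun y => ?_)
    simp only
    rw [enorm_mul]
    by_cases hy : b i y = 0
    · rw [hy]; simp
    · refine mul_le_mul_right ?_ _
      rw [← ofReal_norm, Complex.norm_real, Real.norm_eq_abs]
      refine ENNReal.ofReal_le_ofReal (hD' hA hS hS0 (hr n i) (by positivity) ?_)
      refine (hb.supp i hi y hy).trans (le_of_eq ?_)
      rw [inv_mul_cancel_left₀ (by positivity)]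
  rw [hscale]
  refine (enorm_sum_le _ _).trans ((Finset.sum_le_sum fun n _ => hpiece n).trans ?_)
  rw [Finset.sum_add_distrib]
  exact add_le_add (ENNReal.sum_le_tsum _) (ENNReal.sum_le_tsum _)

theorem lintegral_conv_eq {b : EuclideanSpace ℝ (Fin d) → ℂ} (hb : Continuous b)
    {G : EuclideanSpace ℝ (Fin d) → ℝ≥0∞} (hG : Measurable G) :
    ∫⁻ x, ∫⁻ y, ‖b y‖ₑ * G (x - y) = (∫⁻ y, ‖b y‖ₑ) * ∫⁻ z, G z := by
  rw [lintegral_lintegral_swap]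
  · rw [← lintegral_mul_const _ hb.measurable.enorm]
    refine lintegral_congr fun y => ?_
    rw [lintegral_const_mul _ (by exact hG.comp (measurable_id.sub_const y)),
      lintegral_sub_right_eq_self (f := G)]
  · exact ((hb.measurable.enorm.comp measurable_snd).mul
      (hG.comp (measurable_fst.sub measurable_snd))).aemeasurable

theorem measurable_errorKernel (hΩ : Measurable Ω) (D a : ℝ) (n : ℕ) (r : ℝ) :
    Measurable fun z => ENNReal.ofReal ((closedBall 0 (2 * r)).indicator
      (fun z => D / r ^ d * errorWeight Ω a (2 ^ n)⁻¹ z) z) :=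
  (((measurable_errorWeight hΩ a _).const_mul _).indicator measurableSet_closedBall).ennreal_ofReal

theorem measurable_errorPiece (hΩ : Measurable Ω) (D : ℝ) (s : Finset ι) (ρ : ι → ℝ)
    {b : ι → EuclideanSpace ℝ (Fin d) → ℂ} (hb : ∀ i ∈ s, Continuous (b i)) (a : ℝ) (n : ℕ) :
    Measurable (errorPiece Ω D s ρ b a n) := by
  unfold errorPiece
  refine Finset.measurable_sum _ fun i hi => Measurable.lintegral_prod_right' (f := fun p :
    EuclideanSpace ℝ (Fin d) × EuclideanSpace ℝ (Fin d) => ‖b i p.2‖ₑ * ENNReal.ofReal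
      ((closedBall 0 (2 * (2 ^ n * ρ i))).indicator
        (fun z => D / (2 ^ n * ρ i) ^ d * errorWeight Ω a (2 ^ n)⁻¹ z) (p.1 - p.2))) ?_
  exact ((hb i hi).measurable.enorm.comp measurable_snd).mul
    ((measurable_errorKernel hΩ D a n _).comp (measurable_fst.sub measurable_snd))

theorem lintegral_errorPiece_le (hd : 1 ≤ d) (hΩ : Measurable Ω)
    (hhom : ∀ t : ℝ, 0 < t → ∀ z : EuclideanSpace ℝ (Fin d), z ≠ 0 → Ω (t • z) = Ω z)
    {D : ℝ} (hD : 0 ≤ D) {s : Finset ι} {ρ : ι → ℝ} (hρ : ∀ i, 0 < ρ i)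
    {b : ι → EuclideanSpace ℝ (Fin d) → ℂ} (hb : ∀ i ∈ s, Continuous (b i)) (a : ℝ) (n : ℕ) :
    ∫⁻ x, errorPiece Ω D s ρ b a n x ≤ ENNReal.ofReal (3 ^ d * D) * (∑ i ∈ s, ∫⁻ y, ‖b i y‖ₑ) *
      ∫⁻ θ : sphere (0 : EuclideanSpace ℝ (Fin d)) 1,
        ENNReal.ofReal (errorWeight Ω a (2 ^ n)⁻¹ θ) ∂(sphereMeasure d) := by
  unfold errorPiece
  rw [lintegral_finsetSum' _ fun i hi => (Measurable.lintegral_prod_right' (f := fun p :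
    EuclideanSpace ℝ (Fin d) × EuclideanSpace ℝ (Fin d) => ‖b i p.2‖ₑ * ENNReal.ofReal
      ((closedBall 0 (2 * (2 ^ n * ρ i))).indicator
        (fun z => D / (2 ^ n * ρ i) ^ d * errorWeight Ω a (2 ^ n)⁻¹ z) (p.1 - p.2)))
    (((hb i hi).measurable.enorm.comp measurable_snd).mul
    ((measurable_errorKernel hΩ D a n _).comp (measurable_fst.sub measurable_snd)))).aemeasurable,
    mul_right_comm, Finset.mul_sum]
  refine Finset.sum_le_sum fun i hi => ?_
  have hr : 0 < 2 ^ n * ρ i := mul_pos (by positivity) (hρ i)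
  rw [lintegral_conv_eq (hb i hi) (measurable_errorKernel hΩ D a n _), mul_comm]
  refine mul_le_mul_left ?_ _
  have hw : ∀ z, 0 ≤ errorWeight Ω a (2 ^ n)⁻¹ z := errorWeight_nonneg (by positivity)
  have h1 := lintegral_band_le (r := 2 ^ n * ρ i) (c := D / (2 ^ n * ρ i) ^ d)
    (g := (closedBall 0 (2 * (2 ^ n * ρ i))).indicator
      (fun z => D / (2 ^ n * ρ i) ^ d * errorWeight Ω a (2 ^ n)⁻¹ z)) hd
    (measurable_errorWeight hΩ a (2 ^ n)⁻¹) (fun t ht z hz => by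
      unfold errorWeight; rw [hhom t ht z hz]) hr (by positivity)
    (fun z => by
      by_cases hz : z ∈ closedBall (0 : EuclideanSpace ℝ (Fin d)) (2 * (2 ^ n * ρ i))
      · rw [Set.indicator_of_mem hz, abs_mul, abs_of_nonneg (by positivity)]
      · rw [Set.indicator_of_notMem hz, abs_zero]; positivity)
    (fun z hz => by simpa using Set.mem_of_indicator_ne_zero hz)
  have h2 : D / (2 ^ n * ρ i) ^ d * (3 * (2 ^ n * ρ i)) ^ d = 3 ^ d * D := by
    rw [mul_pow 3]; field_simp
  rw [h2] at h1
  simp_rw [abs_of_nonneg (hw _)] at h1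
  exact (lintegral_mono fun z => ENNReal.ofReal_le_ofReal (le_abs_self _)).trans h1

theorem tsum_lintegral_errorWeight_le {q : ℝ} (hq : 1 < q) (hΩ : Measurable Ω)
    (hL : Integrable (fun θ : sphere (0 : EuclideanSpace ℝ (Fin d)) 1 =>
      |Ω θ| * Real.log (2 + |Ω θ|)) (sphereMeasure d)) (hN : 0 < sphL1 d Ω) :
    ∑' n : ℕ, ∫⁻ θ : sphere (0 : EuclideanSpace ℝ (Fin d)) 1,
        ENNReal.ofReal (errorWeight Ω (q ^ n * sphL1 d Ω) (2 ^ n)⁻¹ θ) ∂(sphereMeasure d) ≤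
      ENNReal.ofReal ((3 + (Real.log q)⁻¹) * COmega d Ω) := by
  have hlq : 0 < Real.log q := Real.log_pos hq
  refine ENNReal.tsum_le_of_sum_range_le fun k => ?_
  have hm := measurable_sphere_abs hΩ
  have h1 : ∀ n : ℕ, ∫⁻ θ : sphere (0 : EuclideanSpace ℝ (Fin d)) 1,
      ENNReal.ofReal (errorWeight Ω (q ^ n * sphL1 d Ω) (2 ^ n)⁻¹ θ) ∂(sphereMeasure d) =
      (∫⁻ θ : sphere (0 : EuclideanSpace ℝ (Fin d)) 1,
        ENNReal.ofReal (if q ^ n * sphL1 d Ω < |Ω θ| then |Ω θ| else 0) ∂(sphereMeasure d)) +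
      ENNReal.ofReal ((2 ^ n)⁻¹ * sphL1 d Ω) := by
    intro n
    rw [ENNReal.ofReal_mul (by positivity), ← lintegral_sphere_eq hΩ hL,
      ← lintegral_const_mul _ hm.ennreal_ofReal, ← lintegral_add_right _
        (hm.ennreal_ofReal.const_mul _)]
    refine lintegral_congr fun θ => ?_
    rw [← ENNReal.ofReal_mul (by positivity), ← ENNReal.ofReal_add (by split_ifs <;> positivity)
      (by positivity)]
    rfl
  simp_rw [h1]
  rw [Finset.sum_add_distrib]
  have h2 := sum_lintegral_large_le hq hΩ hL hN k
  have h3 : ∑ n ∈ Finset.range k, ENNReal.ofReal ((2 ^ n)⁻¹ * sphL1 d Ω) ≤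
      ENNReal.ofReal (2 * COmega d Ω) := by
    rw [← ENNReal.ofReal_sum_of_nonneg fun n _ => by positivity, ← Finset.sum_mul]
    refine ENNReal.ofReal_le_ofReal (mul_le_mul ?_ (sphL1_le_COmega hΩ hL) hN.le (by norm_num))
    have h4 := Summable.sum_le_tsum (f := fun n : ℕ => ((2:ℝ) ^ n)⁻¹) (Finset.range k)
      (fun n _ => by positivity) (by simpa using summable_geometric_two)
    refine h4.trans (le_of_eq ?_)
    simpa using tsum_geometric_two
  refine (add_le_add h2 h3).trans ?_
  have hC := COmega_nonneg (d := d) (Ω := Ω)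
  rw [← ENNReal.ofReal_add (by positivity) (by positivity)]
  exact ENNReal.ofReal_le_ofReal (by linarith)

end ScaleDecomposition

section WeakType

theorem exists_pow_sixteen_eq_half : ∃ p : ℝ, 0 < p ∧ p < 1 ∧ p ^ 16 = 1 / 2 := by
  refine ⟨(1 / 2 : ℝ) ^ ((16 : ℕ) : ℝ)⁻¹, by positivity, ?_, ?_⟩
  · exact Real.rpow_lt_one (by norm_num) (by norm_num) (by norm_num)
  · exact Real.rpow_inv_natCast_pow (by norm_num) (by norm_num)

/-- A weak-type bound for a series whose terms decay geometrically in `L²`. -/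
theorem measure_lt_tsum_enorm_le {X : Type*} [MeasurableSpace X] {μ : Measure X} {F : ℕ → X → ℂ}
    (hF : ∀ n, Measurable (F n)) {p B t : ℝ} (hp : 0 < p) (hp1 : p < 1) (hB : 0 ≤ B) (ht : 0 < t)
    (h : ∀ n, ∫⁻ x, ‖F n x‖ₑ ^ 2 ∂μ ≤ ENNReal.ofReal (B * p ^ (6 * n))) :
    μ {x | ENNReal.ofReal t < ∑' n, ‖F n x‖ₑ} ≤
      ENNReal.ofReal (B / t ^ 2 * ((1 - p) ^ 2 * (1 - p ^ 4))⁻¹) := by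
  have hp' : 0 < 1 - p := by linarith
  have hp4 : p ^ 4 < 1 := pow_lt_one₀ hp.le hp1 (by norm_num)
  have hp4' : 0 < 1 - p ^ 4 := by linarith
  set ε : ℕ → ℝ := fun n => t * (1 - p) * p ^ n with hε
  have hεpos : ∀ n, 0 < ε n := fun n => by positivity
  have hsub : {x | ENNReal.ofReal t < ∑' n, ‖F n x‖ₑ} ⊆
      ⋃ n, {x | ENNReal.ofReal (ε n ^ 2) ≤ ‖F n x‖ₑ ^ 2} := by
    intro x hx
    by_contra hx'
    simp only [Set.mem_iUnion, Set.mem_ofPred_eq, not_exists, not_le] at hx hx'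
    have h1 : ∀ n, ‖F n x‖ₑ ≤ ENNReal.ofReal (ε n) := by
      intro n
      have h2 := (hx' n).le
      rw [ENNReal.ofReal_pow (hεpos n).le] at h2
      exact (ENNReal.pow_le_pow_left_iff two_ne_zero).mp h2
    have h3 : ∑' n, ENNReal.ofReal (ε n) = ENNReal.ofReal t := by
      have hs : HasSum ε (t * (1 - p) * (1 - p)⁻¹) :=
        (hasSum_geometric_of_lt_one hp.le hp1).mul_left _
      rw [← ENNReal.ofReal_tsum_of_nonneg (fun n => (hεpos n).le) hs.summable, hs.tsum_eq,
        mul_assoc, mul_inv_cancel₀ hp'.ne', mul_one]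
    exact absurd (ENNReal.tsum_le_tsum h1) (not_le.mpr (h3 ▸ hx))
  have hone : ∀ n, μ {x | ENNReal.ofReal (ε n ^ 2) ≤ ‖F n x‖ₑ ^ 2} ≤
      ENNReal.ofReal (B / (t ^ 2 * (1 - p) ^ 2) * (p ^ 4) ^ n) := by
    intro n
    have h1 := (mul_meas_ge_le_lintegral₀ ((hF n).enorm.pow_const 2).aemeasurable
      (ENNReal.ofReal (ε n ^ 2))).trans (h n)
    have hpos : 0 < ε n ^ 2 := pow_pos (hεpos n) 2
    rw [mul_comm, ← ENNReal.le_div_iff_mul_le (Or.inl (by simpa using hpos.ne'))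
      (Or.inl ENNReal.ofReal_ne_top), ← ENNReal.ofReal_div_of_pos hpos] at h1
    refine h1.trans (le_of_eq ?_)
    congr 1
    rw [hε]
    simp only
    rw [← pow_mul, show 6 * n = n * 2 + 4 * n by ring, pow_add, mul_pow, mul_pow, ← pow_mul]
    field_simp
  refine (measure_mono hsub).trans ((measure_iUnion_le _).trans
    ((ENNReal.tsum_le_tsum hone).trans (le_of_eq ?_)))
  have hs : HasSum (fun n => B / (t ^ 2 * (1 - p) ^ 2) * (p ^ 4) ^ n)
      (B / (t ^ 2 * (1 - p) ^ 2) * (1 - p ^ 4)⁻¹) :=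
    (hasSum_geometric_of_lt_one (by positivity) hp4).mul_left _
  rw [← ENNReal.ofReal_tsum_of_nonneg (fun n => by positivity) hs.summable, hs.tsum_eq]
  congr 1
  field_simp

variable {d l : ℕ} {A Ω : EuclideanSpace ℝ (Fin d) → ℝ} {S : ℝ} {ι : Type}

theorem measurable_mainPiece (hl : 1 ≤ l) (hA : ContDiff ℝ (l : ℕ∞) A)
    (hS : ∀ α : Fin d → ℕ, ∑ i, α i = l → ∀ x, |mderiv d α A x| ≤ S) (hS0 : 0 ≤ S)
    (hΩ : Measurable Ω) {s : Finset ι} {ρ : ι → ℝ} (hρ : ∀ i, 0 < ρ i)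
    (c : ι → EuclideanSpace ℝ (Fin d))
    {b : ι → EuclideanSpace ℝ (Fin d) → ℂ} (hb : ∀ i ∈ s, Continuous (b i)) (a : ℝ) (n : ℕ) :
    Measurable (mainPiece A Ω l s ρ c b a n) := by
  obtain ⟨K, hK, hK'⟩ := isRadialKernel_kernelPiece d l hl
  unfold mainPiece
  refine Finset.measurable_sum _ fun i hi => (StronglyMeasurable.integral_prod_right' (f := fun p :
    EuclideanSpace ℝ (Fin d) × EuclideanSpace ℝ (Fin d) => b i p.2 *
    ((truncTop Ω a (p.1 - p.2) * kernelPiece A l (2 ^ n * ρ i) (c i) (p.1 - p.2) : ℝ) : ℂ))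
    ?_).measurable
  have hm := (hK' hA hS hS0 (mul_pos (by positivity) (hρ i) : 0 < 2 ^ n * ρ i) (c i)).meas
  exact (((hb i hi).measurable.comp measurable_snd).mul (Complex.measurable_ofReal.comp
    (((measurable_truncTop hΩ a).mul hm).comp
      (measurable_fst.sub measurable_snd)))).stronglyMeasurable

theorem exists_lintegral_mainPiece_le (d l : ℕ) (hd : 1 ≤ d) (hl : 1 ≤ l) : ∃ C : ℝ, 0 < C ∧
    ∀ {A Ω : EuclideanSpace ℝ (Fin d) → ℝ} {S : ℝ}, ContDiff ℝ (l : ℕ∞) A →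
      (∀ α : Fin d → ℕ, ∑ i, α i = l → ∀ x, |mderiv d α A x| ≤ S) → 0 ≤ S → Measurable Ω →
      (∀ t : ℝ, 0 < t → ∀ z : EuclideanSpace ℝ (Fin d), z ≠ 0 → Ω (t • z) = Ω z) →
      ∀ {ι : Type} {f : EuclideanSpace ℝ (Fin d) → ℂ} {α : ℝ} {s : Finset ι} {ρ : ι → ℝ}
        {c : ι → EuclideanSpace ℝ (Fin d)} {b : ι → EuclideanSpace ℝ (Fin d) → ℂ}, 0 < α →
        IsSmoothDecomposition f α s ρ c b → ∀ {a : ℝ}, 0 ≤ a → ∀ n : ℕ,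
        ∫⁻ x, ‖mainPiece A Ω l s ρ c b a n x‖ₑ ^ 2 ≤
          ENNReal.ofReal (C * √((2 ^ n)⁻¹) * (a * S) ^ 2 * α * ∫ x, ‖f x‖) := by
  have : Nontrivial (EuclideanSpace ℝ (Fin d)) := by
    have : Nonempty (Fin d) := ⟨⟨0, hd⟩⟩
    infer_instance
  obtain ⟨C, hC, hC'⟩ := lintegral_roughSum_le (EuclideanSpace ℝ (Fin d)) (d + 1) (by positivity)
  obtain ⟨K, hK, hK'⟩ := isRadialKernel_kernelPiece d l hl
  refine ⟨C * K ^ 2 * 2 ^ (d + 1) * 2 ^ (d + 1), by positivity,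
    fun {A Ω S} hA hS hS0 hΩ hhom {ι f α s ρ c b} hα hb {a} ha n => ?_⟩
  have hρ := hb.side_pos
  have hr : ∀ i, 0 < 2 ^ n * ρ i := fun i => mul_pos (by positivity) (hρ i)
  have hδr : ∀ i, (2 ^ n : ℝ)⁻¹ * (2 ^ n * ρ i) = ρ i := fun i =>
    inv_mul_cancel_left₀ (by positivity) _
  have hcore : IsCoreData s (fun i => 2 ^ n * ρ i) (fun i => 2 ^ (d + 1) * α * ρ i ^ d) c
      (2 ^ n)⁻¹ (2 ^ (d + 1) * α) (d + 1) (K * S)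
      (fun i => kernelPiece A l (2 ^ n * ρ i) (c i))
      (fun i => kernelPieceRadial A l (2 ^ n * ρ i) (c i)) b :=
    { δ_pos := by positivity
      δ_le := inv_le_one_of_one_le₀ (one_le_pow₀ (by norm_num))
      α_nonneg := by positivity
      M_nonneg := by positivity
      r_pos := fun i _ => hr i
      β_le := fun i _ => by
        have := hρ i
        simp only [hδr, finrank_euclideanSpace_fin]
        exact ⟨by positivity, le_rfl⟩
      disj := by simpa only [hδr] using hb.disj
      kernel := fun i _ => by
        rw [finrank_euclideanSpace_fin]
        exact hK' hA hS hS0 (hr i) (c i)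
      b_int := fun i hi => (hb.smooth i hi).continuous.integrable_of_hasCompactSupport
        (hb.compact_supp i hi)
      b_supp := fun i hi y hy => by
        rw [mul_assoc, hδr]
        exact hb.supp i hi y hy
      b_mean := hb.mean
      b_norm := hb.norm_le }
  refine (hC' s _ _ c _ _ _ _ _ b (truncTop Ω a) a hcore (measurable_truncTop hΩ a)
    (abs_truncTop_le ha) (fun t ht z hz => by unfold truncTop; rw [hhom t ht z hz])).trans ?_
  refine ENNReal.ofReal_le_ofReal ?_
  have h1 : ∑ i ∈ s, 2 ^ (d + 1) * α * ρ i ^ d ≤ 2 ^ (d + 1) * ∫ x, ‖f x‖ := by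
    simp_rw [mul_assoc]
    rw [← Finset.mul_sum]
    exact mul_le_mul_of_nonneg_left hb.sum_side (by positivity)
  calc _ ≤ C * √((2 ^ n)⁻¹) * (a * (K * S)) ^ 2 * (2 ^ (d + 1) * α) *
        (2 ^ (d + 1) * ∫ x, ‖f x‖) := mul_le_mul_of_nonneg_left h1 (by positivity)
    _ = _ := by ring

theorem exists_measure_bad_le (d l : ℕ) (hd : 1 ≤ d) (hl : 1 ≤ l) : ∃ C : ℝ, 0 < C ∧
    ∀ {A Ω : EuclideanSpace ℝ (Fin d) → ℝ} {S : ℝ}, ContDiff ℝ (l : ℕ∞) A →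
      (∀ α : Fin d → ℕ, ∑ i, α i = l → ∀ x, |mderiv d α A x| ≤ S) → 0 ≤ S → Measurable Ω →
      (∀ t : ℝ, 0 < t → ∀ z : EuclideanSpace ℝ (Fin d), z ≠ 0 → Ω (t • z) = Ω z) →
      Integrable (fun θ : sphere (0 : EuclideanSpace ℝ (Fin d)) 1 =>
        |Ω θ| * Real.log (2 + |Ω θ|)) (sphereMeasure d) → 0 < sphL1 d Ω →
      ∀ {ι : Type} {f : EuclideanSpace ℝ (Fin d) → ℂ} {α : ℝ} {s : Finset ι} {ρ : ι → ℝ}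
        {c : ι → EuclideanSpace ℝ (Fin d)} {b : ι → EuclideanSpace ℝ (Fin d) → ℂ}, 0 < α →
        IsSmoothDecomposition f α s ρ c b → ∀ {t : ℝ}, 0 < t →
        volume {x | (∀ i ∈ s, (d + 2) * ρ i ≤ ‖x - c i‖) ∧
          t < ‖∑ i ∈ s, ∫ y, ((commKernel d l A Ω x y : ℝ) : ℂ) * b i y‖} ≤
          ENNReal.ofReal (C * ((COmega d Ω * S) ^ 2 * α / t ^ 2 + COmega d Ω * S / t) *
            ∫ x, ‖f x‖) := by
  obtain ⟨p, hp, hp1, hp16⟩ := exists_pow_sixteen_eq_half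
  obtain ⟨C₁, hC₁, hC₁'⟩ := exists_lintegral_mainPiece_le d l hd hl
  obtain ⟨D, hD, hD'⟩ := exists_enorm_sum_commKernel_le d l hl
  have hq : 1 < p⁻¹ := (one_lt_inv₀ hp).mpr hp1
  have hlq : 0 < Real.log p⁻¹ := Real.log_pos hq
  have hp' : 0 < 1 - p := by linarith
  have hp4 : 0 < 1 - p ^ 4 := by linarith [pow_lt_one₀ hp.le hp1 (show 4 ≠ 0 by norm_num)]
  set G : ℝ := ((1 - p) ^ 2 * (1 - p ^ 4))⁻¹ with hG
  have hG0 : 0 < G := by positivity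
  set H : ℝ := 3 ^ d * D * 2 * (3 + (Real.log p⁻¹)⁻¹) with hH
  have hH0 : 0 < H := by positivity
  refine ⟨4 * C₁ * G + 2 * H, by positivity,
    fun {A Ω S} hA hS hS0 hΩ hhom hL hN {ι f α s ρ c b} hα hb {t} ht => ?_⟩
  have hρ := hb.side_pos
  have hbc : ∀ i ∈ s, Continuous (b i) := fun i hi => (hb.smooth i hi).continuous
  have hΩ' := locallyIntegrable_of_homogeneous hd hΩ hhom hL
  have hCΩ := COmega_nonneg (d := d) (Ω := Ω)
  have hf0 : 0 ≤ ∫ x, ‖f x‖ := integral_nonneg fun _ => norm_nonneg _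
  have hNC := sphL1_le_COmega hΩ hL
  set a : ℕ → ℝ := fun n => p⁻¹ ^ n * sphL1 d Ω with ha
  have ha0 : ∀ n, 0 ≤ a n := fun n => by positivity
  set B : ℝ := C₁ * (sphL1 d Ω * S) ^ 2 * α * ∫ x, ‖f x‖ with hBdef
  have hmain : ∀ n, ∫⁻ x, ‖mainPiece A Ω l s ρ c b (a n) n x‖ₑ ^ 2 ≤
      ENNReal.ofReal (B * p ^ (6 * n)) := by
    intro n
    refine (hC₁' hA hS hS0 hΩ hhom hα hb (ha0 n) n).trans (le_of_eq ?_)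
    congr 1
    have h1 : √((2 ^ n : ℝ)⁻¹) = p ^ (8 * n) := by
      rw [Real.sqrt_eq_iff_mul_self_eq_of_pos (by positivity), ← pow_add,
        show 8 * n + 8 * n = 16 * n by ring, pow_mul, hp16, one_div, inv_pow]
    rw [h1, hBdef, ha]
    simp only
    rw [show 8 * n = n + n + 6 * n by ring, pow_add, pow_add, inv_pow]
    field_simp
  have hM := measure_lt_tsum_enorm_le (μ := volume)
    (fun n => measurable_mainPiece hl hA hS hS0 hΩ hρ c hbc (a n) n) hp hp1
    (by positivity : 0 ≤ B) (half_pos ht) hmain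
  have hE : ∫⁻ x, ∑' n, errorPiece Ω (D * S) s ρ b (a n) n x ≤
      ENNReal.ofReal (H * (COmega d Ω * S) * ∫ x, ‖f x‖) := by
    rw [lintegral_tsum fun n => (measurable_errorPiece hΩ (D * S) s ρ hbc (a n) n).aemeasurable]
    refine (ENNReal.tsum_le_tsum fun n =>
      lintegral_errorPiece_le hd hΩ hhom (by positivity) hρ hbc (a n) n).trans ?_
    rw [ENNReal.tsum_mul_left]
    have h1 : ∑ i ∈ s, ∫⁻ y, ‖b i y‖ₑ ≤ ENNReal.ofReal (2 * ∫ x, ‖f x‖) := by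
      have h2 : ∀ i ∈ s, ∫⁻ y, ‖b i y‖ₑ = ENNReal.ofReal (∫ y, ‖b i y‖) := fun i hi =>
        (ofReal_integral_norm_eq_lintegral_enorm
          ((hbc i hi).integrable_of_hasCompactSupport (hb.compact_supp i hi))).symm
      rw [Finset.sum_congr rfl h2, ← ENNReal.ofReal_sum_of_nonneg fun i _ =>
        integral_nonneg fun _ => norm_nonneg _]
      exact ENNReal.ofReal_le_ofReal hb.sum_norm
    refine (mul_le_mul' (mul_le_mul_right h1 _)
      (tsum_lintegral_errorWeight_le hq hΩ hL hN)).trans (le_of_eq ?_)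
    rw [← ENNReal.ofReal_mul (by positivity), ← ENNReal.ofReal_mul (by positivity)]
    congr 1
    rw [hH]
    ring
  have hEm : AEMeasurable (fun x => ∑' n, errorPiece Ω (D * S) s ρ b (a n) n x) :=
    (Measurable.tsum fun n =>
      measurable_errorPiece hΩ (D * S) s ρ hbc (a n) n).aemeasurable
  have hE' : volume {x | ENNReal.ofReal (t / 2) ≤ ∑' n, errorPiece Ω (D * S) s ρ b (a n) n x} ≤
      ENNReal.ofReal (H * (COmega d Ω * S) * (∫ x, ‖f x‖) / (t / 2)) := by
    have h1 := (mul_meas_ge_le_lintegral₀ hEm (ENNReal.ofReal (t / 2))).trans hE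
    rwa [mul_comm, ← ENNReal.le_div_iff_mul_le (Or.inl (by simpa using ht))
      (Or.inl ENNReal.ofReal_ne_top), ← ENNReal.ofReal_div_of_pos (half_pos ht)] at h1
  have hsub : {x | (∀ i ∈ s, (d + 2) * ρ i ≤ ‖x - c i‖) ∧
      t < ‖∑ i ∈ s, ∫ y, ((commKernel d l A Ω x y : ℝ) : ℂ) * b i y‖} ⊆
      {x | ENNReal.ofReal (t / 2) < ∑' n, ‖mainPiece A Ω l s ρ c b (a n) n x‖ₑ} ∪
      {x | ENNReal.ofReal (t / 2) ≤ ∑' n, errorPiece Ω (D * S) s ρ b (a n) n x} := by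
    rintro x ⟨hx1, hx2⟩
    by_contra hx
    simp only [Set.mem_union, Set.mem_ofPred_eq, not_or, not_lt, not_le] at hx
    have h1 := hD' hA hS hS0 hΩ hΩ' hb a hx1
    have h2 := h1.trans (add_le_add hx.1 hx.2.le)
    rw [← ENNReal.ofReal_add (by positivity) (by positivity), add_halves, ← ofReal_norm,
      ENNReal.ofReal_le_ofReal_iff ht.le] at h2
    exact absurd hx2 (not_lt.mpr h2)
  refine (measure_mono hsub).trans ((measure_union_le _ _).trans ((add_le_add hM hE').trans ?_))
  rw [← ENNReal.ofReal_add (by positivity) (by positivity)]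
  refine ENNReal.ofReal_le_ofReal ?_
  have h1 : B ≤ C₁ * (COmega d Ω * S) ^ 2 * α * ∫ x, ‖f x‖ := by
    rw [hBdef]
    gcongr
  set K := COmega d Ω * S
  have hK : 0 ≤ K := mul_nonneg hCΩ hS0
  set I := ∫ x, ‖f x‖
  calc B / (t / 2) ^ 2 * G + H * K * I / (t / 2)
      ≤ C₁ * K ^ 2 * α * I / (t / 2) ^ 2 * G + H * K * I / (t / 2) := by gcongr
    _ = 4 * C₁ * G * (K ^ 2 * α / t ^ 2 * I) + 2 * H * (K / t * I) := by field_simp; ring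
    _ ≤ (4 * C₁ * G + 2 * H) * (K ^ 2 * α / t ^ 2 * I) +
        (4 * C₁ * G + 2 * H) * (K / t * I) := by
        gcongr
        · exact le_add_of_nonneg_right (by positivity)
        · exact le_add_of_nonneg_left (by positivity)
    _ = _ := by ring

end WeakType

section PrincipalValue

variable {d l : ℕ} {A Ω : EuclideanSpace ℝ (Fin d) → ℝ} {S : ℝ}

/-- `G` is almost everywhere the principal value of the commutator applied to `F`. -/
def IsPrincipalValue (d l : ℕ) (A Ω : EuclideanSpace ℝ (Fin d) → ℝ)
    (F G : EuclideanSpace ℝ (Fin d) → ℂ) : Prop :=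
  ∀ᵐ x : EuclideanSpace ℝ (Fin d) ∂volume,
    Tendsto (fun ε : ℝ => ∫ y in {y : EuclideanSpace ℝ (Fin d) | ε < ‖x - y‖},
      ((commKernel d l A Ω x y : ℝ) : ℂ) * F y) (𝓝[>] 0) (𝓝 (G x))

theorem measurableSet_lt_norm_sub (ε : ℝ) (x : EuclideanSpace ℝ (Fin d)) :
    MeasurableSet {y : EuclideanSpace ℝ (Fin d) | ε < ‖x - y‖} :=
  measurableSet_lt measurable_const (measurable_const.sub measurable_id).norm

theorem IsPrincipalValue.aestronglyMeasurable (hA : ContDiff ℝ (l : ℕ∞) A) (hΩ : Measurable Ω)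
    {F G : EuclideanSpace ℝ (Fin d) → ℂ} (hF : Continuous F) (h : IsPrincipalValue d l A Ω F G) :
    AEStronglyMeasurable G volume := by
  refine aestronglyMeasurable_of_tendsto_ae (𝓝[>] (0 : ℝ)) (fun ε => ?_) h
  have hsub : Measurable fun p : EuclideanSpace ℝ (Fin d) × EuclideanSpace ℝ (Fin d) =>
      p.1 - p.2 := measurable_fst.sub measurable_snd
  have hT : Measurable fun p : EuclideanSpace ℝ (Fin d) × EuclideanSpace ℝ (Fin d) =>
      taylorRem A l p.2 (p.1 - p.2) :=
    ((continuous_taylorRem hA).comp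
      (continuous_snd.prodMk (continuous_fst.sub continuous_snd))).measurable
  have hK : Measurable fun p : EuclideanSpace ℝ (Fin d) × EuclideanSpace ℝ (Fin d) =>
      commKernel d l A Ω p.1 p.2 := by
    simp_rw [commKernel_eq]
    exact (hΩ.comp hsub).mul (((hsub.norm.pow_const _).inv).mul hT)
  have hm : Measurable fun p : EuclideanSpace ℝ (Fin d) × EuclideanSpace ℝ (Fin d) =>
      {p : EuclideanSpace ℝ (Fin d) × EuclideanSpace ℝ (Fin d) | ε < ‖p.1 - p.2‖}.indicator
        (fun p => ((commKernel d l A Ω p.1 p.2 : ℝ) : ℂ) * F p.2) p :=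
    ((Complex.measurable_ofReal.comp hK).mul (hF.measurable.comp measurable_snd)).indicator
      (measurableSet_lt measurable_const hsub.norm)
  have h1 := hm.stronglyMeasurable.integral_prod_right' (ν := volume)
  refine (Eq.subst (motive := StronglyMeasurable) (funext fun x => ?_) h1).aestronglyMeasurable
  rw [← integral_indicator (measurableSet_lt_norm_sub ε x)]
  rfl

theorem IsPrincipalValue.add_sum (hA : ContDiff ℝ (l : ℕ∞) A)
    (hS : ∀ α : Fin d → ℕ, ∑ i, α i = l → ∀ x, |mderiv d α A x| ≤ S) (hS0 : 0 ≤ S)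
    (hΩ : Measurable Ω) (hΩ' : LocallyIntegrable Ω) {ι : Type} {s : Finset ι}
    {f g Tf Tg : EuclideanSpace ℝ (Fin d) → ℂ} {b Tb : ι → EuclideanSpace ℝ (Fin d) → ℂ}
    (hg : Continuous g) (hgc : HasCompactSupport g) (hb : ∀ i ∈ s, Continuous (b i))
    (hbc : ∀ i ∈ s, HasCompactSupport (b i)) (hf : ∀ x, f x = g x + ∑ i ∈ s, b i x)
    (hTf : IsPrincipalValue d l A Ω f Tf) (hTg : IsPrincipalValue d l A Ω g Tg)
    (hTb : ∀ i ∈ s, IsPrincipalValue d l A Ω (b i) (Tb i)) :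
    ∀ᵐ x, Tf x = Tg x + ∑ i ∈ s, Tb i x := by
  have hTb' : ∀ᵐ x : EuclideanSpace ℝ (Fin d) ∂volume, ∀ i ∈ s,
      Tendsto (fun ε : ℝ => ∫ y in {y : EuclideanSpace ℝ (Fin d) | ε < ‖x - y‖},
        ((commKernel d l A Ω x y : ℝ) : ℂ) * b i y) (𝓝[>] 0) (𝓝 (Tb i x)) :=
    (ae_ball_iff s.countable_toSet).mpr hTb
  filter_upwards [hTf, hTg, hTb'] with x h1 h2 h3
  refine tendsto_nhds_unique h1 ((h2.add (tendsto_finsetSum s h3)).congr' ?_)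
  filter_upwards [self_mem_nhdsWithin] with ε hε
  have hε' : 0 < ε := hε
  have hbi : ∀ i ∈ s, IntegrableOn (fun y => ((commKernel d l A Ω x y : ℝ) : ℂ) * b i y)
      {y | ε < ‖x - y‖} := fun i hi =>
    integrableOn_commKernel_mul hA hS hS0 hΩ hΩ' (hb i hi) (hbc i hi) x hε'
  rw [← integral_finsetSum s hbi, ← integral_add
    (integrableOn_commKernel_mul hA hS hS0 hΩ hΩ' hg hgc x hε') (integrable_finsetSum s hbi)]
  simp_rw [hf, mul_add, Finset.mul_sum]

theorem IsPrincipalValue.eq_integral {ι : Type} {s : Finset ι}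
    {ρ : ι → ℝ} {c : ι → EuclideanSpace ℝ (Fin d)} {b Tb : ι → EuclideanSpace ℝ (Fin d) → ℂ}
    (hρ : ∀ i, 0 < ρ i) (hsupp : ∀ i ∈ s, ∀ y, b i y ≠ 0 → ‖y - c i‖ ≤ (d + 1) * ρ i)
    (hTb : ∀ i ∈ s, IsPrincipalValue d l A Ω (b i) (Tb i)) :
    ∀ᵐ x, (∀ i ∈ s, (d + 2) * ρ i ≤ ‖x - c i‖) →
      ∀ i ∈ s, Tb i x = ∫ y, ((commKernel d l A Ω x y : ℝ) : ℂ) * b i y := by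
  have hTb' : ∀ᵐ x : EuclideanSpace ℝ (Fin d) ∂volume, ∀ i ∈ s,
      Tendsto (fun ε : ℝ => ∫ y in {y : EuclideanSpace ℝ (Fin d) | ε < ‖x - y‖},
        ((commKernel d l A Ω x y : ℝ) : ℂ) * b i y) (𝓝[>] 0) (𝓝 (Tb i x)) :=
    (ae_ball_iff s.countable_toSet).mpr hTb
  filter_upwards [hTb'] with x h hx i hi
  refine tendsto_nhds_unique (h i hi) (tendsto_const_nhds.congr' ?_)
  filter_upwards [Ioo_mem_nhdsGT (hρ i)] with ε hε
  refine (setIntegral_eq_integral_of_forall_compl_eq_zero fun y hy => ?_).symm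
  by_cases hb : b i y = 0
  · rw [hb, mul_zero]
  · exfalso
    apply hy
    have h1 := hsupp i hi y hb
    have h2 := norm_sub_le_norm_sub_add_norm_sub x y (c i)
    have h3 := hx i hi
    have h4 := hε.2
    change ε < ‖x - y‖
    linarith

end PrincipalValue

section WeakType

variable {d : ℕ}

theorem measure_lt_norm_le_of_eLpNorm_two_le {g G : EuclideanSpace ℝ (Fin d) → ℂ}
    (hG : AEStronglyMeasurable G volume) (hg : Integrable g) {M B t : ℝ}
    (hM : ∀ x, ‖g x‖ ≤ M) (hB : 0 ≤ B) (ht : 0 < t)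
    (h : eLpNorm G 2 volume ≤ ENNReal.ofReal B * eLpNorm g 2 volume) :
    volume {x | t < ‖G x‖} ≤ ENNReal.ofReal (B ^ 2 * M / t ^ 2 * ∫ x, ‖g x‖) := by
  have hM0 : 0 ≤ M := (norm_nonneg _).trans (hM 0)
  have hsq : ∀ H : EuclideanSpace ℝ (Fin d) → ℂ,
      eLpNorm H 2 volume ^ 2 = ∫⁻ x, ‖H x‖ₑ ^ 2 := fun H => by
    simpa using eLpNorm_nnreal_pow_eq_lintegral (f := H) (μ := volume) (p := 2) (by norm_num)
  have h1 : ∫⁻ x, ‖g x‖ₑ ^ 2 ≤ ENNReal.ofReal (M * ∫ x, ‖g x‖) := by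
    rw [ENNReal.ofReal_mul hM0, ofReal_integral_norm_eq_lintegral_enorm hg,
      ← lintegral_const_mul' _ _ ENNReal.ofReal_ne_top]
    refine lintegral_mono fun x => ?_
    rw [pow_two]
    gcongr
    rw [← ofReal_norm]
    exact ENNReal.ofReal_le_ofReal (hM x)
  have h2 : ∫⁻ x, ‖G x‖ₑ ^ 2 ≤ ENNReal.ofReal (B ^ 2 * (M * ∫ x, ‖g x‖)) := by
    rw [← hsq, ENNReal.ofReal_mul (by positivity), ENNReal.ofReal_pow hB]
    refine (pow_le_pow_left' h 2).trans ?_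
    rw [mul_pow, hsq]
    gcongr
  have h3 := (mul_meas_ge_le_lintegral₀ (hG.enorm.pow_const 2)
    (ENNReal.ofReal (t ^ 2))).trans h2
  have hpos : 0 < t ^ 2 := by positivity
  rw [mul_comm, ← ENNReal.le_div_iff_mul_le (Or.inl (by simpa using hpos.ne'))
    (Or.inl ENNReal.ofReal_ne_top), ← ENNReal.ofReal_div_of_pos hpos] at h3
  refine (measure_mono fun x hx => ?_).trans (h3.trans (le_of_eq ?_))
  · have hx' : t < ‖G x‖ := hx
    change ENNReal.ofReal (t ^ 2) ≤ ‖G x‖ₑ ^ 2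
    rw [enorm_sq_eq_ofReal]
    gcongr
  · congr 1
    ring

theorem IsSmoothDecomposition.measure_exceptional_le {ι : Type} {f : EuclideanSpace ℝ (Fin d) → ℂ}
    {α : ℝ} {s : Finset ι} {ρ : ι → ℝ} {c : ι → EuclideanSpace ℝ (Fin d)}
    {b : ι → EuclideanSpace ℝ (Fin d) → ℂ} (h : IsSmoothDecomposition f α s ρ c b) (hα : 0 < α) :
    volume {x | ∃ i ∈ s, ‖x - c i‖ < (d + 2) * ρ i} ≤
      ENNReal.ofReal ((d + 2) ^ d * volume.real (ball (0 : EuclideanSpace ℝ (Fin d)) 1) / α *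
        ∫ x, ‖f x‖) := by
  have h1 : {x | ∃ i ∈ s, ‖x - c i‖ < (d + 2) * ρ i} = ⋃ i ∈ s, ball (c i) ((d + 2) * ρ i) := by
    ext x
    simp [dist_eq_norm]
  have h2 : ∀ i, volume (ball (c i) ((d + 2) * ρ i)) = ENNReal.ofReal
      (((d + 2) * ρ i) ^ d * volume.real (ball (0 : EuclideanSpace ℝ (Fin d)) 1)) := fun i => by
    have hρ := h.side_pos i
    rw [Measure.addHaar_ball_of_pos _ _ (by positivity), ENNReal.ofReal_mul (by positivity),
      ofReal_measureReal, finrank_euclideanSpace_fin]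
  rw [h1]
  refine (measure_biUnion_finset_le s _).trans ?_
  simp_rw [h2]
  rw [← ENNReal.ofReal_sum_of_nonneg fun i _ => by have := h.side_pos i; positivity]
  refine ENNReal.ofReal_le_ofReal ?_
  calc ∑ i ∈ s, ((d + 2) * ρ i) ^ d * volume.real (ball (0 : EuclideanSpace ℝ (Fin d)) 1)
      = (d + 2) ^ d * volume.real (ball (0 : EuclideanSpace ℝ (Fin d)) 1) / α *
        ∑ i ∈ s, α * ρ i ^ d := by
        rw [Finset.mul_sum]
        refine Finset.sum_congr rfl fun i _ => ?_
        rw [mul_pow]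
        field_simp
    _ ≤ _ := by
        gcongr
        exact h.sum_side

end WeakType

theorem exists_measure_lt_norm_le (d l : ℕ) (hd : 1 ≤ d) (hl : 1 ≤ l) (A₀ : ℝ) :
    ∃ C : ℝ, 0 < C ∧ ∀ {A Ω : EuclideanSpace ℝ (Fin d) → ℝ} {S : ℝ}
      {T : (EuclideanSpace ℝ (Fin d) → ℂ) → EuclideanSpace ℝ (Fin d) → ℂ},
      ContDiff ℝ (l : ℕ∞) A →
      (∀ α : Fin d → ℕ, ∑ i, α i = l → ∀ x, |mderiv d α A x| ≤ S) → 0 < S → Measurable Ω →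
      (∀ t : ℝ, 0 < t → ∀ z : EuclideanSpace ℝ (Fin d), z ≠ 0 → Ω (t • z) = Ω z) →
      Integrable (fun θ : sphere (0 : EuclideanSpace ℝ (Fin d)) 1 =>
        |Ω θ| * Real.log (2 + |Ω θ|)) (sphereMeasure d) → 0 < COmega d Ω →
      (∀ F, ContDiff ℝ (⊤ : ℕ∞) F → HasCompactSupport F → IsPrincipalValue d l A Ω F (T F)) →
      (∀ F, ContDiff ℝ (⊤ : ℕ∞) F → HasCompactSupport F →
        eLpNorm (T F) 2 volume ≤ ENNReal.ofReal (A₀ * (COmega d Ω * S)) * eLpNorm F 2 volume) →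
      ∀ {lam : ℝ}, 0 < lam → ∀ {f}, ContDiff ℝ (⊤ : ℕ∞) f → HasCompactSupport f →
        volume {x | lam < ‖T f x‖} ≤
          ENNReal.ofReal (C * (COmega d Ω * S / lam) * ∫ x, ‖f x‖) := by
  obtain ⟨C, hC, hC'⟩ := exists_measure_bad_le d l hd hl
  set V : ℝ := volume.real (ball (0 : EuclideanSpace ℝ (Fin d)) 1) with hV
  have hV0 : 0 ≤ V := measureReal_nonneg
  set B : ℝ := max A₀ 0 with hB
  have hB0 : 0 ≤ B := le_max_right _ _
  refine ⟨12 * B ^ 2 * (2 ^ d + 3) + (d + 2) ^ d * V + 6 * C, by positivity, ?_⟩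
  intro A Ω S T hA hS hS0 hΩ hhom hL hCΩ hPV hT lam hlam f hf hfc
  set K : ℝ := COmega d Ω * S with hK
  have hK0 : 0 < K := mul_pos hCΩ hS0
  set α : ℝ := lam / K with hα
  have hα0 : 0 < α := div_pos hlam hK0
  obtain ⟨s, ρ, c, b, hD⟩ := exists_smooth_decomposition hd hf.continuous hfc hα0
  set I : ℝ := ∫ x, ‖f x‖ with hI
  have hI0 : 0 ≤ I := integral_nonneg fun _ => norm_nonneg _
  set g : EuclideanSpace ℝ (Fin d) → ℂ := fun x => f x - ∑ i ∈ s, b i x with hg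
  have hbsum : ContDiff ℝ (⊤ : ℕ∞) fun x => ∑ i ∈ s, b i x := ContDiff.sum hD.smooth
  have hgs : ContDiff ℝ (⊤ : ℕ∞) g := hf.sub hbsum
  have hbc : HasCompactSupport fun x => ∑ i ∈ s, b i x := by
    have h := HasCompactSupport.intro' (f := fun x => ∑ i ∈ s, b i x)
      (K := ⋃ i ∈ s, tsupport (b i)) (s.isCompact_biUnion fun i hi => hD.compact_supp i hi)
      (isClosed_biUnion_finset fun i _ => isClosed_tsupport (b i)) fun x hx => by
        refine Finset.sum_eq_zero fun i hi => image_eq_zero_of_notMem_tsupport fun h => hx ?_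
        exact Set.mem_biUnion (by exact hi) h
    exact h
  have hgc : HasCompactSupport g := hfc.sub hbc
  have hbi : ∀ i ∈ s, Integrable (b i) := fun i hi =>
    (hD.smooth i hi).continuous.integrable_of_hasCompactSupport (hD.compact_supp i hi)
  have hfi : Integrable f := hf.continuous.integrable_of_hasCompactSupport hfc
  have hgi : Integrable g := hgs.continuous.integrable_of_hasCompactSupport hgc
  have hgI : ∫ x, ‖g x‖ ≤ 3 * I := by
    calc ∫ x, ‖g x‖ ≤ ∫ x, (‖f x‖ + ∑ i ∈ s, ‖b i x‖) := by
          refine integral_mono hgi.norm (hfi.norm.add (integrable_finsetSum s fun i hi =>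
            (hbi i hi).norm)) fun x => ?_
          exact (norm_sub_le _ _).trans (by gcongr; exact norm_sum_le _ _)
      _ = I + ∑ i ∈ s, ∫ x, ‖b i x‖ := by
          rw [integral_add hfi.norm (integrable_finsetSum s fun i hi => (hbi i hi).norm),
            integral_finsetSum s fun i hi => (hbi i hi).norm]
      _ ≤ 3 * I := by linarith [hD.sum_norm]
  have hgood : volume {x | lam / 2 < ‖T g x‖} ≤
      ENNReal.ofReal (12 * B ^ 2 * (2 ^ d + 3) * (K / lam) * I) := by
    refine (measure_lt_norm_le_of_eLpNorm_two_le
      ((hPV g hgs hgc).aestronglyMeasurable hA hΩ hgs.continuous) hgi hD.good_le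
      (B := B * K) (by positivity) (half_pos hlam) ((hT g hgs hgc).trans ?_)).trans ?_
    · gcongr
      exact le_max_left _ _
    · refine ENNReal.ofReal_le_ofReal ?_
      calc (B * K) ^ 2 * ((2 ^ d + 3) * α) / (lam / 2) ^ 2 * ∫ x, ‖g x‖
          ≤ (B * K) ^ 2 * ((2 ^ d + 3) * α) / (lam / 2) ^ 2 * (3 * I) := by gcongr
        _ = 12 * B ^ 2 * (2 ^ d + 3) * (K / lam) * I := by
          rw [hα, mul_pow, div_pow]
          field_simp
          ring
  have hexc : volume {x | ∃ i ∈ s, ‖x - c i‖ < (d + 2) * ρ i} ≤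
      ENNReal.ofReal ((d + 2) ^ d * V * (K / lam) * I) := by
    refine (hD.measure_exceptional_le hα0).trans (le_of_eq ?_)
    rw [hα, ← hV, ← hI]
    congr 1
    field_simp
  have hbad : volume {x | (∀ i ∈ s, (d + 2) * ρ i ≤ ‖x - c i‖) ∧
      lam / 2 < ‖∑ i ∈ s, ∫ y, ((commKernel d l A Ω x y : ℝ) : ℂ) * b i y‖} ≤
      ENNReal.ofReal (6 * C * (K / lam) * I) := by
    refine (hC' hA hS hS0.le hΩ hhom hL (sphL1_pos hΩ hL hCΩ) hα0 hD (half_pos hlam)).trans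
      (le_of_eq ?_)
    rw [← hK, hα]
    congr 1
    field_simp
    ring
  have hae : ∀ᵐ x, lam < ‖T f x‖ → x ∈ {x | lam / 2 < ‖T g x‖} ∪
      {x | ∃ i ∈ s, ‖x - c i‖ < (d + 2) * ρ i} ∪ {x | (∀ i ∈ s, (d + 2) * ρ i ≤ ‖x - c i‖) ∧
      lam / 2 < ‖∑ i ∈ s, ∫ y, ((commKernel d l A Ω x y : ℝ) : ℂ) * b i y‖} := by
    have hPVb : ∀ i ∈ s, IsPrincipalValue d l A Ω (b i) (T (b i)) := fun i hi =>
      hPV _ (hD.smooth i hi) (hD.compact_supp i hi)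
    filter_upwards [IsPrincipalValue.add_sum hA hS hS0.le hΩ
      (locallyIntegrable_of_homogeneous hd hΩ hhom hL) hgs.continuous hgc
      (fun i hi => (hD.smooth i hi).continuous) hD.compact_supp
      (fun x => (sub_add_cancel (f x) (∑ i ∈ s, b i x)).symm) (hPV f hf hfc) (hPV g hgs hgc) hPVb,
      IsPrincipalValue.eq_integral hD.side_pos hD.supp hPVb] with x h1 h2 hx
    by_cases hE : ∃ i ∈ s, ‖x - c i‖ < (d + 2) * ρ i
    · exact Or.inl (Or.inr hE)
    push Not at hE
    by_cases hG : lam / 2 < ‖T g x‖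
    · exact Or.inl (Or.inl hG)
    refine Or.inr ⟨hE, ?_⟩
    rw [h1, Finset.sum_congr rfl (h2 hE)] at hx
    have h3 := norm_add_le (T g x) (∑ i ∈ s, ∫ y, ((commKernel d l A Ω x y : ℝ) : ℂ) * b i y)
    linarith [not_lt.mp hG]
  refine (measure_mono_ae hae).trans ((measure_union_le _ _).trans
    ((add_le_add ((measure_union_le _ _).trans (add_le_add hgood hexc)) hbad).trans (le_of_eq ?_)))
  rw [← ENNReal.ofReal_add (by positivity) (by positivity),
    ← ENNReal.ofReal_add (by positivity) (by positivity)]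
  congr 1
  ring

theorem bajsanski_coifman_commutator_weak11
    (d : ℕ) (hd : 2 ≤ d) (l : ℕ) (hl : 1 ≤ l) (A₀ : ℝ) (hA₀ : 0 < A₀) :
    ∃ C : ℝ, 0 < C ∧
      ∀ (Ω : EuclideanSpace ℝ (Fin d) → ℝ)
        (A : EuclideanSpace ℝ (Fin d) → ℝ)
        (T : (EuclideanSpace ℝ (Fin d) → ℂ) → EuclideanSpace ℝ (Fin d) → ℂ),
        -- Ω is measurable, homogeneous of degree zero, and in L log⁺ L(S^{d-1})
        Measurable Ω →
        (∀ r : ℝ, 0 < r → ∀ x : EuclideanSpace ℝ (Fin d), x ≠ 0 → Ω (r • x) = Ω x) →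
        Integrable (fun θ : sphere (0 : EuclideanSpace ℝ (Fin d)) 1 =>
          |Ω θ| * Real.log (2 + |Ω θ|)) (sphereMeasure d) →
        -- moment (cancellation) conditions: ∫ Ω(θ) θ^α dθ = 0 for all |α| = l
        (∀ α : Fin d → ℕ, (∑ i, α i) = l →
          ∫ θ : sphere (0 : EuclideanSpace ℝ (Fin d)) 1,
            Ω θ * ∏ i, ((θ : EuclideanSpace ℝ (Fin d)) i) ^ (α i) ∂(sphereMeasure d) = 0) →
        -- A is of class C^l with all derivatives of order l bounded
        ContDiff ℝ (l : ℕ∞) A →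
        (∀ α : Fin d → ℕ, (∑ i, α i) = l →
          ∃ M : ℝ, ∀ x, |mderiv d α A x| ≤ M) →
        -- T f is the a.e. principal value of the Bajsanski–Coifman commutator
        (∀ f : EuclideanSpace ℝ (Fin d) → ℂ, ContDiff ℝ (⊤ : ℕ∞) f → HasCompactSupport f →
          ∀ᵐ x : EuclideanSpace ℝ (Fin d) ∂volume,
            Tendsto (fun ε : ℝ =>
                ∫ y in {y : EuclideanSpace ℝ (Fin d) | ε < ‖x - y‖},
                  ((Ω (x - y) / ‖x - y‖ ^ d * (Pl d l A x y / ‖x - y‖ ^ l) : ℝ) : ℂ) * f y)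
              (𝓝[>] 0) (𝓝 (T f x))) →
        -- the L² bound (Bajsanski–Coifman, Theorem F)
        (∀ f : EuclideanSpace ℝ (Fin d) → ℂ, ContDiff ℝ (⊤ : ℕ∞) f → HasCompactSupport f →
          eLpNorm (T f) 2 volume ≤
            ENNReal.ofReal (A₀ * sphLlogL d Ω * sumSupDeriv d l A) * eLpNorm f 2 volume) →
        -- weak type (1,1) bound
        ∀ lam : ℝ, 0 < lam →
          ∀ f : EuclideanSpace ℝ (Fin d) → ℂ, ContDiff ℝ (⊤ : ℕ∞) f → HasCompactSupport f →
            volume {x : EuclideanSpace ℝ (Fin d) | lam < ‖T f x‖} ≤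
              ENNReal.ofReal (C * lam⁻¹ * COmega d Ω * sumSupDeriv d l A) *
                eLpNorm f 1 volume := by
  obtain ⟨C, hC, hC'⟩ := exists_measure_lt_norm_le d l (by omega) hl A₀
  refine ⟨C, hC, ?_⟩
  intro Ω A T hΩ hhom hL _ hA hbdd hPV hT lam hlam f hf hfc
  have hfi : Integrable f := hf.continuous.integrable_of_hasCompactSupport hfc
  have hPV' : ∀ F, ContDiff ℝ (⊤ : ℕ∞) F → HasCompactSupport F →
    IsPrincipalValue d l A Ω F (T F) := hPV
  have hCΩ : 0 ≤ COmega d Ω := COmega_nonneg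
  have hS0 : 0 ≤ sumSupDeriv d l A := sumSupDeriv_nonneg l A
  have hT' : ∀ F : EuclideanSpace ℝ (Fin d) → ℂ, ContDiff ℝ (⊤ : ℕ∞) F → HasCompactSupport F →
      eLpNorm (T F) 2 volume ≤
        ENNReal.ofReal (A₀ * (COmega d Ω * sumSupDeriv d l A)) * eLpNorm F 2 volume := by
    intro F hF hFc
    refine (hT F hF hFc).trans ?_
    rw [mul_assoc]
    gcongr
    exact sphLlogL_le_COmega
  rw [eLpNorm_one_eq_lintegral_enorm, ← ofReal_integral_norm_eq_lintegral_enorm hfi,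
    ← ENNReal.ofReal_mul (by positivity)]
  rcases (mul_nonneg hCΩ hS0).eq_or_lt with hK | hK
  · have h0 : eLpNorm (T f) 2 volume = 0 := by
      have h := hT' f hf hfc
      rw [← hK, mul_zero, ENNReal.ofReal_zero, zero_mul] at h
      exact le_antisymm h bot_le
    rw [eLpNorm_eq_zero_iff ((hPV' f hf hfc).aestronglyMeasurable hA hΩ hf.continuous)
      two_ne_zero] at h0
    refine (le_of_eq ?_).trans bot_le
    refine measure_eq_zero_iff_ae_notMem.mpr ?_
    filter_upwards [h0] with x hx h
    have hx' : lam < ‖T f x‖ := h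
    rw [hx, Pi.zero_apply, norm_zero] at hx'
    exact absurd hx' hlam.not_gt
  · have hS0' : 0 < sumSupDeriv d l A := pos_of_mul_pos_right hK hCΩ
    refine (hC' hA (fun α hα x => abs_mderiv_le_sumSupDeriv hbdd hα x) hS0' hΩ hhom hL
      (pos_of_mul_pos_left hK hS0) hPV' hT' hlam hf hfc).trans (le_of_eq ?_)
    congr 1
    rw [div_eq_mul_inv]
    ring

end
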